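/- Let 𝓕 be a countable class of measurable functions from S into [0,1], X₁,…,Xₙ i.i.d. with law P, and t > 0. Set l(δ) = 2 log( (π/√3) log₂(2/δ) ). Let U(δ) be the largest solution of the equation U = δ + 8·E_ε[ sup{ |R_n(f)| : f∈𝓕, P_n f ≤ U } ] + √( 2δ(t + l(δ))/n ) + 10(t + l(δ))/(3n), and let r(δ) be the largest solution of the equation r = δ + 8·E_ε[ sup{ |R_n(f)| : f∈𝓕, P_n f ≤ U(2r) } ] + √( 4r(t + l(2r))/n ) + 10(t + l(2r))/(3n). Then with probability at least 1 − 2e^{−t}, simultaneously for all f ∈ 𝓕: P f ≤ r(P_n f). -/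

import Mathlib

open MeasureTheory ProbabilityTheory Real Set

noncomputable section

/-- The `ε`-covering number of `F`: the minimal number of closed balls of radius `ε`
with centers in `F` needed to cover `F`. -/
def coveringNum {E : Type*} [PseudoMetricSpace E] (F : Set E) (ε : ℝ) : ℕ :=
  sInf {n : ℕ | ∃ s : Finset E, ↑s ⊆ F ∧ s.card = n ∧ F ⊆ ⋃ c ∈ s, Metric.closedBall c ε}

/-- The `ε`-entropy of `F`. -/
def entropy {E : Type*} [PseudoMetricSpace E] (F : Set E) (ε : ℝ) : ℝ :=
  Real.log (coveringNum F ε)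

/-- `W` is an isonormal Gaussian process on the Hilbert space `H` with respect to the
probability measure `μ`: every finite linear combination `∑ cᵢ • W (hᵢ)` is a centered
Gaussian random variable with variance `‖∑ cᵢ • hᵢ‖²`; in particular each `W h` is
centered Gaussian and `E[W h * W h'] = ⟪h, h'⟫`. -/
structure IsIsonormal {H : Type*} [NormedAddCommGroup H] [InnerProductSpace ℝ H]
    {Ω : Type*} [MeasurableSpace Ω] (μ : Measure Ω) (W : H → Ω → ℝ) : Prop where
  meas : ∀ h, Measurable (W h)
  gaussian : ∀ (m : ℕ) (h : Fin m → H) (c : Fin m → ℝ),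
    μ.map (fun ω => ∑ i, c i * W (h i) ω) = gaussianReal 0 (‖∑ i, c i • h i‖₊ ^ 2)

/-- The continuity modulus `ω(F, δ)` of the process `W` on the class `F`. -/
def modulus {H : Type*} [NormedAddCommGroup H] [InnerProductSpace ℝ H]
    {Ω : Type*} [MeasurableSpace Ω] (μ : Measure Ω) (W : H → Ω → ℝ)
    (F : Set H) (δ : ℝ) : ℝ :=
  ∫ ω, sSup {a : ℝ | ∃ f ∈ F, ∃ g ∈ F, ‖f - g‖ ≤ δ ∧ a = |W f ω - W g ω|} ∂μ

/-- `A` is a maximal `ε`-separated subset of `F`. -/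
def IsMaxSeparated {E : Type*} [PseudoMetricSpace E] (F A : Set E) (ε : ℝ) : Prop :=
  A ⊆ F ∧ (∀ x ∈ A, ∀ y ∈ A, x ≠ y → ε ≤ dist x y) ∧
    ∀ B : Set E, A ⊆ B → B ⊆ F → (∀ x ∈ B, ∀ y ∈ B, x ≠ y → ε ≤ dist x y) → B = A
/-- The sign `±1` associated to a Boolean coin flip. -/
def radSign (b : Bool) : ℝ := if b then 1 else -1

/-- The law of `n` i.i.d. Rademacher (fair ±1) coin flips. -/
def radMeasure (n : ℕ) : Measure (Fin n → Bool) :=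
  Measure.pi fun _ => (PMF.uniformOfFintype Bool).toMeasure

/-- Empirical mean `P_n f = n⁻¹ ∑ f(xᵢ)`. -/
def empMean {S : Type*} (n : ℕ) (x : Fin n → S) (f : S → ℝ) : ℝ :=
  (∑ i, f (x i)) / n

/-- Rademacher average `R_n f = n⁻¹ ∑ εᵢ f(xᵢ)`. -/
def radAvg {S : Type*} (n : ℕ) (x : Fin n → S) (σ : Fin n → Bool) (f : S → ℝ) : ℝ :=
  (∑ i, radSign (σ i) * f (x i)) / n

/-- `E_ε [ sup { |R_n f| : f ∈ 𝓕, P_n f ≤ u } ]`, the localized Rademacher complexity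
(conditionally on the sample `x`). -/
def radSup {S : Type*} (n : ℕ) (𝓕 : Set (S → ℝ)) (x : Fin n → S) (u : ℝ) : ℝ :=
  ∫ σ, sSup {a : ℝ | ∃ f ∈ 𝓕, empMean n x f ≤ u ∧ a = |radAvg n x σ f|} ∂(radMeasure n)

/-- `l(δ) = 2 log( (π/√3) log₂(2/δ) )`. -/
def ell (δ : ℝ) : ℝ := 2 * Real.log (π / Real.sqrt 3 * Real.logb 2 (2 / δ))


section

open MeasureTheory ProbabilityTheory Real Set


namespace GB

/-- Convex functionals on `ι → ℝ` that grow at most like the maximum. -/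
structure Nice {ι : Type*} (Q : (ι → ℝ) → ℝ) : Prop where
  convex : ConvexOn ℝ univ Q
  growth : ∀ (Φ v : ι → ℝ) (M : ℝ), (∀ i, v i ≤ M) → Q (Φ + v) ≤ Q Φ + M

lemma Nice.lower {ι : Type*} {Q : (ι → ℝ) → ℝ} (hQ : Nice Q) (Φ v : ι → ℝ) (M : ℝ)
    (h : ∀ i, -M ≤ v i) : Q Φ - M ≤ Q (Φ + v) := by
  have := hQ.growth (Φ + v) (-v) M (fun i => by have := h i; simp only [Pi.neg_apply]; linarith)
  simp only [add_neg_cancel_right] at this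
  linarith

lemma Nice.add_const {ι : Type*} {Q : (ι → ℝ) → ℝ} (hQ : Nice Q) (Φ : ι → ℝ) (a : ℝ) :
    Q (Φ + fun _ => a) = Q Φ + a := by
  apply le_antisymm
  · exact hQ.growth _ _ _ (fun _ => le_rfl)
  · have := hQ.lower Φ (fun _ => a) (-a) (fun i => by simp)
    linarith

lemma Nice.continuous {ι : Type*} [Fintype ι] {Q : (ι → ℝ) → ℝ} (hQ : Nice Q) :
    Continuous Q := by
  have : LipschitzWith 1 Q := by
    apply LipschitzWith.of_le_add
    intro x y
    have := hQ.growth y (x - y) (dist x y) (fun i => by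
      have := dist_le_pi_dist x y i
      rw [Real.dist_eq] at this
      exact (le_abs_self _).trans this)
    simpa using this
  exact this.continuous

lemma Nice.combo {ι : Type*} {Q : (ι → ℝ) → ℝ} (hQ : Nice Q) (x y : ι → ℝ) {a b : ℝ}
    (ha : 0 ≤ a) (hb : 0 ≤ b) (hab : a + b = 1) : Q (a • x + b • y) ≤ a * Q x + b * Q y := by
  simpa using hQ.convex.2 (mem_univ x) (mem_univ y) ha hb hab

/-- Subgradients of nice functionals are probability weights. -/
lemma Nice.subgrad {ι : Type*} [Fintype ι] [DecidableEq ι] {Q : (ι → ℝ) → ℝ} (hQ : Nice Q)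
    (Φ : ι → ℝ) :
    ∃ w : ι → ℝ, (∀ i, 0 ≤ w i) ∧ ∑ i, w i = 1 ∧ ∀ v, Q Φ + ∑ i, w i * v i ≤ Q (Φ + v) := by
  have hconv := hQ.convex.convex_strict_epigraph
  have hopen : IsOpen {p : (ι → ℝ) × ℝ | p.1 ∈ univ ∧ Q p.1 < p.2} := by
    simp only [mem_univ, true_and]
    exact isOpen_lt (hQ.continuous.comp continuous_fst) continuous_snd
  obtain ⟨f, hf⟩ := geometric_hahn_banach_point_open (x := (Φ, Q Φ)) hconv hopen (by simp)
  have hs : ∀ v s, Q v < s → f (Φ, Q Φ) < f (v, s) := fun v s h => hf (v, s) ⟨mem_univ _, h⟩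
  have hpos : 0 < f (0, 1) := by
    have := hs Φ (Q Φ + 1) (by linarith)
    have e : (Φ, Q Φ + 1) = (Φ, Q Φ) + ((0 : ι → ℝ), (1 : ℝ)) := by simp
    rw [e, map_add] at this
    linarith
  set p := f (0, 1) with hp
  let ℓ : (ι → ℝ) → ℝ := fun v => - f (v, 0) / p
  have hfs : ∀ v s, f (v, s) = f (v, 0) + s * p := by
    intro v s
    have e : (v, s) = (v, (0:ℝ)) + s • ((0 : ι → ℝ), (1 : ℝ)) := by simp
    rw [e, map_add, map_smul, smul_eq_mul]
  have key : ∀ v, Q Φ + ℓ v ≤ Q (Φ + v) := by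
    intro v
    by_contra hcon
    push Not at hcon
    have := hs (Φ + v) (Q Φ + ℓ v) hcon
    rw [hfs, hfs (Φ + v)] at this
    have e : (Φ + v, (0:ℝ)) = (Φ, 0) + (v, 0) := by simp
    rw [e, map_add] at this
    have : ℓ v * p = - f (v, 0) := by simp only [ℓ]; field_simp
    nlinarith
  have hsum : ∀ v, ℓ v = ∑ i, ℓ (Pi.single i 1) * v i := by
    intro v
    let fl : (ι → ℝ) →ₗ[ℝ] ℝ := f.toLinearMap.comp (LinearMap.inl ℝ (ι → ℝ) ℝ)
    have h1 : ∀ v, f (v, 0) = fl v := fun v => by simp [fl]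
    have := LinearMap.pi_apply_eq_sum_univ fl v
    simp only [ℓ, h1]
    rw [this, neg_div, Finset.sum_div, ← Finset.sum_neg_distrib]
    apply Finset.sum_congr rfl
    intro i _
    have : (fun j => if i = j then (1:ℝ) else 0) = Pi.single i 1 := by
      ext j; simp [Pi.single_apply, eq_comm]
    rw [this]; simp only [smul_eq_mul]; ring
  refine ⟨fun i => ℓ (Pi.single i 1), ?_, ?_, ?_⟩
  · intro i
    have h1 := key (-Pi.single i 1)
    have h2 := hQ.growth Φ (-Pi.single i 1) 0 (fun j => by
      simp only [Pi.neg_apply, Left.neg_nonpos_iff]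
      by_cases h : j = i
      · subst h; simp
      · simp [h])
    have h3 : ℓ (-Pi.single i 1) = - ℓ (Pi.single i 1) := by
      have e : (-(Pi.single i 1 : ι → ℝ), (0:ℝ)) = -((Pi.single i 1 : ι → ℝ), (0:ℝ)) := by simp
      simp only [ℓ]; rw [e, map_neg]; ring
    rw [h3] at h1; linarith
  · have h1 := key (fun _ => 1)
    have h2 := key (fun _ => -1)
    rw [hQ.add_const, hsum] at h1 h2
    simp only [mul_one, mul_neg, Finset.sum_neg_distrib] at h1 h2
    linarith
  · intro v; rw [← hsum]; exact key v

lemma nice_max {ι : Type*} [Fintype ι] [Nonempty ι] :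
    Nice (fun Φ : ι → ℝ => Finset.univ.sup' Finset.univ_nonempty Φ) := by
  constructor
  · refine ⟨convex_univ, ?_⟩
    intro x _ y _ a b ha hb hab
    apply Finset.sup'_le
    intro i _
    simp only [Pi.add_apply, Pi.smul_apply, smul_eq_mul]
    gcongr
    · exact Finset.le_sup' x (Finset.mem_univ i)
    · exact Finset.le_sup' y (Finset.mem_univ i)
  · intro Φ v M h
    apply Finset.sup'_le
    intro i _
    have := Finset.le_sup' Φ (Finset.mem_univ i)
    have := h i
    simp only [Pi.add_apply]; linarith

/-- symmetric average -/
def T {ι : Type*} (v : ι → ℝ) (N : (ι → ℝ) → ℝ) (Θ : ι → ℝ) : ℝ := (N (Θ + v) + N (Θ - v)) / 2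

lemma Nice.niceT {ι : Type*} {N : (ι → ℝ) → ℝ} (hN : Nice N) (v : ι → ℝ) : Nice (T v N) := by
  constructor
  · refine ⟨convex_univ, ?_⟩
    intro x _ y _ a b ha hb hab
    have h1 := hN.combo (x + v) (y + v) ha hb hab
    have h2 := hN.combo (x - v) (y - v) ha hb hab
    have e1 : a • (x + v) + b • (y + v) = a • x + b • y + v := by
      have : v = (a + b) • v := by rw [hab, one_smul]
      conv_rhs => rw [this]
      module
    have e2 : a • (x - v) + b • (y - v) = a • x + b • y - v := by
      have : v = (a + b) • v := by rw [hab, one_smul]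
      conv_rhs => rw [this]
      module
    rw [e1] at h1; rw [e2] at h2
    simp only [GB.T, smul_eq_mul]
    linarith
  · intro Φ u M h
    have h1 := hN.growth (Φ + v) u M h
    have h2 := hN.growth (Φ - v) u M h
    have e1 : Φ + v + u = Φ + u + v := by abel
    have e2 : Φ - v + u = Φ + u - v := by abel
    rw [e1] at h1; rw [e2] at h2
    simp only [GB.T]
    linarith

lemma Nice.le_T {ι : Type*} {N : (ι → ℝ) → ℝ} (hN : Nice N) (v Θ : ι → ℝ) : N Θ ≤ GB.T v N Θ := by
  have := hN.combo (Θ + v) (Θ - v) (a := 1/2) (b := 1/2) (by norm_num) (by norm_num) (by norm_num)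
  have e : (1/2:ℝ) • (Θ + v) + (1/2:ℝ) • (Θ - v) = Θ := by module
  rw [e] at this
  simp only [GB.T]; linarith

lemma Nice.T_le {ι : Type*} {N : (ι → ℝ) → ℝ} (hN : Nice N) (v Θ : ι → ℝ) (c : ℝ)
    (h : ∀ i, |v i| ≤ c) : GB.T v N Θ ≤ N Θ + c := by
  have h1 := hN.growth Θ v c (fun i => (le_abs_self _).trans (h i))
  have h2 := hN.growth Θ (-v) c (fun i => (neg_le_abs _).trans (h i))
  rw [← sub_eq_add_neg] at h2
  simp only [GB.T]; linarith

lemma Nice.le_T_abs {ι : Type*} {N : (ι → ℝ) → ℝ} (hN : Nice N) (v Θ : ι → ℝ) (c : ℝ)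
    (h : ∀ i, |v i| ≤ c) : |GB.T v N Θ| ≤ |N Θ| + c := by
  have h1 := hN.T_le v Θ c h
  have h2 := hN.le_T v Θ
  rw [abs_le]
  constructor
  · have := neg_abs_le (N Θ)
    by_cases hc : 0 ≤ c
    · linarith
    · rcases isEmpty_or_nonempty ι with hι | ⟨⟨i⟩⟩
      · have := hN.growth Θ v c (fun i => hι.elim i)
        have e : Θ + v = Θ := Subsingleton.elim _ _
        have := hN.growth Θ v (-1) (fun i => hι.elim i)
        rw [e] at this; linarith
      · exact absurd ((abs_nonneg _).trans (h i)) hc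
  · have := le_abs_self (N Θ); linarith

/-- scaling of symmetric averages -/
lemma Nice.T_scale {ι : Type*} {N : (ι → ℝ) → ℝ} (hN : Nice N) (v Θ : ι → ℝ) {s : ℝ}
    (hs0 : 0 ≤ s) (hs1 : s ≤ 1) : GB.T (s • v) N Θ - N Θ ≤ s * (GB.T v N Θ - N Θ) := by
  have h1 := hN.combo (Θ + v) Θ hs0 (sub_nonneg.2 hs1) (by ring)
  have h2 := hN.combo (Θ - v) Θ hs0 (sub_nonneg.2 hs1) (by ring)
  have e1 : s • (Θ + v) + (1 - s) • Θ = Θ + s • v := by module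
  have e2 : s • (Θ - v) + (1 - s) • Θ = Θ - s • v := by module
  rw [e1] at h1; rw [e2] at h2
  simp only [GB.T]; linarith

end GB

end

section

open MeasureTheory ProbabilityTheory Real Set


namespace GB

lemma integrable_of_bdd {S : Type*} [MeasurableSpace S] {P : Measure S} [IsFiniteMeasure P]
    {f : S → ℝ} (hf : Measurable f) (C : ℝ) (hC : ∀ x, |f x| ≤ C) : Integrable f P :=
  Integrable.of_bound hf.aestronglyMeasurable C (Filter.Eventually.of_forall hC)

lemma Nice.meas_comp {ι : Type*} [Fintype ι] {Q : (ι → ℝ) → ℝ} (hQ : Nice Q) {S : Type*}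
    [MeasurableSpace S] {v : S → ι → ℝ} (hv : Measurable v) : Measurable (fun x => Q (v x)) :=
  hQ.continuous.measurable.comp hv

lemma Nice.int_comp {ι : Type*} [Fintype ι] {Q : (ι → ℝ) → ℝ} (hQ : Nice Q) {S : Type*}
    [MeasurableSpace S] {P : Measure S} [IsFiniteMeasure P]
    (Φ : ι → ℝ) {v : S → ι → ℝ} (hv : Measurable v) (C : ℝ) (hC : ∀ x i, |v x i| ≤ C) :
    Integrable (fun x => Q (Φ + v x)) P := by
  refine integrable_of_bdd (f := fun x => Q (Φ + v x))
    (hQ.meas_comp (measurable_const.add hv)) (|Q Φ| + C) ?_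
  intro x
  have h1 := hQ.growth Φ (v x) C (fun i => (le_abs_self _).trans (hC x i))
  have h2 := hQ.lower Φ (v x) C (fun i => (abs_le.1 (hC x i)).1)
  rw [abs_le]
  have := neg_abs_le (Q Φ)
  have := le_abs_self (Q Φ)
  constructor <;> linarith

/-- symmetrization for one variable -/
lemma Nice.symm_one {ι : Type*} [Fintype ι] [DecidableEq ι] {Q : (ι → ℝ) → ℝ} (hQ : Nice Q)
    {S : Type*} [MeasurableSpace S] (P : Measure S) [IsProbabilityMeasure P]
    (g : ι → S → ℝ) (hg : ∀ i, Measurable (g i)) (hb : ∀ i x, |g i x| ≤ 1) (a : ℝ) (ha : 0 ≤ a)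
    (Φ : ι → ℝ) :
    ∫ x, Q (Φ + fun i => a * (g i x - ∫ y, g i y ∂P)) ∂P ≤
      ∫ x, T (fun i => 2 * a * g i x) Q Φ ∂P := by
  have hgi : ∀ i, Integrable (g i) P := fun i => integrable_of_bdd (hg i) 1 (hb i)
  have hm : Measurable (fun x => (fun i => 2 * a * g i x : ι → ℝ)) :=
    measurable_pi_lambda _ (fun i => (hg i).const_mul _)
  have hm' : Measurable (fun x => (fun i => -(2 * a * g i x) : ι → ℝ)) :=
    measurable_pi_lambda _ (fun i => ((hg i).const_mul _).neg)
  have i1 : Integrable (fun x => Q (Φ + fun i => 2 * a * g i x)) P :=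
    hQ.int_comp Φ hm (2 * a) (fun x i => by
      rw [abs_mul, abs_of_nonneg (by positivity)]
      have := hb i x
      nlinarith)
  have i2 : Integrable (fun x => Q (Φ + fun i => -(2 * a * g i x))) P :=
    hQ.int_comp Φ hm' (2 * a) (fun x i => by
      rw [abs_neg, abs_mul, abs_of_nonneg (by positivity)]
      have := hb i x
      nlinarith)
  -- pointwise bound
  have hpt : ∀ x, Q (Φ + fun i => a * (g i x - ∫ y, g i y ∂P)) ≤
      Q (Φ + fun i => 2 * a * g i x) / 2 + (∫ y, Q (Φ + fun i => -(2 * a * g i y)) ∂P) / 2 := by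
    intro x
    obtain ⟨w, _, _, hw⟩ := hQ.subgrad (Φ + fun i => a * (g i x - ∫ y, g i y ∂P))
    have h1 : ∀ y, Q (Φ + fun i => a * (g i x - ∫ y, g i y ∂P)) +
        ∑ i, w i * (a * ((∫ y, g i y ∂P) - g i y)) ≤
        Q (Φ + fun i => 2 * a * g i x) / 2 + Q (Φ + fun i => -(2 * a * g i y)) / 2 := by
      intro y
      refine (hw (fun i => a * ((∫ y, g i y ∂P) - g i y))).trans ?_
      have := hQ.combo (Φ + fun i => 2 * a * g i x) (Φ + fun i => -(2 * a * g i y))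
        (a := 1/2) (b := 1/2) (by norm_num) (by norm_num) (by norm_num)
      refine le_trans (le_of_eq ?_) (this.trans (le_of_eq (by ring)))
      congr 1
      ext i
      simp only [Pi.add_apply, Pi.smul_apply, smul_eq_mul]
      ring
    have h2 := integral_mono (μ := P) (f := fun y => Q (Φ + fun i => a * (g i x - ∫ y, g i y ∂P)) +
        ∑ i, w i * (a * ((∫ y, g i y ∂P) - g i y)))
        (g := fun y => Q (Φ + fun i => 2 * a * g i x) / 2 + Q (Φ + fun i => -(2 * a * g i y)) / 2)
        ?_ ?_ h1
    · rw [integral_add (integrable_const _), integral_add (integrable_const _),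
        integral_finsetSum] at h2
      · have h3 : ∀ i, ∫ y, w i * (a * ((∫ y, g i y ∂P) - g i y)) ∂P = 0 := by
          intro i
          rw [integral_const_mul, integral_const_mul, integral_sub (integrable_const _) (hgi i)]
          simp
        simp only [h3, integral_const, integral_div] at h2
        simpa using h2
      · intro i _
        exact (((integrable_const _).sub (hgi i)).const_mul _).const_mul _
      · exact i2.div_const _
      · exact integrable_finsetSum _ (fun i _ =>
          (((integrable_const _).sub (hgi i)).const_mul _).const_mul _)
    · exact (integrable_const _).add (integrable_finsetSum _ (fun i _ =>
          (((integrable_const _).sub (hgi i)).const_mul _).const_mul _))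
    · exact (integrable_const _).add (i2.div_const _)
  have e : ∀ x, T (fun i => 2 * a * g i x) Q Φ =
      Q (Φ + fun i => 2 * a * g i x) / 2 + Q (Φ + fun i => -(2 * a * g i x)) / 2 := by
    intro x
    simp only [T]
    have : (Φ - fun i => 2 * a * g i x) = (Φ + fun i => -(2 * a * g i x)) := by
      ext i; simp [sub_eq_add_neg]
    rw [this]; ring
  simp only [e]
  rw [integral_add (i1.div_const _) (i2.div_const _)]
  refine (integral_mono ?_ ((i1.div_const 2).add (integrable_const
    ((∫ y, Q (Φ + fun i => -(2 * a * g i y)) ∂P) / 2))) hpt).trans ?_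
  · apply hQ.int_comp Φ (v := fun x i => a * (g i x - ∫ y, g i y ∂P)) _ (a * 2)
    · intro x i
      rw [abs_mul, abs_of_nonneg ha]
      have h0 : |∫ y, g i y ∂P| ≤ 1 := by
        have := norm_integral_le_of_norm_le_const (μ := P) (f := g i) (C := 1)
          (Filter.Eventually.of_forall (hb i))
        simpa using this
      have := abs_sub (g i x) (∫ y, g i y ∂P)
      have := hb i x
      gcongr
      linarith
    · exact measurable_pi_lambda _ (fun i => ((hg i).sub_const _).const_mul _)
  · simp only [Pi.add_apply]
    rw [integral_add (i1.div_const _) (integrable_const _)]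
    simp [integral_div]

lemma exp_chord {c d : ℝ} (hc : 0 < c) (h0 : 0 ≤ d) (h1 : d ≤ c) :
    exp (-d) ≤ 1 - (1 - exp (-c)) / c * d := by
  have := convexOn_exp.2 (mem_univ (-c)) (mem_univ 0)
    (show (0:ℝ) ≤ d / c by positivity)
    (show (0:ℝ) ≤ 1 - d / c by rw [sub_nonneg, div_le_one hc]; exact h1) (by ring)
  have e : (d / c) • (-c) + (1 - d / c) • (0:ℝ) = -d := by
    simp only [smul_eq_mul]; field_simp; ring
  rw [e] at this
  simp only [smul_eq_mul, exp_zero] at this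
  refine this.trans (le_of_eq ?_)
  field_simp; ring

/-- pointwise exponential inequality used in the one-step bound -/
lemma one_step_pt {l η ψ d c m1 m2 : ℝ} (hc : 0 < c) (hη : 0 ≤ η) (hψ : 0 ≤ ψ)
    (h1 : -m1 ≤ l + η) (h2 : l + η ≤ m2) (hd0 : 0 ≤ d) (hdc : d ≤ c) :
    exp (l + η - ψ - d) ≤ exp (-ψ) * exp l + exp m2 * η -
      (1 - exp (-c)) / c * exp (-m1 - ψ) * d := by
  have hch := exp_chord hc hd0 hdc
  have hκ : 0 ≤ (1 - exp (-c)) / c := by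
    apply div_nonneg _ hc.le
    rw [sub_nonneg, exp_le_one_iff]; linarith
  have e1 : exp (l + η - ψ - d) = exp (l + η - ψ) * exp (-d) := by rw [← exp_add]; ring_nf
  rw [e1]
  have hp : 0 < exp (l + η - ψ) := exp_pos _
  have s1 : exp (l + η - ψ) * exp (-d) ≤ exp (l + η - ψ) -
      (1 - exp (-c)) / c * d * exp (l + η - ψ) := by nlinarith
  have s2 : exp (-m1 - ψ) ≤ exp (l + η - ψ) := exp_le_exp.2 (by linarith)
  have s3 : (1 - exp (-c)) / c * d * exp (-m1 - ψ) ≤ (1 - exp (-c)) / c * d * exp (l + η - ψ) :=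
    mul_le_mul_of_nonneg_left s2 (mul_nonneg hκ hd0)
  have s4 : exp (l + η - ψ) ≤ exp (-ψ) * exp l + exp m2 * η := by
    have t1 : exp (l + η - ψ) = exp (-ψ) * exp (l + η) := by rw [← exp_add]; ring_nf
    have t2 : exp l = exp (l + η) * exp (-η) := by rw [← exp_add]; ring_nf
    have t3 : 1 - η ≤ exp (-η) := by have := add_one_le_exp (-η); linarith
    have t4 : exp (l + η) ≤ exp m2 := exp_le_exp.2 h2
    have t5 : exp (-ψ) ≤ 1 := exp_le_one_iff.2 (by linarith)
    have t6 : exp (l + η) - exp l ≤ exp m2 * η := by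
      rw [t2]
      have : exp (l + η) * (1 - exp (-η)) ≤ exp (l + η) * η := by
        apply mul_le_mul_of_nonneg_left _ (exp_pos _).le; linarith
      nlinarith
    have t7 : 0 ≤ exp m2 * η := by positivity
    have t8 : 0 ≤ exp (l + η) - exp l := by
      rw [sub_nonneg, exp_le_exp]; linarith
    rw [t1]
    have := exp_pos (-ψ)
    nlinarith
  nlinarith

/-- standing assumptions for the main inequality -/
structure Setup {ι S : Type*} [MeasurableSpace S] (P : Measure S) (g : ι → S → ℝ)
    (lam m1 m2 ψ c : ℝ) : Prop where
  meas : ∀ i, Measurable (g i)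
  bdd : ∀ i x, |g i x| ≤ 1
  lam_nonneg : 0 ≤ lam
  lower : ∀ i x, -m1 ≤ lam * (g i x - ∫ y, g i y ∂P)
  upper : ∀ i x, lam * (g i x - ∫ y, g i y ∂P) ≤ m2
  m2_nonneg : 0 ≤ m2
  psi_nonneg : 0 ≤ ψ
  mgf : ∀ i, ∫ x, exp (lam * (g i x - ∫ y, g i y ∂P)) ∂P ≤ exp ψ
  c_pos : 0 < c
  cond : 2 * lam * exp m2 ≤ (1 - exp (-c)) * exp (-m1 - ψ)

/-- averaged functional -/
def avgQ {ι S : Type*} [MeasurableSpace S] (P : Measure S) (g : ι → S → ℝ) (a : ℝ)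
    (Q : (ι → ℝ) → ℝ) (Φ : ι → ℝ) : ℝ := ∫ x, T (fun i => a * g i x) Q Φ ∂P

lemma Setup.c'_le {ι S : Type*} [MeasurableSpace S] {P : Measure S} {g : ι → S → ℝ}
    {lam m1 m2 ψ c : ℝ} (h : Setup P g lam m1 m2 ψ c) (hm1 : 0 ≤ m1) :
    2 * lam * exp m2 ≤ c := by
  refine h.cond.trans ?_
  have h1 : exp (-m1 - ψ) ≤ 1 := exp_le_one_iff.2 (by have := h.psi_nonneg; linarith)
  have h2 : 1 - exp (-c) ≤ c := by have := add_one_le_exp (-c); linarith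
  have h3 : 0 ≤ 1 - exp (-c) := by
    rw [sub_nonneg, exp_le_one_iff]; have := h.c_pos; linarith
  have := exp_pos (-m1 - ψ)
  nlinarith

lemma int_T {ι : Type*} [Fintype ι] {N : (ι → ℝ) → ℝ} (hN : Nice N)
    {S : Type*} [MeasurableSpace S] (P : Measure S) [IsProbabilityMeasure P]
    (g : ι → S → ℝ) (hg : ∀ i, Measurable (g i)) (hb : ∀ i x, |g i x| ≤ 1) (a : ℝ) (ha : 0 ≤ a)
    (Θ : ι → ℝ) : Integrable (fun x => T (fun i => a * g i x) N Θ) P := by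
  have hC : ∀ x i, |a * g i x| ≤ a := fun x i => by
    rw [abs_mul, abs_of_nonneg ha]; have := hb i x; nlinarith
  have i1 := hN.int_comp (P := P) Θ (v := fun x i => a * g i x)
    (measurable_pi_lambda _ (fun i => (hg i).const_mul _)) a hC
  have i2 := hN.int_comp (P := P) Θ (v := fun x i => -(a * g i x))
    (measurable_pi_lambda _ (fun i => ((hg i).const_mul _).neg)) a
    (fun x i => by rw [abs_neg]; exact hC x i)
  refine ((i1.add i2).div_const 2).congr (Filter.Eventually.of_forall fun x => ?_)
  simp only [T, Pi.add_apply]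
  have : (Θ - fun i => a * g i x) = (Θ + fun i => -(a * g i x)) := by
      ext i; simp [sub_eq_add_neg]
  rw [this]

lemma Nice.avg {ι : Type*} [Fintype ι] {Q : (ι → ℝ) → ℝ} (hQ : Nice Q)
    {S : Type*} [MeasurableSpace S] (P : Measure S) [IsProbabilityMeasure P]
    (g : ι → S → ℝ) (hg : ∀ i, Measurable (g i)) (hb : ∀ i x, |g i x| ≤ 1) (a : ℝ) (ha : 0 ≤ a) :
    Nice (avgQ P g a Q) := by
  have hi := fun Θ => int_T hQ P g hg hb a ha Θ
  constructor
  · refine ⟨convex_univ, ?_⟩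
    intro x _ y _ p q hp hq hpq
    simp only [avgQ, smul_eq_mul]
    rw [← integral_const_mul, ← integral_const_mul,
      ← integral_add ((hi x).const_mul _) ((hi y).const_mul _)]
    exact integral_mono (hi _) (((hi x).const_mul _).add ((hi y).const_mul _))
      (fun s => (hQ.niceT _).combo x y hp hq hpq)
  · intro Φ v M hM
    have := integral_mono (hi (Φ + v)) ((hi Φ).add (integrable_const M))
      (fun s => (hQ.niceT _).growth Φ v M hM)
    rw [integral_add' (hi Φ) (integrable_const M)] at this
    simpa [avgQ] using this

/-- The one-step inequality. -/
lemma one_step {ι : Type*} [Fintype ι] [DecidableEq ι] {Q N : (ι → ℝ) → ℝ} (hQ : Nice Q)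
    (hN : Nice N) {S : Type*} [MeasurableSpace S] {P : Measure S} [IsProbabilityMeasure P]
    {g : ι → S → ℝ} {lam m1 m2 ψ c : ℝ} (h : Setup P g lam m1 m2 ψ c) (hm1 : 0 ≤ m1)
    (Φ Θ : ι → ℝ) :
    ∫ x, exp (Q (Φ + fun i => (lam * (g i x - ∫ y, g i y ∂P) - ψ)) -
        T (fun i => c * g i x) N Θ) ∂P ≤
      exp (avgQ P g (2 * lam * exp m2) Q Φ - avgQ P g (2 * lam * exp m2) N Θ) := by
  obtain ⟨w, hw0, hw1, hw⟩ := hQ.subgrad Φ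
  have hc := h.c_pos
  set c' := 2 * lam * exp m2 with hc'
  have hlam := h.lam_nonneg
  have hc'0 : 0 ≤ c' := by positivity
  set H : S → ι → ℝ := fun x i => lam * (g i x - ∫ y, g i y ∂P) with hH
  have hHm : Measurable H := measurable_pi_lambda _ (fun i => ((h.meas i).sub_const _).const_mul _)
  have hgi : ∀ i, Integrable (g i) P := fun i => integrable_of_bdd (h.meas i) 1 (h.bdd i)
  have hHi : ∀ i, Integrable (fun x => H x i) P := fun i =>
    ((hgi i).sub (integrable_const _)).const_mul _
  have hHabs : ∀ x i, |H x i| ≤ max m1 m2 := fun x i => by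
    rw [abs_le]; constructor
    · have := h.lower i x; have := le_max_left m1 m2; linarith
    · exact (h.upper i x).trans (le_max_right _ _)
  set l : S → ℝ := fun x => ∑ i, w i * H x i with hl
  set η : S → ℝ := fun x => Q (Φ + H x) - Q Φ - l x with hη
  set d : S → ℝ := fun x => T (fun i => c * g i x) N Θ - N Θ with hd
  set κ := (1 - exp (-c)) / c with hκ
  have hpt : ∀ x, exp (Q (Φ + fun i => (H x i - ψ)) - T (fun i => c * g i x) N Θ) ≤
      exp (Q Φ - N Θ) * (exp (-ψ) * exp (l x) + exp m2 * η x - κ * exp (-m1 - ψ) * d x) := by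
    intro x
    have e1 : Q (Φ + fun i => (H x i - ψ)) = Q (Φ + H x) - ψ := by
      have := hQ.add_const (Φ + H x) (-ψ)
      rw [← sub_eq_add_neg] at this
      rw [← this]; congr 1; ext i; simp; ring
    have e2 : Q (Φ + fun i => (H x i - ψ)) - T (fun i => c * g i x) N Θ =
        (Q Φ - N Θ) + (l x + η x - ψ - d x) := by rw [e1]; simp only [hη, hd]; ring
    rw [e2, exp_add]
    apply mul_le_mul_of_nonneg_left _ (exp_pos _).le
    apply one_step_pt hc _ h.psi_nonneg
    · have := hQ.lower Φ (H x) m1 (fun i => h.lower i x)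
      simp only [hη]; linarith
    · have := hQ.growth Φ (H x) m2 (fun i => h.upper i x)
      simp only [hη]; linarith
    · have := hN.le_T (fun i => c * g i x) Θ; simp only [hd]; linarith
    · have := hN.T_le (fun i => c * g i x) Θ c (fun i => by
        rw [abs_mul, abs_of_pos hc]; have := h.bdd i x; nlinarith)
      simp only [hd]; linarith
    · have := hw (H x); simp only [hη]; linarith
  have il : Integrable l P := integrable_finsetSum _ (fun i _ => (hHi i).const_mul _)
  have iη : Integrable η P :=
    ((hQ.int_comp Φ hHm _ hHabs).sub (integrable_const _)).sub il
  have idd : Integrable d P := (int_T hN P g h.meas h.bdd c hc.le Θ).sub (integrable_const _)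
  have ilm : Measurable l := Finset.measurable_sum _ (fun i _ => ((measurable_pi_iff.1 hHm) i).const_mul _)
  have habs_l : ∀ x, |l x| ≤ max m1 m2 := fun x => by
    refine (Finset.abs_sum_le_sum_abs _ _).trans ?_
    calc ∑ i, |w i * H x i| ≤ ∑ i, w i * max m1 m2 := by
          apply Finset.sum_le_sum; intro i _
          rw [abs_mul, abs_of_nonneg (hw0 i)]
          exact mul_le_mul_of_nonneg_left (hHabs x i) (hw0 i)
      _ = max m1 m2 := by rw [← Finset.sum_mul, hw1, one_mul]
  have iel : Integrable (fun x => exp (l x)) P := by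
    apply integrable_of_bdd ilm.exp (exp (max m1 m2))
    intro x; rw [abs_exp]; exact exp_le_exp.2 ((le_abs_self _).trans (habs_l x))
  have ieH : ∀ i, Integrable (fun x => exp (H x i)) P := fun i => by
    apply integrable_of_bdd ((measurable_pi_iff.1 hHm) i).exp (exp (max m1 m2))
    intro x; rw [abs_exp]; exact exp_le_exp.2 ((le_abs_self _).trans (hHabs x i))
  have hEl : ∫ x, l x ∂P = 0 := by
    simp only [hl]
    rw [integral_finsetSum _ (fun i _ => (hHi i).const_mul _)]
    apply Finset.sum_eq_zero; intro i _
    simp only [hH]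
    rw [integral_const_mul, integral_const_mul, integral_sub (hgi i) (integrable_const _)]
    simp
  have hEel : ∫ x, exp (l x) ∂P ≤ exp ψ := by
    calc ∫ x, exp (l x) ∂P ≤ ∫ x, ∑ i, w i * exp (H x i) ∂P := by
          apply integral_mono iel (integrable_finsetSum _ (fun i _ => (ieH i).const_mul _))
          intro x
          have := convexOn_exp.map_sum_le (t := Finset.univ) (w := w) (p := H x)
            (fun i _ => hw0 i) hw1 (fun i _ => mem_univ _)
          simpa [smul_eq_mul] using this
      _ = ∑ i, w i * ∫ x, exp (H x i) ∂P := by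
          rw [integral_finsetSum _ (fun i _ => (ieH i).const_mul _)]
          simp only [integral_const_mul]
      _ ≤ ∑ i, w i * exp ψ := by
          apply Finset.sum_le_sum; intro i _
          exact mul_le_mul_of_nonneg_left (h.mgf i) (hw0 i)
      _ = exp ψ := by rw [← Finset.sum_mul, hw1, one_mul]
  have hEη : ∫ x, η x ∂P = ∫ x, Q (Φ + H x) ∂P - Q Φ := by
    simp only [hη]
    have iQ0 : Integrable (fun x => Q (Φ + H x) - Q Φ) P :=
      (hQ.int_comp Φ hHm _ hHabs).sub (integrable_const _)
    rw [integral_sub iQ0 il, hEl,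
      integral_sub (hQ.int_comp Φ hHm _ hHabs) (integrable_const _)]
    simp
  have hC1 : 1 ≤ exp m2 := one_le_exp h.m2_nonneg
  have hQ' : Q Φ + exp m2 * ∫ x, η x ∂P ≤ avgQ P g c' Q Φ := by
    have hs := hQ.symm_one P g h.meas h.bdd (exp m2 * lam) (by positivity) Φ
    have e : 2 * (exp m2 * lam) = c' := by rw [hc']; ring
    rw [e] at hs
    refine le_trans ?_ hs
    have : ∀ x, Q Φ + exp m2 * (Q (Φ + H x) - Q Φ) ≤
        Q (Φ + fun i => exp m2 * lam * (g i x - ∫ y, g i y ∂P)) := by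
      intro x
      have hp := exp_pos m2
      have hcm := hQ.combo (Φ + fun i => exp m2 * lam * (g i x - ∫ y, g i y ∂P)) Φ
        (a := 1 / exp m2) (b := 1 - 1 / exp m2) (by positivity)
        (by rw [sub_nonneg, div_le_one hp]; exact hC1) (by ring)
      have e : (1 / exp m2) • (Φ + fun i => exp m2 * lam * (g i x - ∫ y, g i y ∂P)) +
          (1 - 1 / exp m2) • Φ = Φ + H x := by
        ext i
        simp only [hH, Pi.add_apply, Pi.smul_apply, smul_eq_mul]
        field_simp; ring
      rw [e] at hcm
      have := mul_le_mul_of_nonneg_left hcm hp.le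
      have e2 : exp m2 * (1 / exp m2 * Q (Φ + fun i => exp m2 * lam * (g i x - ∫ y, g i y ∂P)) +
        (1 - 1 / exp m2) * Q Φ) = Q (Φ + fun i => exp m2 * lam * (g i x - ∫ y, g i y ∂P)) +
        (exp m2 - 1) * Q Φ := by field_simp
      rw [e2] at this
      linarith
    have iQ := hQ.int_comp (P := P) Φ hHm _ hHabs
    have hmono := integral_mono (μ := P) ((integrable_const (Q Φ)).add
      ((iQ.sub (integrable_const (Q Φ))).const_mul (exp m2)))
      (hQ.int_comp (P := P) Φ (v := fun x i => exp m2 * lam * (g i x - ∫ y, g i y ∂P))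
        (measurable_pi_lambda _ (fun i => ((h.meas i).sub_const _).const_mul _))
        (exp m2 * max m1 m2) (fun x i => by
          rw [mul_assoc, abs_mul, abs_exp]
          exact mul_le_mul_of_nonneg_left (hHabs x i) (exp_pos _).le)) this
    refine le_trans (le_of_eq ?_) hmono
    simp only [Pi.add_apply, Pi.sub_apply]
    have iQ0 : Integrable (fun x => Q (Φ + H x) - Q Φ) P := iQ.sub (integrable_const (Q Φ))
    rw [integral_add (integrable_const _) (iQ0.const_mul (exp m2)),
      integral_const_mul, integral_sub iQ (integrable_const _), hEη]
    simp
  have hN' : avgQ P g c' N Θ ≤ N Θ + κ * exp (-m1 - ψ) * ∫ x, d x ∂P := by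
    have hle : ∀ x, T (fun i => c' * g i x) N Θ ≤ N Θ + c' / c * d x := by
      intro x
      have := hN.T_scale (fun i => c * g i x) Θ (s := c' / c) (by positivity)
        (by rw [div_le_one hc]; exact h.c'_le hm1)
      have e : (c' / c) • (fun i => c * g i x) = fun i => c' * g i x := by
        ext i; simp only [Pi.smul_apply, smul_eq_mul]; field_simp
      rw [e] at this
      simp only [hd]; linarith
    have hmono := integral_mono (μ := P) (int_T hN P g h.meas h.bdd c' hc'0 Θ)
      ((integrable_const (N Θ)).add (idd.const_mul (c' / c))) hle
    simp only [Pi.add_apply] at hmono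
    rw [integral_add (integrable_const _) (idd.const_mul _), integral_const_mul] at hmono
    have hd0 : 0 ≤ ∫ x, d x ∂P := integral_nonneg (fun x => by
      have := hN.le_T (fun i => c * g i x) Θ; simp only [hd, Pi.zero_apply]; linarith)
    have hcc : c' / c ≤ κ * exp (-m1 - ψ) := by
      rw [hκ, div_mul_eq_mul_div]
      exact div_le_div_of_nonneg_right h.cond hc.le
    have := mul_le_mul_of_nonneg_right hcc hd0
    simp only [avgQ]
    simp at hmono
    linarith
  have i3 : Integrable (fun x => exp (-ψ) * exp (l x) + exp m2 * η x) P :=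
    (iel.const_mul _).add (iη.const_mul _)
  calc ∫ x, exp (Q (Φ + fun i => (H x i - ψ)) - T (fun i => c * g i x) N Θ) ∂P
      ≤ ∫ x, exp (Q Φ - N Θ) * (exp (-ψ) * exp (l x) + exp m2 * η x -
          κ * exp (-m1 - ψ) * d x) ∂P := by
        apply integral_mono_of_nonneg (Filter.Eventually.of_forall fun x => (exp_pos _).le)
          ((i3.sub (idd.const_mul _)).const_mul _) (Filter.Eventually.of_forall hpt)
    _ = exp (Q Φ - N Θ) * (exp (-ψ) * ∫ x, exp (l x) ∂P + exp m2 * ∫ x, η x ∂P -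
          κ * exp (-m1 - ψ) * ∫ x, d x ∂P) := by
        rw [integral_const_mul, integral_sub i3 (idd.const_mul _),
          integral_add (iel.const_mul _) (iη.const_mul _)]
        simp only [integral_const_mul]
    _ ≤ exp (Q Φ - N Θ) * (1 + (exp m2 * ∫ x, η x ∂P - κ * exp (-m1 - ψ) * ∫ x, d x ∂P)) := by
        apply mul_le_mul_of_nonneg_left _ (exp_pos _).le
        have : exp (-ψ) * ∫ x, exp (l x) ∂P ≤ exp (-ψ) * exp ψ :=
          mul_le_mul_of_nonneg_left hEel (exp_pos _).le
        rw [← exp_add, neg_add_cancel, exp_zero] at this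
        linarith
    _ ≤ exp (Q Φ - N Θ) * exp (exp m2 * ∫ x, η x ∂P - κ * exp (-m1 - ψ) * ∫ x, d x ∂P) := by
        apply mul_le_mul_of_nonneg_left _ (exp_pos _).le
        have := add_one_le_exp (exp m2 * ∫ x, η x ∂P - κ * exp (-m1 - ψ) * ∫ x, d x ∂P)
        linarith
    _ ≤ _ := by
        rw [← exp_add, exp_le_exp]
        linarith

end GB

end

section

open MeasureTheory ProbabilityTheory Real Set


namespace GB

/-- Rademacher average of a functional -/
def radA {ι S : Type*} (c : ℝ) (g : ι → S → ℝ) (k : ℕ) (Q : (ι → ℝ) → ℝ) (x : Fin k → S)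
    (Θ : ι → ℝ) : ℝ :=
  (∑ σ : Fin k → Bool, Q (Θ + fun i => c * ∑ j, radSign (σ j) * g i (x j))) / 2 ^ k

lemma radA_zero {ι S : Type*} (c : ℝ) (g : ι → S → ℝ) (Q : (ι → ℝ) → ℝ) (x : Fin 0 → S)
    (Θ : ι → ℝ) : radA c g 0 Q x Θ = Q Θ := by
  simp only [radA, Finset.univ_eq_empty, Finset.sum_empty, mul_zero, pow_zero, div_one,
    Finset.sum_const, Finset.card_univ, Fintype.card_fun, Fintype.card_fin, Fintype.card_bool,
    one_smul]
  congr 1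
  ext i; simp

lemma radA_succ {ι S : Type*} (c : ℝ) (g : ι → S → ℝ) (k : ℕ) (Q : (ι → ℝ) → ℝ)
    (x : Fin (k + 1) → S) (Θ : ι → ℝ) :
    radA c g (k + 1) Q x Θ = T (fun i => c * g i (x 0)) (radA c g k Q (fun j => x j.succ)) Θ := by
  simp only [radA, T]
  rw [← (Fin.consEquiv (fun _ => Bool)).sum_comp, Fintype.sum_prod_type, Fintype.sum_bool]
  have e1 : ∀ y : Fin k → Bool, (Θ + fun i => c * ∑ j, radSign
      ((Fin.consEquiv (fun _ => Bool)) (true, y) j) * g i (x j)) =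
      (Θ + fun i => c * g i (x 0)) + fun i => c * ∑ j, radSign (y j) * g i (x j.succ) := by
    intro y; ext i
    simp [Fin.sum_univ_succ, Fin.consEquiv, radSign]; ring
  have e2 : ∀ y : Fin k → Bool, (Θ + fun i => c * ∑ j, radSign
      ((Fin.consEquiv (fun _ => Bool)) (false, y) j) * g i (x j)) =
      (Θ - fun i => c * g i (x 0)) + fun i => c * ∑ j, radSign (y j) * g i (x j.succ) := by
    intro y; ext i
    simp [Fin.sum_univ_succ, Fin.consEquiv, radSign]; ring
  simp only [e1, e2]
  rw [pow_succ]
  field_simp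

lemma Nice.radA {ι S : Type*} (c : ℝ) (g : ι → S → ℝ) (k : ℕ) {Q : (ι → ℝ) → ℝ} (hQ : Nice Q)
    (x : Fin k → S) : Nice (GB.radA c g k Q x) := by
  induction k with
  | zero =>
    have : GB.radA c g 0 Q x = Q := funext fun Θ => radA_zero c g Q x Θ
    rw [this]; exact hQ
  | succ k ih =>
    have : GB.radA c g (k+1) Q x = T (fun i => c * g i (x 0)) (GB.radA c g k Q (fun j => x j.succ)) :=
      funext fun Θ => radA_succ c g k Q x Θ
    rw [this]; exact (ih _).niceT _

lemma T_comm {ι : Type*} (v w : ι → ℝ) (N : (ι → ℝ) → ℝ) (Θ : ι → ℝ) :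
    T w (T v N) Θ = (T w N (Θ + v) + T w N (Θ - v)) / 2 := by
  simp only [T]
  have e1 : Θ + w + v = Θ + v + w := by abel
  have e2 : Θ + w - v = Θ - v + w := by abel
  have e3 : Θ - w + v = Θ + v - w := by abel
  have e4 : Θ - w - v = Θ - v - w := by abel
  rw [e1, e2, e3, e4]; ring

lemma avgQ_T {ι : Type*} [Fintype ι] {N : (ι → ℝ) → ℝ} (hN : Nice N)
    {S : Type*} [MeasurableSpace S] (P : Measure S) [IsProbabilityMeasure P]
    (g : ι → S → ℝ) (hg : ∀ i, Measurable (g i)) (hb : ∀ i x, |g i x| ≤ 1) (a : ℝ) (ha : 0 ≤ a)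
    (v Θ : ι → ℝ) : avgQ P g a (T v N) Θ = T v (avgQ P g a N) Θ := by
  simp only [avgQ, T_comm]
  rw [integral_div, integral_add (int_T hN P g hg hb a ha _) (int_T hN P g hg hb a ha _)]
  rfl

lemma avgQ_radA {ι : Type*} [Fintype ι] {Q : (ι → ℝ) → ℝ} (hQ : Nice Q)
    {S : Type*} [MeasurableSpace S] (P : Measure S) [IsProbabilityMeasure P]
    (g : ι → S → ℝ) (hg : ∀ i, Measurable (g i)) (hb : ∀ i x, |g i x| ≤ 1) (a : ℝ) (ha : 0 ≤ a)
    (c : ℝ) (k : ℕ) (x : Fin k → S) (Θ : ι → ℝ) :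
    avgQ P g a (radA c g k Q x) Θ = radA c g k (avgQ P g a Q) x Θ := by
  induction k generalizing Θ with
  | zero =>
    have : GB.radA c g 0 Q x = Q := funext fun Θ => radA_zero c g Q x Θ
    rw [this, radA_zero]
  | succ k ih =>
    have : GB.radA c g (k+1) Q x = T (fun i => c * g i (x 0)) (GB.radA c g k Q (fun j => x j.succ)) :=
      funext fun Θ => radA_succ c g k Q x Θ
    rw [this, avgQ_T (hQ.radA _ _ _ _) P g hg hb a ha, radA_succ]
    simp only [T, ih]

lemma radA_meas {ι : Type*} [Fintype ι] {Q : (ι → ℝ) → ℝ} (hQ : Nice Q)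
    {S : Type*} [MeasurableSpace S] 
    (g : ι → S → ℝ) (hg : ∀ i, Measurable (g i)) (c : ℝ) (k : ℕ) (Θ : ι → ℝ) :
    Measurable (fun x : Fin k → S => radA c g k Q x Θ) := by
  simp only [radA]
  apply Measurable.div_const
  refine Finset.measurable_sum _ (fun σ _ => ?_)
  refine hQ.meas_comp (v := fun x : Fin k → S => Θ + fun i => c * ∑ j, radSign (σ j) * g i (x j))
    (measurable_const.add (measurable_pi_lambda _ (fun i => ?_)))
  refine Measurable.const_mul (Finset.measurable_sum _ (fun j _ => ?_)) _
  exact ((hg i).comp (measurable_pi_apply j)).const_mul _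

lemma radA_lower {ι : Type*} {Q : (ι → ℝ) → ℝ} (hQ : Nice Q)
    {S : Type*} (g : ι → S → ℝ) (c : ℝ) (k : ℕ) (x : Fin k → S) (Θ : ι → ℝ) :
    Q Θ ≤ radA c g k Q x Θ := by
  induction k generalizing Θ with
  | zero => rw [radA_zero]
  | succ k ih =>
    rw [radA_succ]
    exact (ih _ _).trans ((hQ.radA c g k _).le_T _ _)

/-- integrand of the main inequality -/
def integrand {ι S : Type*} [MeasurableSpace S] (P : Measure S) (g : ι → S → ℝ)
    (lam ψ c : ℝ) (k : ℕ) (Q : (ι → ℝ) → ℝ) (Φ : ι → ℝ) (x : Fin k → S) : ℝ :=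
  exp (Q (Φ + fun i => ∑ j, (lam * (g i (x j) - ∫ y, g i y ∂P) - ψ)) - radA c g k Q x Φ)

lemma integrand_int {ι S : Type*} [Fintype ι] [MeasurableSpace S] {P : Measure S}
    [IsProbabilityMeasure P] {g : ι → S → ℝ}
    {lam m1 m2 ψ c : ℝ} (h : Setup P g lam m1 m2 ψ c) (k : ℕ) {Q : (ι → ℝ) → ℝ} (hQ : Nice Q)
    (Φ : ι → ℝ) : Integrable (integrand P g lam ψ c k Q Φ) (Measure.pi fun _ : Fin k => P) := by
  have hm : Measurable (integrand P g lam ψ c k Q Φ) := by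
    unfold integrand
    refine (Measurable.sub ?_ (radA_meas hQ g h.meas c k Φ)).exp
    refine hQ.meas_comp (v := fun x : Fin k → S =>
        Φ + fun i => ∑ j, (lam * (g i (x j) - ∫ y, g i y ∂P) - ψ))
      (measurable_const.add (measurable_pi_lambda _ (fun i => ?_)))
    refine (Finset.measurable_sum _ (fun j _ => ?_))
    exact ((((h.meas i).comp (measurable_pi_apply j)).sub_const _).const_mul _).sub_const _
  apply integrable_of_bdd hm (exp (k * m2))
  intro x
  rw [integrand, abs_exp, exp_le_exp]
  have h1 := radA_lower hQ g c k x Φ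
  have h2 := hQ.growth Φ (fun i => ∑ j, (lam * (g i (x j) - ∫ y, g i y ∂P) - ψ)) (k * m2) (by
    intro i
    have : ∀ j : Fin k, (lam * (g i (x j) - ∫ y, g i y ∂P) - ψ) ≤ m2 := fun j => by
      have := h.upper i (x j); have := h.psi_nonneg; linarith
    calc ∑ j, (lam * (g i (x j) - ∫ y, g i y ∂P) - ψ) ≤ ∑ j : Fin k, m2 :=
          Finset.sum_le_sum (fun j _ => this j)
      _ = k * m2 := by simp)
  linarith

/-- Main inequality. -/
theorem main_ineq {ι S : Type*} [Fintype ι] [DecidableEq ι] [MeasurableSpace S] {P : Measure S}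
    [IsProbabilityMeasure P] {g : ι → S → ℝ}
    {lam m1 m2 ψ c : ℝ} (h : Setup P g lam m1 m2 ψ c) (hm1 : 0 ≤ m1) (k : ℕ) (Q : (ι → ℝ) → ℝ)
    (hQ : Nice Q) (Φ : ι → ℝ) :
    ∫ x, integrand P g lam ψ c k Q Φ x ∂(Measure.pi fun _ : Fin k => P) ≤ 1 := by
  have hlam := h.lam_nonneg
  induction k generalizing Q with
  | zero =>
    have : ∀ x, integrand P g lam ψ c 0 Q Φ x = 1 := by
      intro x
      simp only [integrand, radA_zero, Finset.univ_eq_empty, Finset.sum_empty]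
      have : (Φ + fun i : ι => (0:ℝ)) = Φ := by ext i; simp
      rw [this]; simp
    simp [this]
  | succ k ih =>
    have hp := measurePreserving_piFinSuccAbove (fun _ : Fin (k+1) => P) 0
    have hI := integrand_int h (k+1) hQ Φ
    set e := MeasurableEquiv.piFinSuccAbove (fun _ : Fin (k+1) => S) 0 with he
    have hI' : Integrable (fun p => integrand P g lam ψ c (k+1) Q Φ (e.symm p))
        (P.prod (Measure.pi fun _ : Fin k => P)) := by
      have := (hp.symm e).integrable_comp_emb e.symm.measurableEmbedding
        (g := integrand P g lam ψ c (k+1) Q Φ)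
      exact this.2 hI
    have e1 : ∫ x, integrand P g lam ψ c (k+1) Q Φ x ∂(Measure.pi fun _ : Fin (k+1) => P) =
        ∫ p, integrand P g lam ψ c (k+1) Q Φ (e.symm p) ∂(P.prod (Measure.pi fun _ : Fin k => P)) :=
      ((hp.symm e).integral_comp e.symm.measurableEmbedding _).symm
    rw [e1, integral_prod_symm _ hI']
    have hQ' := hQ.avg P g h.meas h.bdd (2 * lam * exp m2) (by positivity)
    refine le_trans (integral_mono hI'.integral_prod_right
      (integrand_int h k hQ' Φ) ?_) (ih _ hQ')
    intro xs
    have := one_step hQ (hQ.radA c g k xs) h hm1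
      (Φ + fun i => ∑ j, (lam * (g i (xs j) - ∫ y, g i y ∂P) - ψ)) Φ
    rw [avgQ_radA hQ P g h.meas h.bdd _ (by positivity)] at this
    refine le_trans (le_of_eq ?_) this
    apply integral_congr_ae
    refine Filter.Eventually.of_forall fun x0 => ?_
    simp only [integrand, radA_succ]
    have z : ∀ j : Fin k, e.symm (x0, xs) j.succ = xs j := fun j => by
      simp [he, MeasurableEquiv.piFinSuccAbove]
    have z0 : e.symm (x0, xs) 0 = x0 := by
      simp [he, MeasurableEquiv.piFinSuccAbove]
    simp only [z, z0]
    congr 3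
    ext i
    simp only [Pi.add_apply, Fin.sum_univ_succ, z, z0]
    ring

end GB

end

section

open MeasureTheory ProbabilityTheory Real Set


namespace GB

/-- full Rademacher complexity of a class on the sample -/
def RadF {S : Type*} (n : ℕ) (C : Set (S → ℝ)) (x : Fin n → S) : ℝ :=
  (∑ σ : Fin n → Bool, sSup {a : ℝ | ∃ f ∈ C, a = |radAvg n x σ f|}) / 2 ^ n

lemma abs_radSign (b : Bool) : |radSign b| = 1 := by cases b <;> simp [radSign]

lemma abs_radAvg_le {S : Type*} {n : ℕ} {x : Fin n → S} {σ : Fin n → Bool} {f : S → ℝ}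
    (hf : ∀ s, |f s| ≤ 1) : |radAvg n x σ f| ≤ 1 := by
  unfold radAvg
  rw [abs_div, Nat.abs_cast]
  apply div_le_one_of_le₀ _ (Nat.cast_nonneg n)
  calc |∑ i, radSign (σ i) * f (x i)| ≤ ∑ i, |radSign (σ i) * f (x i)| :=
        Finset.abs_sum_le_sum_abs _ _
    _ ≤ ∑ i : Fin n, (1:ℝ) := by
        apply Finset.sum_le_sum; intro i _
        rw [abs_mul, abs_radSign, one_mul]; exact hf _
    _ = n := by simp

lemma bddAbove_rad {S : Type*} {n : ℕ} {C : Set (S → ℝ)} {x : Fin n → S}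
    (hC : ∀ f ∈ C, ∀ s, |f s| ≤ 1) (σ : Fin n → Bool) :
    BddAbove {a : ℝ | ∃ f ∈ C, a = |radAvg n x σ f|} := by
  refine ⟨1, ?_⟩
  rintro a ⟨f, hf, rfl⟩
  exact abs_radAvg_le (hC f hf)

lemma sSup_rad_nonneg {S : Type*} {n : ℕ} {C : Set (S → ℝ)} {x : Fin n → S} (σ : Fin n → Bool) :
    0 ≤ sSup {a : ℝ | ∃ f ∈ C, a = |radAvg n x σ f|} := by
  apply Real.sSup_nonneg
  rintro a ⟨f, hf, rfl⟩
  exact abs_nonneg _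

lemma sSup_rad_le_one {S : Type*} {n : ℕ} {C : Set (S → ℝ)} {x : Fin n → S}
    (hC : ∀ f ∈ C, ∀ s, |f s| ≤ 1) (σ : Fin n → Bool) :
    sSup {a : ℝ | ∃ f ∈ C, a = |radAvg n x σ f|} ≤ 1 := by
  apply Real.sSup_le _ zero_le_one
  rintro a ⟨f, hf, rfl⟩
  exact abs_radAvg_le (hC f hf)

lemma RadF_nonneg {S : Type*} {n : ℕ} {C : Set (S → ℝ)} {x : Fin n → S} : 0 ≤ RadF n C x := by
  unfold RadF
  apply div_nonneg _ (by positivity)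
  exact Finset.sum_nonneg (fun σ _ => sSup_rad_nonneg σ)

lemma RadF_le_one {S : Type*} {n : ℕ} {C : Set (S → ℝ)} {x : Fin n → S}
    (hC : ∀ f ∈ C, ∀ s, |f s| ≤ 1) : RadF n C x ≤ 1 := by
  unfold RadF
  rw [div_le_one (by positivity)]
  calc _ ≤ ∑ σ : Fin n → Bool, (1:ℝ) := Finset.sum_le_sum (fun σ _ => sSup_rad_le_one hC σ)
    _ = 2 ^ n := by simp

lemma RadF_mono {S : Type*} {n : ℕ} {C D : Set (S → ℝ)} {x : Fin n → S}
    (hD : ∀ f ∈ D, ∀ s, |f s| ≤ 1) (h : C ⊆ D) : RadF n C x ≤ RadF n D x := by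
  unfold RadF
  apply div_le_div_of_nonneg_right _ (by positivity)
  apply Finset.sum_le_sum
  intro σ _
  apply Real.sSup_le _ (sSup_rad_nonneg σ)
  rintro a ⟨f, hf, rfl⟩
  exact le_csSup (bddAbove_rad hD σ) ⟨f, h hf, rfl⟩

instance (n : ℕ) : IsProbabilityMeasure (radMeasure n) := by
  unfold radMeasure; infer_instance

lemma radMeasure_singleton (n : ℕ) (σ : Fin n → Bool) :
    (radMeasure n).real {σ} = 1 / 2 ^ n := by
  unfold radMeasure
  rw [Measure.real, Measure.pi_singleton]
  have : ∀ b : Bool, (PMF.uniformOfFintype Bool).toMeasure {b} = 2⁻¹ := by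
    intro b
    rw [PMF.toMeasure_apply_singleton _ _ (measurableSet_singleton b)]
    simp [PMF.uniformOfFintype_apply]
  simp [this, ENNReal.toReal_pow]

lemma radSup_eq {S : Type*} (n : ℕ) (F : Set (S → ℝ)) (x : Fin n → S) (u : ℝ) :
    radSup n F x u = RadF n {f ∈ F | empMean n x f ≤ u} x := by
  unfold radSup RadF
  rw [integral_fintype (Integrable.of_finite)]
  simp only [radMeasure_singleton, smul_eq_mul, mem_setOf_eq, and_assoc]
  rw [Finset.sum_div]
  apply Finset.sum_congr rfl
  intro σ _
  ring

/-- finite class deviation bound -/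
lemma dev_fin {S : Type*} [MeasurableSpace S] {P : Measure S} [IsProbabilityMeasure P]
    {ι : Type*} [Fintype ι] [Nonempty ι] [DecidableEq ι] {g : ι → S → ℝ}
    {lam m1 m2 ψ c : ℝ} (h : Setup P g lam m1 m2 ψ c) (hm1 : 0 ≤ m1) (n : ℕ) (hn : 1 ≤ n)
    (C : Set (S → ℝ)) (hC : ∀ f ∈ C, ∀ s, |f s| ≤ 1)
    (hgC : ∀ i, g i ∈ C ∨ -g i ∈ C) (τ : ℝ) :
    (Measure.pi fun _ : Fin n => P)
      {x | ∃ i, n * ψ + c * n * RadF n C x + τ ≤ lam * (∑ j, g i (x j) - n * ∫ y, g i y ∂P)} ≤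
      ENNReal.ofReal (exp (-τ)) := by
  set μ := (Measure.pi fun _ : Fin n => P) with hμ
  set Q := (fun Φ : ι → ℝ => Finset.univ.sup' Finset.univ_nonempty Φ) with hQ
  have hMI := main_ineq h hm1 n Q nice_max 0
  have hI := integrand_int h n (nice_max (ι := ι)) 0
  have hn0 : (0:ℝ) < n := by exact_mod_cast hn
  have hA : ∀ x : Fin n → S, radA c g n Q x 0 ≤ c * n * RadF n C x := by
    intro x
    simp only [radA, RadF]
    rw [mul_div_assoc', div_le_div_iff_of_pos_right (by positivity), Finset.mul_sum]
    apply Finset.sum_le_sum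
    intro σ _
    apply Finset.sup'_le
    intro i _
    simp only [zero_add]
    rw [mul_assoc]
    apply mul_le_mul_of_nonneg_left _ h.c_pos.le
    have key : ∑ j, radSign (σ j) * g i (x j) ≤ n * |radAvg n x σ (g i)| := by
      unfold radAvg
      rw [abs_div, Nat.abs_cast, mul_div_cancel₀ _ hn0.ne']
      exact le_abs_self _
    refine key.trans ?_
    apply mul_le_mul_of_nonneg_left _ hn0.le
    rcases hgC i with hi | hi
    · exact le_csSup (bddAbove_rad hC σ) ⟨_, hi, rfl⟩
    · refine le_csSup (bddAbove_rad hC σ) ⟨_, hi, ?_⟩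
      simp only [radAvg, Pi.neg_apply, mul_neg, Finset.sum_neg_distrib, neg_div, abs_neg]
  have hsub : {x | ∃ i, n * ψ + c * n * RadF n C x + τ ≤
      lam * (∑ j, g i (x j) - n * ∫ y, g i y ∂P)} ⊆
      {x | exp τ ≤ integrand P g lam ψ c n Q 0 x} := by
    rintro x ⟨i, hi⟩
    simp only [mem_setOf_eq, integrand, exp_le_exp]
    have h1 : ∑ j, (lam * (g i (x j) - ∫ y, g i y ∂P) - ψ) ≤
        Q (0 + fun i => ∑ j, (lam * (g i (x j) - ∫ y, g i y ∂P) - ψ)) := by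
      rw [zero_add]
      exact Finset.le_sup' (fun i => ∑ j, (lam * (g i (x j) - ∫ y, g i y ∂P) - ψ))
        (Finset.mem_univ i)
    have h2 : ∑ j : Fin n, (lam * (g i (x j) - ∫ y, g i y ∂P) - ψ) =
        lam * (∑ j, g i (x j) - n * ∫ y, g i y ∂P) - n * ψ := by
      rw [Finset.sum_sub_distrib, ← Finset.mul_sum, Finset.sum_sub_distrib]; simp
    have := hA x
    linarith
  refine (measure_mono hsub).trans ?_
  have hmk := mul_meas_ge_le_integral_of_nonneg (μ := μ) (f := integrand P g lam ψ c n Q 0)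
    (Filter.Eventually.of_forall fun x => (exp_pos _).le) hI (exp τ)
  have hreal : μ.real {x | exp τ ≤ integrand P g lam ψ c n Q 0 x} ≤ exp (-τ) := by
    have := hmk.trans hMI
    rw [exp_neg, ← one_div, le_div_iff₀ (exp_pos _)]
    linarith
  rw [← ENNReal.ofReal_toReal (measure_ne_top μ _)]
  exact ENNReal.ofReal_le_ofReal hreal

/-- countable class deviation bound -/
lemma dev_count {S : Type*} [MeasurableSpace S] {P : Measure S} [IsProbabilityMeasure P]
    (G : Set (S → ℝ)) (hG : G.Countable)
    {lam m1 m2 ψ c : ℝ} (h : Setup P (fun g : G => g.1) lam m1 m2 ψ c) (hm1 : 0 ≤ m1)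
    (n : ℕ) (hn : 1 ≤ n)
    (C : Set (S → ℝ)) (hC : ∀ f ∈ C, ∀ s, |f s| ≤ 1)
    (hgC : ∀ g ∈ G, g ∈ C ∨ -g ∈ C) (τ : ℝ) :
    (Measure.pi fun _ : Fin n => P)
      {x | ∃ g ∈ G, n * ψ + c * n * RadF n C x + τ ≤ lam * (∑ j, g (x j) - n * ∫ y, g y ∂P)} ≤
      ENNReal.ofReal (exp (-τ)) := by
  rcases G.eq_empty_or_nonempty with rfl | hne
  · simp
  obtain ⟨φ, hφ⟩ := hG.exists_eq_range hne
  have hφG : ∀ k, φ k ∈ G := fun k => by rw [hφ]; exact mem_range_self k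
  have e : {x : Fin n → S | ∃ g ∈ G, n * ψ + c * n * RadF n C x + τ ≤
      lam * (∑ j, g (x j) - n * ∫ y, g y ∂P)} =
      ⋃ N : ℕ, {x | ∃ i : Fin (N + 1), n * ψ + c * n * RadF n C x + τ ≤
      lam * (∑ j, φ i (x j) - n * ∫ y, φ i y ∂P)} := by
    ext x
    simp only [mem_setOf_eq, mem_iUnion]
    constructor
    · rintro ⟨g, hg, hx⟩
      rw [hφ] at hg
      obtain ⟨k, rfl⟩ := hg
      exact ⟨k, Fin.last k, by simpa using hx⟩
    · rintro ⟨N, i, hx⟩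
      exact ⟨φ i, hφG i, hx⟩
  rw [e, Monotone.measure_iUnion]
  · apply iSup_le
    intro N
    apply dev_fin (g := fun i : Fin (N + 1) => φ i) (m1 := m1) (m2 := m2) _ hm1 n hn C hC
      (fun i => hgC _ (hφG i))
    exact ⟨fun i => h.meas ⟨φ i, hφG i⟩, fun i => h.bdd ⟨φ i, hφG i⟩, h.lam_nonneg,
      fun i => h.lower ⟨φ i, hφG i⟩, fun i => h.upper ⟨φ i, hφG i⟩, h.m2_nonneg, h.psi_nonneg,
      fun i => h.mgf ⟨φ i, hφG i⟩, h.c_pos, h.cond⟩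
  · intro N M hNM x
    rintro ⟨i, hx⟩
    exact ⟨⟨i, by have := i.2; omega⟩, hx⟩

end GB

end

section

open MeasureTheory ProbabilityTheory Real Set Filter Topology


namespace GB

/-- the constant `π / (√3 log 2)` -/
def K0 : ℝ := π / √3 / log 2

/-- `t + ell (2ρ)` -/
def tau (t ρ : ℝ) : ℝ := t + 2 * log (K0 * |log ρ|)

lemma sqrt3_bounds : (1.73205 : ℝ) < √3 ∧ √3 < 1.73206 := by
  constructor
  · rw [Real.lt_sqrt (by norm_num)]; norm_num
  · rw [Real.sqrt_lt' (by norm_num)]; norm_num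

lemma K0_gt : (2.6167 : ℝ) < K0 := by
  unfold K0
  have h1 := pi_gt_d6
  have h2 := sqrt3_bounds
  have h3 := log_two_gt_d9
  have h4 := log_two_lt_d9
  rw [lt_div_iff₀ (by linarith), lt_div_iff₀ (by linarith)]
  nlinarith

lemma K0_lt : K0 < (2.6169 : ℝ) := by
  unfold K0
  have h1 := pi_lt_d4
  have h2 := sqrt3_bounds
  have h3 := log_two_gt_d9
  have h4 := log_two_lt_d9
  rw [div_lt_iff₀ (by linarith), div_lt_iff₀ (by linarith)]
  nlinarith

lemma K0_pos : 0 < K0 := by have := K0_gt; linarith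

lemma ell_two_mul (t ρ : ℝ) : t + ell (2 * ρ) = tau t ρ := by
  unfold ell tau K0
  have h : (2:ℝ) / (2 * ρ) = ρ⁻¹ := by
    rw [mul_comm, ← div_div, div_right_comm, div_self (by norm_num), one_div]
  rw [h, Real.logb, Real.log_inv]
  congr 2
  rw [← Real.log_abs, abs_mul, abs_div, abs_div, abs_neg]
  congr 1
  rw [abs_of_pos pi_pos, abs_of_pos (show 0 < √3 by positivity),
    abs_of_pos (Real.log_pos one_lt_two)]
  ring

/-- `D` -/
def DD (n : ℕ) (t ρ : ℝ) : ℝ := ρ - √(4 * ρ * tau t ρ / n) - 10 * tau t ρ / (3 * n)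

/-- `c(2ρ)` -/
def c2 (n : ℕ) (t ρ : ℝ) : ℝ := 2 * ρ + √(4 * ρ * tau t ρ / n) + 10 * tau t ρ / (3 * n)

/-- abstract fixed point structure; `V ρ = U (2ρ)` -/
structure FP (n : ℕ) (t : ℝ) (Rs V r : ℝ → ℝ) : Prop where
  hn : 1 ≤ n
  mono : Monotone Rs
  nonneg : ∀ u, 0 ≤ Rs u
  le_one : ∀ u, Rs u ≤ 1
  const : ∀ u, 1 ≤ u → Rs u = Rs 1
  hV : ∀ ρ, V ρ = c2 n t ρ + 8 * Rs (V ρ)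
  hVmax : ∀ ρ u, u = c2 n t ρ + 8 * Rs u → u ≤ V ρ
  hr : ∀ δ ρ, DD n t ρ - 8 * Rs (V ρ) = δ → ρ ≤ r δ

lemma FP.tarski {n : ℕ} {t : ℝ} {Rs V r : ℝ → ℝ} (h : FP n t Rs V r) {ρ u : ℝ}
    (hu : u ≤ c2 n t ρ + 8 * Rs u) : u ≤ V ρ := by
  set A := {v | v ≤ c2 n t ρ + 8 * Rs v} with hA
  have hb : BddAbove A := ⟨c2 n t ρ + 8, fun v hv => by
    have h1 : v ≤ c2 n t ρ + 8 * Rs v := hv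
    have := h.le_one v; linarith⟩
  have huA : u ∈ A := hu
  have h1 : sSup A ≤ c2 n t ρ + 8 * Rs (sSup A) := by
    apply csSup_le ⟨u, huA⟩
    intro v hv
    have h1 : v ≤ c2 n t ρ + 8 * Rs v := hv
    have := h.mono (le_csSup hb hv); linarith
  have h2 : c2 n t ρ + 8 * Rs (sSup A) ∈ A := by
    have := h.mono h1
    rw [hA, Set.mem_setOf]
    linarith
  have h3 := le_csSup hb h2
  have h4 := h.hVmax ρ (sSup A) (le_antisymm h1 h3)
  exact (le_csSup hb huA).trans h4

lemma FP.V_mono {n : ℕ} {t : ℝ} {Rs V r : ℝ → ℝ} (h : FP n t Rs V r) {ρ ρ' : ℝ}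
    (hc : c2 n t ρ ≤ c2 n t ρ') : V ρ ≤ V ρ' := by
  apply h.tarski
  have := h.hV ρ
  linarith

lemma FP.c2_le_V {n : ℕ} {t : ℝ} {Rs V r : ℝ → ℝ} (h : FP n t Rs V r) (ρ : ℝ) :
    c2 n t ρ ≤ V ρ := by
  have := h.hV ρ
  have := h.nonneg (V ρ)
  linarith

lemma FP.B_mono {n : ℕ} {t : ℝ} {Rs V r : ℝ → ℝ} (h : FP n t Rs V r) {ρ ρ' : ℝ}
    (hc : c2 n t ρ ≤ c2 n t ρ') : Rs (V ρ) ≤ Rs (V ρ') := h.mono (h.V_mono hc)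

/-- attaining the level at the supremum -/
lemma sup_attain {D B : ℝ → ℝ} {δ : ℝ} {I : Set ℝ} (hI : IsOpen I)
    {p : ℝ} (hp : IsLUB {ρ ∈ I | D ρ - B ρ ≤ δ} p) (hpI : p ∈ I)
    (hD : ContinuousAt D p)
    (hl : ∀ᶠ ρ in 𝓝[<] p, B ρ ≤ B p) (hr : ∀ᶠ ρ in 𝓝[>] p, B p ≤ B ρ)
    (hne : {ρ ∈ I | D ρ - B ρ ≤ δ}.Nonempty) : D p - B p = δ := by
  apply le_antisymm
  · by_contra hcon
    push Not at hcon
    have h1 : ∀ᶠ ρ in 𝓝 p, δ + B p < D ρ :=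
      hD.eventually (lt_mem_nhds (by linarith))
    have hl' : ∀ᶠ ρ in 𝓝[≤] p, B ρ ≤ B p := by
      rw [← Iio_insert, nhdsWithin_insert, eventually_sup]
      exact ⟨by simp, hl⟩
    have hf := hp.frequently_mem hne
    have h2 : ∀ᶠ ρ in 𝓝[≤] p, δ + B p < D ρ := nhdsWithin_le_nhds h1
    obtain ⟨ρ, hρ, h3, h4⟩ := (hf.and_eventually (hl'.and h2)).exists
    have := hρ.2
    linarith
  · have h1 : ∀ᶠ ρ in 𝓝[>] p, δ + B p ≤ D ρ := by
      have hI' : ∀ᶠ ρ in 𝓝[>] p, ρ ∈ I := nhdsWithin_le_nhds (hI.mem_nhds hpI)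
      filter_upwards [hr, hI', self_mem_nhdsWithin] with ρ h1 h2 h3
      by_contra hcon
      push Not at hcon
      have : ρ ≤ p := hp.1 ⟨h2, by linarith⟩
      exact absurd h3 (not_lt.2 this)
    have := ge_of_tendsto (hD.tendsto.mono_left nhdsWithin_le_nhds : Tendsto D (𝓝[>] p) _) h1
    linarith

lemma tau_continuousAt (t : ℝ) {p : ℝ} (hp0 : 0 < p) (hp1 : p ≠ 1) : ContinuousAt (tau t) p := by
  unfold tau
  have hl : log p ≠ 0 := by
    rw [Real.log_ne_zero]; exact ⟨hp0.ne', hp1, by linarith⟩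
  have h1 : ContinuousAt (fun ρ => K0 * |log ρ|) p :=
    ((Real.continuousAt_log hp0.ne').abs).const_mul _
  have h2 : K0 * |log p| ≠ 0 := mul_ne_zero K0_pos.ne' (abs_ne_zero.2 hl)
  exact ((h1.log h2).const_mul 2).const_add t

lemma DD_continuousAt (n : ℕ) (t : ℝ) {p : ℝ} (hp0 : 0 < p) (hp1 : p ≠ 1) :
    ContinuousAt (DD n t) p := by
  unfold DD
  have := tau_continuousAt t hp0 hp1
  fun_prop

lemma c2_continuousAt (n : ℕ) (t : ℝ) {p : ℝ} (hp0 : 0 < p) (hp1 : p ≠ 1) :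
    ContinuousAt (c2 n t) p := by
  unfold c2
  have := tau_continuousAt t hp0 hp1
  fun_prop

lemma c2_le_c2 (n : ℕ) (t : ℝ) {ρ ρ' : ℝ} (h0 : 0 ≤ ρ) (h : ρ ≤ ρ') (hτ : tau t ρ ≤ tau t ρ') :
    c2 n t ρ ≤ c2 n t ρ' := by
  unfold c2
  have h1 : √(4 * ρ * tau t ρ / n) ≤ √(4 * ρ' * tau t ρ' / n) := by
    rcases le_total (tau t ρ) 0 with hn | hp
    · rw [Real.sqrt_eq_zero_of_nonpos]
      · positivity
      · apply div_nonpos_of_nonpos_of_nonneg _ (Nat.cast_nonneg n)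
        nlinarith
    · have h0' : 0 ≤ ρ' := h0.trans h
      apply Real.sqrt_le_sqrt
      gcongr
  have h2 : 10 * tau t ρ / (3 * n) ≤ 10 * tau t ρ' / (3 * n) := by gcongr
  linarith

lemma tau_mono_gt (t : ℝ) {ρ ρ' : ℝ} (h1 : 1 < ρ) (h : ρ ≤ ρ') : tau t ρ ≤ tau t ρ' := by
  unfold tau
  have hl : 0 < log ρ := Real.log_pos h1
  have hll : log ρ ≤ log ρ' := Real.log_le_log (by linarith) h
  have := K0_pos
  rw [abs_of_pos hl, abs_of_pos (hl.trans_le hll)]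
  gcongr

lemma DD_tendsto_bound {n : ℕ} (hn : 1 ≤ n) {t M : ℝ} (ht : 0 ≤ t) :
    ∃ R : ℝ, ∀ ρ, 1 < ρ → DD n t ρ ≤ M → ρ ≤ R := by
  refine ⟨10 * (|M| + 6 * t + 12 * 3 * log 1000), ?_⟩
  intro ρ hρ hD
  have hn1 : (1:ℝ) ≤ n := by exact_mod_cast hn
  have hl : 0 < log ρ := Real.log_pos hρ
  have hK := K0_lt
  have hK' := K0_pos
  set s := max (tau t ρ) 0 with hs
  have hs0 : 0 ≤ s := le_max_right _ _
  have hτs : tau t ρ ≤ s := le_max_left _ _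
  have h1 : √(4 * ρ * tau t ρ / n) ≤ ρ / 2 + 2 * s := by
    rw [Real.sqrt_le_left (by positivity), div_le_iff₀ (by linarith)]
    have : 4 * ρ * tau t ρ ≤ 4 * ρ * s := by gcongr
    have : 4 * ρ * s ≤ (ρ / 2 + 2 * s) ^ 2 := by nlinarith [sq_nonneg (ρ / 2 - 2 * s)]
    have h3 : 0 ≤ (ρ / 2 + 2 * s) ^ 2 := by positivity
    nlinarith
  have h2 : 10 * tau t ρ / (3 * n) ≤ 4 * s := by
    rw [div_le_iff₀ (by positivity)]
    nlinarith
  have h3 : s ≤ t + 2 * 3 * log ρ := by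
    apply max_le _ (by positivity)
    unfold tau
    rw [abs_of_pos hl]
    have := Real.log_le_self (show 0 ≤ K0 * log ρ by positivity)
    nlinarith
  have h4 : log ρ ≤ ρ / 1000 + log 1000 := by
    have e : log ρ = log (ρ / 1000) + log 1000 := by
      rw [← Real.log_mul (by positivity) (by norm_num)]; congr 1; field_simp
    have := Real.log_le_self (show 0 ≤ ρ / 1000 by positivity)
    linarith
  have h5 := le_abs_self M
  have h6 : 0 ≤ log (1000:ℝ) := Real.log_nonneg (by norm_num)
  unfold DD at hD
  linarith

/-- Case R of the localization lemma. -/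
lemma caseR {n : ℕ} {t : ℝ} {Rs V r : ℝ → ℝ} (h : FP n t Rs V r) (ht : 0 ≤ t) {δ ρ₁ : ℝ}
    (h1 : 1 < ρ₁) (hK : DD n t ρ₁ - 8 * Rs (V ρ₁) ≤ δ) : ρ₁ ≤ r δ := by
  set A := {ρ ∈ Ioi (1:ℝ) | DD n t ρ - 8 * Rs (V ρ) ≤ δ} with hA
  have hm : ρ₁ ∈ A := ⟨h1, hK⟩
  obtain ⟨R, hR⟩ := DD_tendsto_bound h.hn (M := δ + 8) ht
  have hb : BddAbove A := ⟨R, fun ρ hρ => hR ρ hρ.1 (by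
    have := hρ.2; have := h.le_one (V ρ); linarith)⟩
  have hp := isLUB_csSup ⟨ρ₁, hm⟩ hb
  set p := sSup A
  have hp1 : ρ₁ ≤ p := le_csSup hb hm
  have hp1' : 1 < p := h1.trans_le hp1
  have key := sup_attain (D := DD n t) (B := fun ρ => 8 * Rs (V ρ)) (δ := δ) isOpen_Ioi hp
    hp1' (DD_continuousAt n t (by linarith) hp1'.ne') ?_ ?_ ⟨ρ₁, hm⟩
  · exact hp1.trans (h.hr δ p key)
  · filter_upwards [self_mem_nhdsWithin, nhdsWithin_le_nhds (Ioi_mem_nhds hp1')] with ρ h2 h3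
    have h2' : ρ < p := h2
    have h3' : 1 < ρ := h3
    have := h.B_mono (c2_le_c2 n t (by linarith) h2'.le (tau_mono_gt t h3' h2'.le))
    linarith
  · filter_upwards [self_mem_nhdsWithin] with ρ h2
    have h2' : p < ρ := h2
    have := h.B_mono (c2_le_c2 n t (by linarith) h2'.le (tau_mono_gt t hp1' h2'.le))
    linarith

end GB

end

section

open MeasureTheory ProbabilityTheory Real Set Filter Topology


namespace GB

lemma tau_hasDerivAt (t : ℝ) {p : ℝ} (hp0 : 0 < p) (hp1 : p < 1) :
    HasDerivAt (tau t) (2 / (p * log p)) p := by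
  have hl : log p < 0 := Real.log_neg hp0 hp1
  have h1 : HasDerivAt (fun ρ => t + 2 * (log K0 + log (log ρ))) (2 * (p⁻¹ / log p)) p :=
    ((((Real.hasDerivAt_log hp0.ne').log hl.ne).const_add _).const_mul 2).const_add t
  have e : 2 / (p * log p) = 2 * (p⁻¹ / log p) := by field_simp
  rw [e]
  refine h1.congr_of_eventuallyEq ?_
  have : ∀ᶠ ρ in 𝓝 p, 0 < ρ ∧ ρ < 1 := (lt_mem_nhds hp0).and (gt_mem_nhds hp1)
  filter_upwards [this] with ρ hρ
  have : log ρ < 0 := Real.log_neg hρ.1 hρ.2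
  unfold tau
  rw [Real.log_mul K0_pos.ne' (abs_ne_zero.2 this.ne), Real.log_abs]

lemma deriv_pos_sides {f : ℝ → ℝ} {f' p : ℝ} (h : HasDerivAt f f' p) (hf : 0 < f') :
    (∀ᶠ ρ in 𝓝[<] p, f ρ ≤ f p) ∧ (∀ᶠ ρ in 𝓝[>] p, f p ≤ f ρ) := by
  have h1 := (hasDerivAt_iff_tendsto_slope.1 h).eventually (lt_mem_nhds hf)
  constructor
  · have h2 : ∀ᶠ ρ in 𝓝[<] p, 0 < slope f p ρ :=
      nhdsWithin_mono p (fun x hx => ne_of_lt hx) h1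
    filter_upwards [h2, self_mem_nhdsWithin] with ρ h3 h4
    have h4' : ρ < p := h4
    rw [slope_def_field] at h3
    have := (div_pos_iff.1 h3).resolve_left (fun hh => by linarith [hh.2])
    linarith [this.1]
  · have h2 : ∀ᶠ ρ in 𝓝[>] p, 0 < slope f p ρ :=
      nhdsWithin_mono p (fun x hx => ne_of_gt hx) h1
    filter_upwards [h2, self_mem_nhdsWithin] with ρ h3 h4
    have h4' : p < ρ := h4
    rw [slope_def_field] at h3
    have := (div_pos_iff.1 h3).resolve_right (fun hh => by linarith [hh.2])
    linarith [this.1]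

lemma tau_half {t p : ℝ} (ht : log 2 ≤ t) (hp0 : 0 < p) (hp1 : p ≤ 1 / 2) :
    1.835 ≤ tau t p ∧ 0.693 ≤ -log p := by
  have h2 := log_two_gt_d9
  have hlp : log p ≤ - log 2 := by
    have := Real.log_le_log hp0 hp1
    rwa [one_div, Real.log_inv] at this
  refine ⟨?_, by linarith⟩
  unfold tau
  rw [abs_of_neg (by linarith)]
  have hK := K0_gt
  have h3 : (1.8 : ℝ) ≤ K0 * -log p := by nlinarith
  have h4 := Real.log_le_log (by norm_num) h3
  have h5 := Real.le_log_one_add_of_nonneg (show (0:ℝ) ≤ 0.8 by norm_num)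
  norm_num at h5 h4 ⊢
  linarith

/-- in the lower half the function `c2` is locally increasing where `DD ≥ 0` -/
lemma c2_local_mono {n : ℕ} (hn : 1 ≤ n) {t p : ℝ} (ht : log 2 ≤ t) (hp0 : 0 < p)
    (hp1 : p ≤ 1 / 2) (hD : 0 ≤ DD n t p) :
    (∀ᶠ ρ in 𝓝[<] p, c2 n t ρ ≤ c2 n t p) ∧ (∀ᶠ ρ in 𝓝[>] p, c2 n t p ≤ c2 n t ρ) := by
  have hn0 : (0:ℝ) < n := by exact_mod_cast hn
  obtain ⟨hτ, hL⟩ := tau_half ht hp0 hp1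
  have hτ0 : 0 < tau t p := by linarith
  have hd := tau_hasDerivAt t hp0 (by linarith : p < 1)
  have hq0 : 0 < 4 * p * tau t p / n := by positivity
  have hin : HasDerivAt (fun ρ => 4 * ρ * tau t ρ / n)
      ((4 * 1 * tau t p + 4 * p * (2 / (p * log p))) / n) p :=
    (((hasDerivAt_id p).const_mul 4).mul hd).div_const _
  have hc : HasDerivAt (c2 n t) (2 * 1 + ((4 * 1 * tau t p + 4 * p * (2 / (p * log p))) / n) /
      (2 * √(4 * p * tau t p / n)) + 10 * (2 / (p * log p)) / (3 * n)) p :=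
    ((((hasDerivAt_id p).const_mul 2)).add (hin.sqrt hq0.ne')).add
      ((hd.const_mul 10).div_const _)
  apply deriv_pos_sides hc
  unfold DD at hD
  set q := √(4 * p * tau t p / n) with hq
  have hqpos : 0 < q := Real.sqrt_pos.2 hq0
  have hq2 : q ^ 2 = 4 * p * tau t p / n := Real.sq_sqrt hq0.le
  set τ := tau t p
  set L := -log p with hLdef
  have hlog : log p = -L := by rw [hLdef]; ring
  rw [hlog]
  set a := τ / n with ha
  have ha0 : 0 < a := by positivity
  set m := 2 / (L * τ) with hm
  have hL0 : 0 < L := by linarith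
  have hm0 : 0 < m := by positivity
  have hmle : m ≤ 1.6 := by
    rw [hm, div_le_iff₀ (by positivity)]; nlinarith
  have h10 : 10 * a / 3 ≤ p := by
    have : 10 * τ / (3 * n) = 10 * a / 3 := by rw [ha]; field_simp
    linarith
  have e1 : ((4 * 1 * τ + 4 * p * (2 / (p * -L))) / n) / (2 * q) = 2 * (a / q) * (1 - m) := by
    rw [ha, hm]; field_simp; ring
  have e2 : 10 * (2 / (p * -L)) / (3 * n) = - (10 * a / 3 / p) * m := by
    rw [ha, hm]; field_simp
  rw [e1, e2]
  have h11 : 10 * a / 3 / p ≤ 1 := by rw [div_le_one hp0]; exact h10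
  have h12 : a / q ≤ 0.28 := by
    rw [div_le_iff₀ hqpos]
    have : q ^ 2 = 4 * p * a := by rw [hq2, ha]; ring
    have : a ^ 2 ≤ (0.28 * q) ^ 2 := by nlinarith
    exact abs_le_of_sq_le_sq' this (by positivity) |>.2
  have h13 : 0 ≤ a / q := by positivity
  rcases le_total m 1 with h | h
  · have : 0 ≤ 2 * (a / q) * (1 - m) := by
      apply mul_nonneg (by linarith) (by linarith)
    nlinarith
  · have : (a / q) * (m - 1) ≤ 0.28 * (m - 1) :=
      mul_le_mul_of_nonneg_right h12 (by linarith)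
    nlinarith

/-- if `τ` is very negative at `ρ ∈ (1/2,1)`, we can jump over `1` -/
lemma jump {n : ℕ} {t : ℝ} {Rs V r : ℝ → ℝ} (h : FP n t Rs V r) (ht : log 2 ≤ t) {δ ρ : ℝ}
    (h0 : 1 / 2 < ρ) (h1 : ρ < 1) (hK : DD n t ρ - 8 * Rs (V ρ) ≤ δ)
    (hτ : tau t ρ < -0.155 * n) :
    ∃ ρ', 1 < ρ' ∧ DD n t ρ' - 8 * Rs (V ρ') ≤ δ := by
  have hn1 : (1:ℝ) ≤ n := by exact_mod_cast h.hn
  have hn0 : (0:ℝ) < n := by linarith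
  set x := -log ρ with hx
  have hl : log ρ < 0 := Real.log_neg (by linarith) h1
  have hx0 : 0 < x := by linarith
  have habs : |log ρ| = x := abs_of_neg hl
  have hK0 := K0_gt
  have h2 := log_two_gt_d9
  -- bound on x
  have hxb : x * exp (0.0775 * n) ≤ 0.27025 := by
    unfold tau at hτ
    rw [habs] at hτ
    have h3 : log (K0 * x) + 0.0775 * n < -(log 2 / 2) := by linarith
    have h4 : log (K0 * x * exp (0.0775 * n)) < log ((√2)⁻¹) := by
      rw [Real.log_mul (by have := K0_pos; positivity) (exp_pos _).ne', Real.log_exp,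
        Real.log_inv, Real.log_sqrt (by norm_num)]
      linarith
    have h5 := (Real.log_lt_log_iff (by have := K0_pos; positivity) (by positivity)).1 h4
    have h6 : (√2)⁻¹ ≤ 0.70711 := by
      rw [inv_le_comm₀ (by positivity) (by norm_num)]
      apply Real.le_sqrt_of_sq_le; norm_num
    have h7 : 0 < x * exp (0.0775 * n) := by positivity
    nlinarith
  have hexp1 : 1 + 0.0775 * n ≤ exp (0.0775 * n) := by
    have := add_one_le_exp (0.0775 * (n:ℝ)); linarith
  have hx25 : x ≤ 0.251 := by
    have : x * 1.0775 ≤ x * exp (0.0775 * n) := by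
      apply mul_le_mul_of_nonneg_left _ hx0.le; linarith
    linarith
  have hnx : 5 * x * n ≤ 6.45 := by
    have h3 := add_one_le_exp (0.0775 * (n:ℝ) - 1)
    rw [Real.exp_sub] at h3
    have h4 : 0.0775 * n * exp 1 ≤ exp (0.0775 * n) := by
      rw [le_div_iff₀ (exp_pos _)] at h3; linarith
    have h5 := exp_one_gt_d9
    have h6 : 0.0775 * n * 2.718 ≤ exp (0.0775 * n) := by
      refine le_trans ?_ h4
      apply mul_le_mul_of_nonneg_left (by linarith) (by positivity)
    have : x * (0.0775 * n * 2.718) ≤ x * exp (0.0775 * n) :=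
      mul_le_mul_of_nonneg_left h6 hx0.le
    nlinarith
  refine ⟨1 + 4 * x, by linarith, ?_⟩
  have hlog : 2.66 * x ≤ log (1 + 4 * x) := by
    refine le_trans ?_ (Real.le_log_one_add_of_nonneg (show 0 ≤ 4 * x by linarith))
    rw [le_div_iff₀ (by linarith)]
    nlinarith
  have hlogp : 0 < log (1 + 4 * x) := by nlinarith
  have hl266 : 0.97 ≤ log (2.66:ℝ) := by
    rw [Real.le_log_iff_exp_le (by norm_num)]
    have h5 := exp_one_lt_d9
    have e : exp (0.97:ℝ) = exp 1 * exp (-0.03) := by rw [← exp_add]; norm_num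
    have h6 : exp (-0.03:ℝ) ≤ 1 / (1 + 0.03) := by
      rw [Real.exp_neg, ← one_div]
      apply one_div_le_one_div_of_le (by norm_num)
      have := add_one_le_exp (0.03:ℝ); linarith
    rw [e]
    have := exp_pos (-0.03:ℝ)
    norm_num at h6 ⊢
    nlinarith
  have hτd : tau t ρ + 2 * log 2.66 ≤ tau t (1 + 4 * x) := by
    unfold tau
    rw [habs, abs_of_pos hlogp]
    have : log (K0 * x) + log 2.66 ≤ log (K0 * log (1 + 4 * x)) := by
      rw [← Real.log_mul (by have := K0_pos; positivity) (by norm_num)]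
      apply Real.log_le_log (by have := K0_pos; positivity)
      have := K0_pos
      nlinarith
    linarith
  have hex : 1 - x ≤ ρ := by
    have := Real.add_one_le_exp (log ρ)
    rw [Real.exp_log (by linarith)] at this
    linarith
  have hB := h.B_mono (c2_le_c2 n t (by linarith) (by linarith : ρ ≤ 1 + 4 * x)
    (by linarith : tau t ρ ≤ tau t (1 + 4 * x)))
  have hDle : DD n t (1 + 4 * x) ≤ DD n t ρ := by
    unfold DD
    have e : √(4 * ρ * tau t ρ / n) = 0 := by
      apply Real.sqrt_eq_zero_of_nonpos
      apply div_nonpos_of_nonpos_of_nonneg _ hn0.le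
      nlinarith
    rw [e]
    have h3 := Real.sqrt_nonneg (4 * (1 + 4 * x) * tau t (1 + 4 * x) / n)
    have h4 : 10 * tau t ρ / (3 * n) + 5 * x ≤ 10 * tau t (1 + 4 * x) / (3 * n) := by
      rw [div_add' _ _ _ (by positivity), div_le_div_iff_of_pos_right (by positivity)]
      nlinarith
    linarith
  linarith

lemma log_76 : (0.2727 : ℝ) ≤ -log 0.76 := by
  have h := Real.le_log_one_add_of_nonneg (show (0:ℝ) ≤ 6/19 by norm_num)
  have e : log (0.76:ℝ) = - log (1 + 6/19) := by rw [← Real.log_inv]; norm_num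
  rw [e]; norm_num at h ⊢; linarith

/-- The localization lemma. -/
theorem lemmaJ {n : ℕ} {t : ℝ} {Rs V r : ℝ → ℝ} (h : FP n t Rs V r) (ht : log 2 ≤ t) {δ ρ₀ : ℝ}
    (hδ : 0 ≤ δ) (h0 : 0 < ρ₀) (h1 : ρ₀ ≠ 1) (hK : DD n t ρ₀ - 8 * Rs (V ρ₀) ≤ δ) :
    min ρ₀ 1 ≤ r δ := by
  have h2 := log_two_gt_d9
  have hn1 : (1:ℝ) ≤ n := by exact_mod_cast h.hn
  have hn0 : (0:ℝ) < n := by linarith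
  by_cases hR : ∃ ρ', 1 < ρ' ∧ DD n t ρ' - 8 * Rs (V ρ') ≤ δ
  · obtain ⟨ρ', h3, h4⟩ := hR
    exact (min_le_right _ _).trans (h3.le.trans (caseR h (by linarith) h3 h4))
  have hlt : ρ₀ < 1 := by
    rcases lt_or_gt_of_ne h1 with h3 | h3
    · exact h3
    · exact absurd ⟨ρ₀, h3, hK⟩ hR
  rw [min_eq_left hlt.le]
  set A := {ρ ∈ Ioo (0:ℝ) 1 | DD n t ρ - 8 * Rs (V ρ) ≤ δ} with hA
  have hm : ρ₀ ∈ A := ⟨⟨h0, hlt⟩, hK⟩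
  -- bounded away from 1
  obtain ⟨b, hb1, hb⟩ : ∃ b < 1, ∀ ρ ∈ A, ρ ≤ b := by
    refine ⟨max (1/2) (exp (-(exp (-(0.155 * n + t) / 2) / K0))), ?_, ?_⟩
    · apply max_lt (by norm_num)
      rw [Real.exp_lt_one_iff]
      have := K0_pos
      have : 0 < exp (-(0.155 * n + t) / 2) / K0 := by positivity
      linarith
    · intro ρ hρ
      by_contra hcon
      push Not at hcon
      have hc1 := (max_lt_iff.1 hcon).1
      have hc2 := (max_lt_iff.1 hcon).2
      apply hR
      apply jump h ht hc1 hρ.1.2 hρ.2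
      have hl : log ρ < 0 := Real.log_neg hρ.1.1 hρ.1.2
      have h3 : -(exp (-(0.155 * n + t) / 2) / K0) < log ρ := by
        rwa [Real.lt_log_iff_exp_lt hρ.1.1]
      have hKp := K0_pos
      unfold tau
      rw [abs_of_neg hl]
      have h4 : K0 * -log ρ < exp (-(0.155 * n + t) / 2) := by
        have : -log ρ < exp (-(0.155 * n + t) / 2) / K0 := by linarith
        rw [lt_div_iff₀ hKp] at this; linarith
      have h5 : log (K0 * -log ρ) < -(0.155 * n + t) / 2 := by
        rw [Real.log_lt_iff_lt_exp (mul_pos hKp (by linarith))]; exact h4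
      linarith
  have hbb : BddAbove A := ⟨b, hb⟩
  have hp := isLUB_csSup ⟨ρ₀, hm⟩ hbb
  set p := sSup A
  have hp0' : ρ₀ ≤ p := le_csSup hbb hm
  have hp0 : 0 < p := by linarith
  have hp1 : p < 1 := (csSup_le ⟨ρ₀, hm⟩ hb).trans_lt hb1
  have hDc := DD_continuousAt n t hp0 hp1.ne
  -- to the right of p, K > δ
  have hright : ∀ᶠ ρ in 𝓝[>] p, δ < DD n t ρ - 8 * Rs (V ρ) := by
    filter_upwards [self_mem_nhdsWithin, nhdsWithin_le_nhds (Iio_mem_nhds hp1)] with ρ h3 h4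
    by_contra hcon
    push Not at hcon
    have h3' : p < ρ := h3
    have : ρ ≤ p := hp.1 ⟨⟨by linarith, h4⟩, hcon⟩
    linarith
  suffices hs : (∀ᶠ ρ in 𝓝[<] p, 8 * Rs (V ρ) ≤ 8 * Rs (V p)) ∧
      (∀ᶠ ρ in 𝓝[>] p, 8 * Rs (V p) ≤ 8 * Rs (V ρ)) by
    have key := sup_attain (D := DD n t) (B := fun ρ => 8 * Rs (V ρ)) (δ := δ) isOpen_Ioo hp
      ⟨hp0, hp1⟩ hDc hs.1 hs.2 ⟨ρ₀, hm⟩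
    exact hp0'.trans (h.hr δ p key)
  rcases le_or_gt p (1/2) with hph | hph
  · have hD0 : 0 ≤ DD n t p := by
      refine ge_of_tendsto (hDc.tendsto.mono_left nhdsWithin_le_nhds :
        Tendsto (DD n t) (𝓝[>] p) _) ?_
      filter_upwards [hright] with ρ h3
      have := h.nonneg (V ρ)
      linarith
    obtain ⟨hl, hr⟩ := c2_local_mono h.hn ht hp0 hph hD0
    constructor
    · filter_upwards [hl] with ρ h3
      have := h.B_mono h3; linarith
    · filter_upwards [hr] with ρ h3
      have := h.B_mono h3; linarith
  · -- tau is not too negative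
    have hτ : -0.155 * n ≤ tau t p := by
      by_contra hcon
      push Not at hcon
      have h3 : ∀ᶠ ρ in 𝓝[≤] p, tau t ρ < -0.155 * n ∧ 1/2 < ρ :=
        nhdsWithin_le_nhds (((tau_continuousAt t hp0 hp1.ne).eventually (gt_mem_nhds hcon)).and
          (lt_mem_nhds hph))
      obtain ⟨ρ, hρ, h4, h5⟩ := ((hp.frequently_mem ⟨ρ₀, hm⟩).and_eventually h3).exists
      exact hR (jump h ht h5 hρ.1.2 hρ.2 h4)
    have hc1 : 1 < c2 n t p := by
      unfold c2
      have hsq := Real.sqrt_nonneg (4 * p * tau t p / n)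
      rcases le_or_gt p 0.76 with h3 | h3
      · have hτ0 : 0 ≤ tau t p := by
          unfold tau
          have hl : log p ≤ log 0.76 := Real.log_le_log hp0 h3
          have := log_76
          rw [abs_of_neg (by linarith)]
          have hK := K0_gt
          have h5 : exp (-(0.3465)) ≤ K0 * -log p := by
            have : exp (-(0.3465:ℝ)) ≤ 1 / (1 + 0.3465 + 0.3465^2/2) := by
              rw [Real.exp_neg, ← one_div]
              apply one_div_le_one_div_of_le (by norm_num)
              have := Real.quadratic_le_exp_of_nonneg (show (0:ℝ) ≤ 0.3465 by norm_num)
              linarith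
            have h7 : exp (-(0.3465:ℝ)) ≤ 0.7111 := this.trans (by norm_num)
            refine h7.trans ?_
            have h8 : (0.2727:ℝ) ≤ -log p := by linarith
            nlinarith
          have h6 := (Real.le_log_iff_exp_le (by nlinarith)).2 h5
          linarith
        have : 0 ≤ 10 * tau t p / (3 * n) := by positivity
        linarith
      · have : -0.517 ≤ 10 * tau t p / (3 * n) := by
          rw [le_div_iff₀ (by positivity)]; linarith
        linarith
    have hc := (c2_continuousAt n t hp0 hp1.ne).eventually (lt_mem_nhds hc1)
    have hp' := h.const _ (hc1.le.trans (h.c2_le_V p))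
    have hev : ∀ᶠ ρ in 𝓝 p, Rs (V ρ) = Rs (V p) := by
      filter_upwards [hc] with ρ h3
      rw [hp', h.const _ (h3.le.trans (h.c2_le_V ρ))]
    constructor
    · filter_upwards [nhdsWithin_le_nhds hev] with ρ h3
      rw [h3]
    · filter_upwards [nhdsWithin_le_nhds hev] with ρ h3
      rw [h3]

end GB

end

section

open MeasureTheory ProbabilityTheory Real Set Filter Topology


namespace GB

/-- admissible function -/
structure Adm {S : Type*} [MeasurableSpace S] (f : S → ℝ) : Prop where
  meas : Measurable f
  rng : ∀ s, f s ∈ Icc (0:ℝ) 1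

lemma Adm.absle {S : Type*} [MeasurableSpace S] {f : S → ℝ} (h : Adm f) (s : S) : |f s| ≤ 1 := by
  have := h.rng s
  rw [abs_le]; constructor <;> linarith [this.1, this.2]

lemma Adm.int {S : Type*} [MeasurableSpace S] {f : S → ℝ} (h : Adm f) (P : Measure S)
    [IsProbabilityMeasure P] : Integrable f P := integrable_of_bdd h.meas 1 h.absle

lemma Adm.mean {S : Type*} [MeasurableSpace S] {f : S → ℝ} (h : Adm f) (P : Measure S)
    [IsProbabilityMeasure P] : ∫ s, f s ∂P ∈ Icc (0:ℝ) 1 := by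
  constructor
  · exact integral_nonneg fun s => (h.rng s).1
  · have := integral_mono (h.int P) (integrable_const (1:ℝ)) (fun s => (h.rng s).2)
    simpa using this

lemma Adm.var {S : Type*} [MeasurableSpace S] {f : S → ℝ} (h : Adm f) (P : Measure S)
    [IsProbabilityMeasure P] :
    ∫ s, (f s - ∫ y, f y ∂P) ^ 2 ∂P ≤ (∫ y, f y ∂P) * (1 - ∫ y, f y ∂P) := by
  set m := ∫ y, f y ∂P with hm
  have h1 : ∫ s, (f s - m) ^ 2 ∂P ≤ ∫ s, ((1 - 2 * m) * f s + m ^ 2) ∂P := by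
    apply integral_mono
    · refine integrable_of_bdd ((h.meas.sub_const m).pow_const 2) 1 fun s => ?_
      have := h.rng s
      have h2 := h.mean P
      rw [abs_of_nonneg (sq_nonneg _)]
      rw [← hm] at h2
      nlinarith [this.1, this.2, h2.1, h2.2]
    · exact ((h.int P).const_mul _).add (integrable_const _)
    · intro s
      have := h.rng s
      simp only
      nlinarith [this.1, this.2]
  refine h1.trans (le_of_eq ?_)
  rw [integral_add ((h.int P).const_mul _) (integrable_const _), integral_const_mul, ← hm]
  simp; ring

lemma exp_le_cubic {y lam : ℝ} (hl : lam ≤ 1) (hy : |y| ≤ lam) :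
    exp y ≤ 1 + y + y ^ 2 / 2 * (1 + 4 * lam / 9) := by
  have h := Real.exp_bound (hy.trans hl) (show 0 < 3 by norm_num)
  have h2 := (abs_le.1 h).2
  simp [Finset.sum_range_succ, Nat.factorial] at h2
  have h3 : |y| ^ 3 ≤ lam * y ^ 2 := by
    rw [← sq_abs y]; nlinarith [sq_nonneg |y|]
  nlinarith

lemma mgf_var {S : Type*} [MeasurableSpace S] {P : Measure S} [IsProbabilityMeasure P]
    {g : S → ℝ} (hg : Measurable g) (hb : ∀ s, |g s| ≤ 1)
    (hc : ∀ s, |g s - ∫ y, g y ∂P| ≤ 1) {v lam : ℝ} (h0 : 0 ≤ lam) (h1 : lam ≤ 1)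
    (hv : ∫ s, (g s - ∫ y, g y ∂P) ^ 2 ∂P ≤ v) :
    ∫ s, exp (lam * (g s - ∫ y, g y ∂P)) ∂P ≤ exp (v * lam ^ 2 / 2 * (1 + 4 * lam / 9)) := by
  set m := ∫ y, g y ∂P with hm
  have hi : Integrable g P := integrable_of_bdd hg 1 hb
  have hi2 : Integrable (fun s => (g s - m) ^ 2) P := by
    refine integrable_of_bdd ((hg.sub_const m).pow_const 2) 1 fun s => ?_
    rw [abs_of_nonneg (sq_nonneg _), sq_le_one_iff_abs_le_one]; exact hc s
  have hi3 : Integrable (fun s => lam * (g s - m)) P := (hi.sub (integrable_const _)).const_mul _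
  have hi4 : Integrable (fun s => lam ^ 2 / 2 * (1 + 4 * lam / 9) * (g s - m) ^ 2) P :=
    hi2.const_mul _
  have hi5 : Integrable (fun s => 1 + lam * (g s - m)) P := (integrable_const _).add hi3
  have key : ∫ s, exp (lam * (g s - m)) ∂P ≤
      ∫ s, ((1 + lam * (g s - m)) + lam ^ 2 / 2 * (1 + 4 * lam / 9) * (g s - m) ^ 2) ∂P := by
    apply integral_mono
    · refine integrable_of_bdd ?_ (exp 1) fun s => ?_
      · exact (measurable_exp.comp ((hg.sub_const m).const_mul lam))
      · rw [abs_of_pos (exp_pos _)]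
        apply exp_le_exp.2
        have := hc s
        nlinarith [abs_le.1 this]
    · exact hi5.add hi4
    · intro s
      have : |lam * (g s - m)| ≤ lam := by
        rw [abs_mul, abs_of_nonneg h0]; nlinarith [hc s]
      have := exp_le_cubic h1 this
      simp only
      nlinarith
  refine key.trans ?_
  rw [integral_add hi5 hi4, integral_add (integrable_const _) hi3,
    integral_const_mul, integral_const_mul, integral_sub hi (integrable_const _)]
  simp only [integral_const, probReal_univ, smul_eq_mul, one_mul, ← hm, sub_self, mul_zero, add_zero]
  have hA : 0 ≤ lam ^ 2 / 2 * (1 + 4 * lam / 9) := by positivity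
  have h4 := mul_le_mul_of_nonneg_left hv hA
  have h5 := add_one_le_exp (v * lam ^ 2 / 2 * (1 + 4 * lam / 9))
  linarith

lemma exp_le_div {x : ℝ} (h : x < 1) : exp x ≤ 1 / (1 - x) := by
  have h1 : 1 - x ≤ exp (-x) := by have := add_one_le_exp (-x); linarith
  rw [← neg_neg x, Real.exp_neg, ← one_div, neg_neg]
  exact one_div_le_one_div_of_le (by linarith) h1

lemma cond_of {lam m1 m2 ψ c : ℝ} (h : 2 * lam * exp (m2 + m1 + ψ) ≤ 1 - exp (-c)) :
    2 * lam * exp m2 ≤ (1 - exp (-c)) * exp (-m1 - ψ) := by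
  have h1 := mul_le_mul_of_nonneg_right h (exp_pos (-m1 - ψ)).le
  refine le_trans (le_of_eq ?_) h1
  rw [mul_assoc, mul_assoc, mul_assoc, ← Real.exp_add]
  congr 3; ring

lemma cond_two {lam ψ : ℝ} (h0 : 0 < lam) (h1 : lam ≤ 1/5) (hψ : ψ ≤ 0.06 * lam) :
    2 * lam * exp lam ≤ (1 - exp (-(8 * lam))) * exp (-lam - ψ) := by
  have hc := exp_chord (c := 1.6) (d := 8 * lam) (by norm_num) (by linarith) (by linarith)
  have e1 : exp (-1.6:ℝ) ≤ 0.21 := by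
    have := Real.sum_le_exp_of_nonneg (show (0:ℝ) ≤ 1.6 by norm_num) 6
    rw [Real.exp_neg, inv_le_comm₀ (exp_pos _) (by norm_num)]
    refine le_trans ?_ this
    simp [Finset.sum_range_succ, Nat.factorial]; norm_num
  have e2 : exp (lam + lam + ψ) ≤ 1.71 := by
    have : exp (lam + lam + ψ) ≤ exp 0.412 := exp_le_exp.2 (by linarith)
    have h3 := exp_le_div (show (0.412:ℝ) < 1 by norm_num)
    refine this.trans (h3.trans ?_)
    norm_num
  apply cond_of
  have h3 := mul_le_mul_of_nonneg_left e2 (show 0 ≤ 2 * lam by linarith)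
  have h4 := mul_le_mul_of_nonneg_left e1 h0.le
  have h5 : (1 - exp (-1.6:ℝ)) / 1.6 * (8 * lam) = 5 * lam - 5 * (lam * exp (-1.6:ℝ)) := by ring
  linarith

/-- two sided deviation -/
lemma dev_two {S : Type*} [MeasurableSpace S] {P : Measure S} [IsProbabilityMeasure P]
    {F : Set (S → ℝ)} (hF : F.Countable) (hA : ∀ f ∈ F, Adm f) {δ : ℝ}
    (hδ : ∀ f ∈ F, ∫ s, f s ∂P ≤ δ) (h0δ : 0 ≤ δ) (h1δ : δ ≤ 1/2) {n : ℕ} (hn : 1 ≤ n) {lam τ : ℝ}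
    (h0 : 0 < lam) (h1 : lam ≤ 1/5) :
    (Measure.pi fun _ : Fin n => P) {x | ∃ f ∈ F, δ * lam / 2 * (1 + 4 * lam / 9) +
      8 * RadF n F x + τ / (lam * n) ≤ |empMean n x f - ∫ s, f s ∂P|} ≤
      ENNReal.ofReal (exp (-τ)) := by
  set G : Set (S → ℝ) := F ∪ (fun f => -f) '' F with hG
  have hn0 : (0:ℝ) < n := by exact_mod_cast hn
  have hb : ∀ g ∈ G, Measurable g ∧ (∀ s, |g s| ≤ 1) ∧ (∀ s, |g s - ∫ y, g y ∂P| ≤ 1) ∧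
      ∫ s, (g s - ∫ y, g y ∂P) ^ 2 ∂P ≤ δ := by
    have h2 : ∀ f ∈ F, (∀ s, |f s - ∫ y, f y ∂P| ≤ 1) ∧
      ∫ s, (f s - ∫ y, f y ∂P) ^ 2 ∂P ≤ δ := by
      intro f hf
      have h3 := (hA f hf).mean P
      refine ⟨fun s => ?_, ?_⟩
      · have h4 := (hA f hf).rng s
        rw [abs_le]; constructor <;> linarith [h3.1, h3.2, h4.1, h4.2]
      · have := (hA f hf).var P
        nlinarith [hδ f hf, h3.1]
    rintro g (hg | ⟨f, hf, rfl⟩)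
    · exact ⟨(hA g hg).meas, (hA g hg).absle, (h2 g hg).1, (h2 g hg).2⟩
    · refine ⟨(hA f hf).meas.neg, fun s => ?_, fun s => ?_, ?_⟩
      · simpa using (hA f hf).absle s
      · have := (h2 f hf).1 s
        rw [← abs_neg] at this
        simp only [Pi.neg_apply, integral_neg]
        convert this using 2; ring
      · refine le_trans (le_of_eq ?_) (h2 f hf).2
        simp only [Pi.neg_apply, integral_neg]
        congr 1; ext s; ring
  have hset : Setup P (fun g : G => g.1) lam lam lam (δ * lam ^ 2 / 2 * (1 + 4 * lam / 9))
      (8 * lam) := by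
    refine ⟨fun i => (hb i i.2).1, fun i => (hb i i.2).2.1, h0.le, fun i x => ?_, fun i x => ?_,
      h0.le, by positivity, fun i => ?_, by linarith, ?_⟩
    · have := abs_le.1 ((hb i i.2).2.2.1 x); nlinarith
    · have := abs_le.1 ((hb i i.2).2.2.1 x); nlinarith
    · exact mgf_var (hb i i.2).1 (hb i i.2).2.1 (hb i i.2).2.2.1 h0.le (by linarith)
        (hb i i.2).2.2.2
    · apply cond_two h0 h1
      have h5 : δ * lam ^ 2 / 2 * (1 + 4 * lam / 9) ≤ 1/2 * lam ^ 2 / 2 * (1 + 4 * (1/5) / 9) := by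
        gcongr
      nlinarith
  refine le_trans (measure_mono ?_) (dev_count G (hF.union (hF.image _)) hset h0.le n hn F
    (fun f hf => (hA f hf).absle) ?_ τ)
  · rintro x ⟨f, hf, hx⟩
    have key : n * (δ * lam ^ 2 / 2 * (1 + 4 * lam / 9)) + 8 * lam * n * RadF n F x + τ ≤
        lam * n * |empMean n x f - ∫ s, f s ∂P| := by
      have := mul_le_mul_of_nonneg_left hx (show 0 ≤ lam * n by positivity)
      refine le_trans (le_of_eq ?_) this
      field_simp
    have e : n * (empMean n x f - ∫ s, f s ∂P) = ∑ j, f (x j) - n * ∫ s, f s ∂P := by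
      unfold empMean; field_simp
    rcases abs_cases (empMean n x f - ∫ s, f s ∂P) with h3 | h3
    · refine ⟨f, Or.inl hf, key.trans (le_of_eq ?_)⟩
      rw [h3.1, ← e]; ring
    · refine ⟨-f, Or.inr ⟨f, hf, rfl⟩, key.trans (le_of_eq ?_)⟩
      rw [h3.1]
      simp only [Pi.neg_apply, integral_neg, Finset.sum_neg_distrib]
      linear_combination (-lam) * e
  · rintro g (hg | ⟨f, hf, rfl⟩)
    · exact Or.inl hg
    · right; simpa using hf

end GB

end

section

open MeasureTheory ProbabilityTheory Real Set Filter Topology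


namespace GB

lemma lam_choice {δ w : ℝ} (hδ : 0 < δ) (hw : 0 < w) (h : 50/9 * w ≤ δ) :
    ∃ lam, 0 < lam ∧ lam ≤ 1/5 ∧
      δ * lam / 2 * (1 + 4 * lam / 9) + w / lam ≤ √(2 * δ * w) + 10 / 3 * w := by
  set s := √(δ / (2 * w)) with hs
  have hs2 : s ^ 2 = δ / (2 * w) := Real.sq_sqrt (by positivity)
  have hδ' : δ = 2 * w * s ^ 2 := by rw [hs2]; field_simp
  have hs1 : 5/3 ≤ s := by
    rw [hs]; apply Real.le_sqrt_of_sq_le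
    rw [le_div_iff₀ (by positivity)]; linarith
  have e : √(2 * δ * w) = 2 * w * s := by
    rw [hδ', show 2 * (2 * w * s ^ 2) * w = (2 * w * s) ^ 2 by ring]
    exact Real.sqrt_sq (by positivity)
  have hp : 0 < s + 10/3 := by linarith
  refine ⟨1 / (s + 10/3), by positivity, ?_, ?_⟩
  · apply one_div_le_one_div_of_le (by norm_num); linarith
  · rw [e, div_div_eq_mul_div, div_one]
    have h2 : δ * (1 / (s + 10/3)) / 2 * (1 + 4 * (1 / (s + 10/3)) / 9) ≤ w * s := by
      have h3 : s * (1 / (s + 10/3)) * (1 + 4 * (1 / (s + 10/3)) / 9) ≤ 1 := by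
        rw [show s * (1 / (s + 10/3)) * (1 + 4 * (1 / (s + 10/3)) / 9)
          = s * (s + 10/3 + 4/9) / (s + 10/3) ^ 2 by field_simp]
        rw [div_le_one (by positivity)]
        nlinarith
      have := mul_le_mul_of_nonneg_left h3 (show 0 ≤ w * s by positivity)
      rw [hδ']
      linarith
    linarith

/-- the number of levels constant -/
def tauj (t : ℝ) (j : ℕ) : ℝ := t + 2 * log (π / √3 * j)

lemma tauj_le {t ρ : ℝ} {j : ℕ} (hj : 1 ≤ j) (h0 : 0 < ρ) (h : ρ ≤ (1/2) ^ j) :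
    tauj t j ≤ tau t ρ := by
  unfold tauj tau
  have h1 : log ρ ≤ - (j * log 2) := by
    have := Real.log_le_log h0 h
    rw [Real.log_pow, one_div, Real.log_inv] at this
    linarith
  have h2 : 0 < log 2 := Real.log_pos one_lt_two
  have hj' : (0:ℝ) < j := by exact_mod_cast hj
  have hjl : 0 < j * log 2 := by positivity
  have h3 : π / √3 * j ≤ K0 * |log ρ| := by
    rw [abs_of_neg (by linarith)]
    have e : π / √3 * j = K0 * (j * log 2) := by unfold K0; field_simp
    rw [e]
    exact mul_le_mul_of_nonneg_left (by linarith) K0_pos.le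
  have := Real.log_le_log (by positivity) h3
  linarith

lemma tauj_gt {t : ℝ} {j : ℕ} (hj : 1 ≤ j) : t < tauj t j := by
  unfold tauj
  have hj' : (1:ℝ) ≤ j := by exact_mod_cast hj
  have h1 : 1 < π / √3 := by
    rw [lt_div_iff₀ (by positivity)]
    have := sqrt3_bounds; have := pi_gt_d6; linarith
  have := Real.log_pos (show 1 < π / √3 * j by nlinarith)
  linarith

lemma FP_of_le {n : ℕ} {t : ℝ} {Rs V r : ℝ → ℝ} (h : FP n t Rs V r) (ht : log 2 ≤ t) {δ ρ : ℝ}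
    (hδ : 0 ≤ δ) (h0 : 0 < ρ) (h1 : ρ < 1) (hK : DD n t ρ - 8 * Rs (V ρ) ≤ δ) : ρ ≤ r δ := by
  have := lemmaJ h ht hδ h0 h1.ne hK
  rwa [min_eq_left h1.le] at this

lemma DD_eq (n : ℕ) (t ρ : ℝ) :
    DD n t ρ = ρ - √(4 * ρ * (tau t ρ / n)) - 10 / 3 * (tau t ρ / n) := by
  unfold DD
  congr 2
  · rw [mul_div_assoc]
  · ring

lemma c2_eq (n : ℕ) (t ρ : ℝ) :
    c2 n t ρ = 2 * ρ + √(4 * ρ * (tau t ρ / n)) + 10 / 3 * (tau t ρ / n) := by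
  unfold c2
  congr 2
  · rw [mul_div_assoc]
  · ring

lemma empMean_nonneg {S : Type*} [MeasurableSpace S] {n : ℕ} {f : S → ℝ} (h : Adm f)
    (x : Fin n → S) : 0 ≤ empMean n x f := by
  unfold empMean
  have : 0 ≤ ∑ i, f (x i) := Finset.sum_nonneg fun i _ => (h.rng _).1
  positivity

lemma radSup_ge {S : Type*} [MeasurableSpace S] {n : ℕ} {F D : Set (S → ℝ)}
    (hA : ∀ f ∈ F, Adm f) {x : Fin n → S} {u : ℝ} (hD : D ⊆ F) (hu : ∀ f ∈ D, empMean n x f ≤ u) :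
    RadF n D x ≤ radSup n F x u := by
  rw [radSup_eq]
  exact RadF_mono (fun f hf => (hA f hf.1).absle) fun f hf => ⟨hD hf, hu f hf⟩

lemma level {S : Type*} [MeasurableSpace S] {P : Measure S} [IsProbabilityMeasure P]
    {F : Set (S → ℝ)} (hF : F.Countable) (hA : ∀ f ∈ F, Adm f) {n : ℕ} (hn : 1 ≤ n) {t : ℝ}
    (ht : log 2 ≤ t) {j : ℕ} (hj : 1 ≤ j) :
    ∃ B, (Measure.pi fun _ : Fin n => P) B ≤ ENNReal.ofReal (exp (-tauj t j)) ∧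
      ∀ x ∉ B, ∀ V r, FP n t (radSup n F x) V r → ∀ f ∈ F, (1/2:ℝ) ^ (j + 1) < ∫ s, f s ∂P →
        ∫ s, f s ∂P ≤ (1/2) ^ j → ∫ s, f s ∂P ≤ r (empMean n x f) := by
  have hn0 : (0:ℝ) < n := by exact_mod_cast hn
  have hl2 := Real.log_pos one_lt_two
  set δ : ℝ := (1/2) ^ j with hδ
  have hδ0 : 0 < δ := by positivity
  have hδ1 : δ ≤ 1/2 := by
    rw [hδ]; exact pow_le_of_le_one (by norm_num) (by norm_num) (by omega)
  set w := tauj t j / n with hw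
  have hτ0 : 0 < tauj t j := by have := tauj_gt (t := t) hj; linarith
  have hw0 : 0 < w := by positivity
  have hwρ : ∀ {ρ : ℝ}, 0 < ρ → ρ ≤ δ → w ≤ tau t ρ / n := fun h1 h2 => by
    rw [hw]; exact div_le_div_of_nonneg_right (tauj_le hj h1 h2) hn0.le
  by_cases hc : 50/9 * w ≤ δ
  · obtain ⟨lam, hl0, hl1, hl⟩ := lam_choice hδ0 hw0 hc
    set D : Set (S → ℝ) := {f ∈ F | ∫ s, f s ∂P ≤ δ} with hD
    have hDF : D ⊆ F := fun f hf => hf.1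
    refine ⟨_, dev_two (hF.mono hDF) (fun f hf => hA f hf.1) (δ := δ) (fun f hf => hf.2) hδ0.le hδ1
      hn (τ := tauj t j) hl0 hl1, ?_⟩
    intro x hx V r hFP f hf h1 h2
    simp only [Set.mem_setOf_eq, not_exists, not_and, not_le] at hx
    set ρ := ∫ s, f s ∂P with hρ
    have hρ0 : 0 < ρ := lt_trans (by positivity) h1
    have hρ2 : δ ≤ 2 * ρ := by rw [pow_succ] at h1; linarith
    have hdev : ∀ g ∈ D, |empMean n x g - ∫ s, g s ∂P| ≤
        8 * RadF n D x + √(2 * δ * w) + 10 / 3 * w := by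
      intro g hg
      have := hx g hg
      have e : tauj t j / (lam * n) = w / lam := by rw [hw]; field_simp
      rw [e] at this
      linarith
    apply FP_of_le hFP ht (empMean_nonneg (hA f hf) x) hρ0 (by linarith)
    have hwr := hwρ hρ0 h2
    have hsq : √(2 * δ * w) ≤ √(4 * ρ * (tau t ρ / n)) := by
      apply Real.sqrt_le_sqrt
      calc 2 * δ * w ≤ 2 * (2 * ρ) * (tau t ρ / n) := by gcongr
        _ = _ := by ring
    set V0 := δ + (8 * RadF n D x + √(2 * δ * w) + 10 / 3 * w) with hV0
    have hR0 : RadF n D x ≤ radSup n F x V0 := by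
      apply radSup_ge hA hDF
      intro g hg
      have := (abs_le.1 (hdev g hg)).2
      have h5 := hg.2
      linarith
    have hVV : V0 ≤ V ρ := by
      apply hFP.tarski
      rw [c2_eq]
      linarith
    have hR := hR0.trans (hFP.mono hVV)
    have := (abs_le.1 (hdev f ⟨hf, h2⟩)).1
    rw [DD_eq]
    linarith
  · refine ⟨∅, by simp, ?_⟩
    intro x _ V r hFP f hf h1 h2
    push Not at hc
    set ρ := ∫ s, f s ∂P with hρ
    have hρ0 : 0 < ρ := lt_trans (by positivity) h1
    have hwr := hwρ hρ0 h2
    apply FP_of_le hFP ht (empMean_nonneg (hA f hf) x) hρ0 (by linarith)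
    have h6 := empMean_nonneg (hA f hf) x
    have h7 := hFP.nonneg (V ρ)
    have h8 : DD n t ρ ≤ 0 := by
      rw [DD_eq]
      rcases le_or_gt ρ (10/3 * w) with h9 | h9
      · have := Real.sqrt_nonneg (4 * ρ * (tau t ρ / n)); linarith
      · have : 3 * w ≤ √(4 * ρ * (tau t ρ / n)) := by
          apply Real.le_sqrt_of_sq_le
          nlinarith
        linarith
    linarith

lemma level_zero {S : Type*} [MeasurableSpace S] {F : Set (S → ℝ)} (hA : ∀ f ∈ F, Adm f) {n : ℕ}
    {t : ℝ} (ht : log 2 ≤ t) {x : Fin n → S} {V r : ℝ → ℝ} (hFP : FP n t (radSup n F x) V r)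
    {f : S → ℝ} (hf : f ∈ F) : 0 ≤ r (empMean n x f) := by
  have hn0 : (0:ℝ) < n := by exact_mod_cast hFP.hn
  have hn1 : (1:ℝ) ≤ n := by exact_mod_cast hFP.hn
  have h0 : (0:ℝ) < 1 / (2 * n) := by positivity
  have h1 : (1:ℝ) / (2 * n) ≤ 1/2 := by
    apply one_div_le_one_div_of_le (by norm_num); linarith
  have := tauj_gt (t := t) (le_refl 1)
  have h2 := tauj_le (t := t) (le_refl 1) h0 (by simpa using h1)
  have h3 : (0.69:ℝ) ≤ tau t (1 / (2 * n)) := by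
    have := log_two_gt_d9; linarith
  refine h0.le.trans (FP_of_le hFP ht (empMean_nonneg (hA f hf) x) h0 (by linarith) ?_)
  have h6 := empMean_nonneg (hA f hf) x
  have h7 := hFP.nonneg (V (1 / (2 * n)))
  have h8 := Real.sqrt_nonneg (4 * (1 / (2 * n)) * (tau t (1 / (2 * n)) / n))
  have h9 : (1:ℝ) / (2 * n) ≤ 10/3 * (tau t (1 / (2 * n)) / n) := by
    rw [← mul_div_assoc, div_le_div_iff₀ (by positivity) hn0]
    nlinarith
  rw [DD_eq]
  linarith

end GB

end

section

open MeasureTheory ProbabilityTheory Real Set Filter Topology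


namespace GB

/-- sign sum -/
def sgnS {n : ℕ} (σ : Fin n → Bool) : ℝ := ∑ i, radSign (σ i)

/-- total absolute sum -/
def MM (n : ℕ) : ℝ := ∑ σ : Fin n → Bool, |sgnS σ|

lemma kh1 {n : ℕ} (hn : 1 ≤ n) (a : Fin n → ℝ) :
    (∑ i, a i) * MM n / n ≤ ∑ σ : Fin n → Bool, |∑ i, radSign (σ i) * a i| := by
  have hn0 : (0:ℝ) < n := by exact_mod_cast hn
  set c : Fin n → ℝ := fun i => ∑ σ : Fin n → Bool, SignType.sign (sgnS σ) * radSign (σ i) with hc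
  have hcc : ∀ i j, c i = c j := by
    intro i j
    simp only [hc]
    apply Fintype.sum_equiv (Equiv.arrowCongr (Equiv.swap i j) (Equiv.refl Bool))
    intro σ
    have e1 : sgnS ((Equiv.arrowCongr (Equiv.swap i j) (Equiv.refl Bool)) σ) = sgnS σ := by
      unfold sgnS
      apply Fintype.sum_equiv (Equiv.swap i j)
      intro l
      simp [Equiv.arrowCongr]
    rw [e1]
    simp [Equiv.arrowCongr]
  have hsum : ∑ i, c i = MM n := by
    simp only [hc, MM]
    rw [Finset.sum_comm]
    refine Finset.sum_congr rfl fun σ _ => ?_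
    rw [← Finset.mul_sum]
    exact sign_mul_self (sgnS σ)
  have hci : ∀ i, c i = MM n / n := by
    intro i
    rw [← hsum, Finset.sum_congr rfl (fun j _ => hcc j i)]
    simp; field_simp
  have key : ∑ i, a i * c i ≤ ∑ σ : Fin n → Bool, |∑ i, radSign (σ i) * a i| := by
    simp only [hc, Finset.mul_sum]
    rw [Finset.sum_comm]
    refine Finset.sum_le_sum fun σ _ => ?_
    have : ∑ i, a i * ((SignType.sign (sgnS σ) : ℝ) * radSign (σ i)) =
        (SignType.sign (sgnS σ) : ℝ) * ∑ i, radSign (σ i) * a i := by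
      rw [Finset.mul_sum]; exact Finset.sum_congr rfl fun i _ => by ring
    rw [this]
    refine (le_abs_self _).trans ?_
    rw [abs_mul]
    have h1 : |(SignType.sign (sgnS σ) : ℝ)| ≤ 1 := by
      rcases lt_trichotomy (sgnS σ) 0 with h | h | h <;> simp [h]
    exact mul_le_of_le_one_left (abs_nonneg _) h1
  refine le_trans (le_of_eq ?_) key
  simp only [hci]
  rw [← Finset.sum_mul]; ring

/-- number of heads -/
def cnt {n : ℕ} (σ : Fin n → Bool) : ℕ := (Finset.univ.filter (fun i => σ i = true)).card

lemma sum_cnt (n : ℕ) (φ : ℕ → ℝ) :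
    ∑ σ : Fin n → Bool, φ (cnt σ) = ∑ k ∈ Finset.range (n + 1), (n.choose k) • φ k := by
  have h := Finset.sum_powerset_apply_card φ (x := (Finset.univ : Finset (Fin n)))
  rw [Finset.card_univ, Fintype.card_fin] at h
  rw [← h]
  apply Finset.sum_nbij' (fun σ => Finset.univ.filter (fun i => σ i = true))
    (fun A i => decide (i ∈ A))
  · intro σ _; simp
  · intro A _; simp
  · intro σ _; ext i; simp
  · intro A _; ext i; simp
  · intro σ _; rfl

lemma sgnS_eq {n : ℕ} (σ : Fin n → Bool) : sgnS σ = 2 * cnt σ - n := by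
  unfold sgnS cnt
  have h : ∀ i, radSign (σ i) = 2 * (if σ i = true then 1 else 0) - 1 := by
    intro i; unfold radSign; split_ifs <;> norm_num
  simp only [h]
  rw [Finset.sum_sub_distrib, ← Finset.mul_sum, Finset.sum_boole]
  simp

lemma MM_succ (n : ℕ) : MM (n + 1) = 2 * MM n +
    2 * ∑ σ : Fin n → Bool, (if 2 * cnt σ = n then (1:ℝ) else 0) := by
  have h1 : MM (n + 1) = ∑ σ : Fin n → Bool, (|sgnS σ + 1| + |sgnS σ - 1|) := by
    unfold MM
    rw [← (Fin.consEquiv (fun _ : Fin (n + 1) => Bool)).sum_comp, Fintype.sum_prod_type]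
    rw [Fintype.sum_bool, ← Finset.sum_add_distrib]
    refine Finset.sum_congr rfl fun σ _ => ?_
    congr 2
    · simp [sgnS, Fin.sum_univ_succ, Fin.consEquiv, radSign]; ring
    · simp [sgnS, Fin.sum_univ_succ, Fin.consEquiv, radSign]; ring
  rw [h1, MM, Finset.mul_sum, Finset.mul_sum, ← Finset.sum_add_distrib]
  refine Finset.sum_congr rfl fun σ _ => ?_
  have e : sgnS σ = ((2 * (cnt σ : ℤ) - n : ℤ) : ℝ) := by rw [sgnS_eq]; push_cast; ring
  rw [e]
  generalize hz : (2 * (cnt σ : ℤ) - n : ℤ) = z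
  have hif : (if 2 * cnt σ = n then (1:ℝ) else 0) = ((if z = 0 then 1 else 0 : ℤ) : ℝ) := by
    have : 2 * cnt σ = n ↔ z = 0 := by omega
    simp [this]
  rw [hif]
  have : |z + 1| + |z - 1| = 2 * |z| + 2 * (if z = 0 then 1 else 0) := by
    split_ifs with h
    · subst h; norm_num
    · rcases lt_or_gt_of_ne h with h | h
      · rw [abs_of_neg h, abs_of_nonpos (by omega), abs_of_neg (by omega)]; ring
      · rw [abs_of_pos h, abs_of_pos (by omega), abs_of_nonneg (by omega)]; ring
  exact_mod_cast this

lemma ZZ_even (m : ℕ) : ∑ σ : Fin (2 * m) → Bool, (if 2 * cnt σ = 2 * m then (1:ℝ) else 0) =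
    m.centralBinom := by
  rw [sum_cnt (2 * m) (fun k => if 2 * k = 2 * m then (1:ℝ) else 0)]
  rw [Finset.sum_eq_single m]
  · simp [Nat.centralBinom]
  · intro b _ hb
    simp [hb]
  · intro h; simp at h; omega

lemma ZZ_odd (m : ℕ) : ∑ σ : Fin (2 * m + 1) → Bool,
    (if 2 * cnt σ = 2 * m + 1 then (1:ℝ) else 0) = 0 := by
  apply Finset.sum_eq_zero
  intro σ _
  rw [if_neg (by omega)]

lemma MM_even (m : ℕ) : MM (2 * m) = 2 * m * m.centralBinom := by
  induction m with
  | zero => simp [MM, sgnS]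
  | succ m ih =>
    have h := MM_succ (2 * m + 1)
    rw [ZZ_odd, MM_succ (2 * m), ZZ_even, ih] at h
    have h2 : ((m:ℝ) + 1) * (m + 1).centralBinom = 2 * (2 * m + 1) * m.centralBinom := by
      exact_mod_cast Nat.succ_mul_centralBinom_succ m
    rw [show 2 * (m + 1) = 2 * m + 1 + 1 by ring, h]
    push_cast
    linear_combination (-2) * h2

lemma cb_lower (m : ℕ) (hm : 5 ≤ m) :
    0.3028 * (16:ℝ) ^ m ≤ m * (m.centralBinom : ℝ) ^ 2 := by
  induction m, hm using Nat.le_induction with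
  | base =>
    have : Nat.centralBinom 5 = 252 := by decide
    rw [this]; norm_num
  | succ m hm ih =>
    have h2 : ((m:ℝ) + 1) * (m + 1).centralBinom = 2 * (2 * m + 1) * m.centralBinom := by
      exact_mod_cast Nat.succ_mul_centralBinom_succ m
    set a : ℝ := (m.centralBinom : ℝ)
    set b : ℝ := ((m + 1).centralBinom : ℝ)
    have hb : b = 2 * (2 * m + 1) * a / (m + 1) := by field_simp; linarith
    push_cast
    rw [hb, pow_succ]
    have : ((m:ℝ) + 1) * (2 * (2 * m + 1) * a / (m + 1)) ^ 2 = 4 * (2 * m + 1) ^ 2 / (m + 1) * a ^ 2 := by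
      field_simp; ring
    rw [this]
    have h3 : 16 * (m:ℝ) ≤ 4 * (2 * m + 1) ^ 2 / (m + 1) := by
      rw [le_div_iff₀ (by positivity)]; nlinarith
    nlinarith [sq_nonneg a]

lemma MM_lower {n : ℕ} (hn : 9 ≤ n) : √n / 1.29 * 2 ^ n ≤ MM n := by
  have h0 : 0 ≤ MM n := Finset.sum_nonneg fun σ _ => abs_nonneg _
  apply le_of_sq_le_sq _ h0
  rw [mul_pow, div_pow, Real.sq_sqrt (by positivity)]
  rcases Nat.even_or_odd' n with ⟨m, rfl | rfl⟩
  · rw [MM_even]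
    have := cb_lower m (by omega)
    have e : ((2:ℝ) ^ (2 * m)) ^ 2 = 16 ^ m := by rw [← pow_mul, mul_comm, ← mul_assoc, pow_mul]; norm_num
    rw [e]
    push_cast
    have hm : (0:ℝ) ≤ m := by positivity
    have h3 := mul_le_mul_of_nonneg_left this hm
    have h4 : 0 ≤ (m:ℝ) * 16 ^ m := by positivity
    have e3 : 2 * (m:ℝ) / 1.29 ^ 2 * 16 ^ m = (2 / 1.29 ^ 2) * (m * 16 ^ m) := by ring
    rw [e3]
    calc (2 / 1.29 ^ 2) * ((m:ℝ) * 16 ^ m) ≤ 1.21 * (m * 16 ^ m) := by gcongr; norm_num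
      _ ≤ _ := by linarith
  · rw [MM_succ, MM_even, ZZ_even]
    have := cb_lower (m + 1) (by omega)
    have h2 : ((m:ℝ) + 1) * (m + 1).centralBinom = 2 * (2 * m + 1) * m.centralBinom := by
      exact_mod_cast Nat.succ_mul_centralBinom_succ m
    have e : ((2:ℝ) ^ (2 * m + 1)) ^ 2 = 4 * 16 ^ m := by
      rw [← pow_mul, show (2 * m + 1) * 2 = 4 * m + 2 by ring, pow_add, pow_mul]; norm_num; ring
    rw [e]
    push_cast at this ⊢
    have e2 : (2 * (2 * m * (m.centralBinom : ℝ)) + 2 * m.centralBinom) ^ 2 =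
      ((m:ℝ) + 1) * ((m + 1) * ((m + 1).centralBinom : ℝ) ^ 2) := by
      have : 2 * (2 * m * (m.centralBinom : ℝ)) + 2 * m.centralBinom =
        ((m:ℝ) + 1) * (m + 1).centralBinom := by rw [h2]; ring
      rw [this]; ring
    rw [e2]
    have hm : (0:ℝ) ≤ m + 1 := by positivity
    have h3 := mul_le_mul_of_nonneg_left this hm
    have h4 : 0 ≤ (m:ℝ) * 16 ^ m := by positivity
    have h5 : 0 < (16:ℝ) ^ m := by positivity
    rw [pow_succ] at h3
    have e3 : (2 * (m:ℝ) + 1) / 1.29 ^ 2 * (4 * 16 ^ m) =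
      (4 / 1.29 ^ 2) * ((2 * m + 1) * 16 ^ m) := by ring
    rw [e3]
    calc (4 / 1.29 ^ 2) * ((2 * (m:ℝ) + 1) * 16 ^ m) ≤ 2.42 * ((2 * m + 1) * 16 ^ m) := by
          gcongr; norm_num
      _ ≤ _ := by linarith

/-- Khinchine lower bound -/
lemma RadF_ge {S : Type*} [MeasurableSpace S] {n : ℕ} (hn : 9 ≤ n) {C : Set (S → ℝ)}
    (hC : ∀ f ∈ C, Adm f) {x : Fin n → S} {f : S → ℝ} (hf : f ∈ C) :
    empMean n x f * (1 / √n) ≤ 1.29 * RadF n C x := by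
  have hn0 : (0:ℝ) < n := by exact_mod_cast (by omega : 0 < n)
  have h1 : ∑ σ : Fin n → Bool, |radAvg n x σ f| ≤
      ∑ σ : Fin n → Bool, sSup {a : ℝ | ∃ f ∈ C, a = |radAvg n x σ f|} :=
    Finset.sum_le_sum fun σ _ => le_csSup (bddAbove_rad (fun f hf => (hC f hf).absle) σ) ⟨f, hf, rfl⟩
  have h2 := kh1 (by omega) (fun i => f (x i)) (n := n)
  have h3 := MM_lower hn
  have h4 : ∑ σ : Fin n → Bool, |radAvg n x σ f| =
      (∑ σ : Fin n → Bool, |∑ i, radSign (σ i) * f (x i)|) / n := by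
    rw [Finset.sum_div]
    refine Finset.sum_congr rfl fun σ _ => ?_
    unfold radAvg
    rw [abs_div, abs_of_pos hn0]
  have h5 : ∑ i, f (x i) = n * empMean n x f := by unfold empMean; field_simp
  rw [h5] at h2
  have hq := empMean_nonneg (hC f hf) x
  set q := empMean n x f
  set s := √(n:ℝ) with hs
  have hs0 : 0 < s := Real.sqrt_pos.2 hn0
  have hss : s * s = n := Real.mul_self_sqrt hn0.le
  have h6 : n * q * (s / 1.29 * 2 ^ n) / n / n ≤ RadF n C x * 2 ^ n := by
    unfold RadF
    rw [div_mul_cancel₀ _ (by positivity)]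
    refine le_trans ?_ h1
    rw [h4]
    apply div_le_div_of_nonneg_right _ hn0.le
    refine le_trans ?_ h2
    gcongr
  have h7 : n * q * (s / 1.29 * 2 ^ n) / n / n = (q * (1 / s) / 1.29) * 2 ^ n := by
    rw [← hss]; field_simp
  rw [h7] at h6
  have h8 := le_of_mul_le_mul_right h6 (by positivity)
  rw [div_le_iff₀ (by norm_num)] at h8
  linarith

end GB

end

section

open MeasureTheory ProbabilityTheory Real Set Filter Topology


namespace GB

lemma mgf_hoeff {S : Type*} [MeasurableSpace S] {P : Measure S} [IsProbabilityMeasure P]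
    {f : S → ℝ} (h : Adm f) (lam : ℝ) :
    ∫ s, exp (lam * ((-f) s - ∫ y, (-f) y ∂P)) ∂P ≤ exp (lam ^ 2 / 8) := by
  have h1 := hasSubgaussianMGF_of_mem_Icc (μ := P) (X := -f) (a := -1) (b := 0)
    h.meas.neg.aemeasurable
    (Eventually.of_forall fun s => by
      have := h.rng s
      simp only [Pi.neg_apply, Set.mem_Icc]; constructor <;> linarith [this.1, this.2])
  have h2 := h1.mgf_le lam
  unfold mgf at h2
  refine h2.trans (le_of_eq ?_)
  congr 1
  norm_num
  ring

lemma mgf_var' {S : Type*} [MeasurableSpace S] {P : Measure S} [IsProbabilityMeasure P]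
    {f : S → ℝ} (h : Adm f) {lam p : ℝ} (hp : p ≤ ∫ s, f s ∂P) (h0 : 0 ≤ lam) (h1 : lam ≤ 1) :
    ∫ s, exp (lam * ((-f) s - ∫ y, (-f) y ∂P)) ∂P ≤
      exp ((1 - p) * lam ^ 2 / 2 * (1 + 4 * lam / 9)) := by
  have hm := h.mean P
  apply mgf_var h.meas.neg (fun s => by simpa using h.absle s) _ h0 h1
  · have := h.var P
    simp only [Pi.neg_apply, integral_neg]
    have e : ∀ s, (-f s - -∫ y, f y ∂P) ^ 2 = (f s - ∫ y, f y ∂P) ^ 2 := fun s => by ring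
    simp only [e]
    nlinarith [hm.1, hm.2]
  · intro s
    have := h.rng s
    simp only [Pi.neg_apply, integral_neg]
    rw [abs_le]; constructor <;> linarith [this.1, this.2, hm.1, hm.2]

/-- one sided deviation -/
lemma dev_one {S : Type*} [MeasurableSpace S] {P : Measure S} [IsProbabilityMeasure P]
    {D : Set (S → ℝ)} (hD : D.Countable) (hA : ∀ f ∈ D, Adm f) {p : ℝ} (hp1 : p ≤ 1)
    (hp : ∀ f ∈ D, p ≤ ∫ s, f s ∂P) {n : ℕ} (hn : 1 ≤ n) {lam τ a ψ : ℝ} (ha : 0 < a)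
    (h0 : 0 < lam) (hψ : lam ^ 2 / 8 ≤ ψ ∨ ((1 - p) * lam ^ 2 / 2 * (1 + 4 * lam / 9) ≤ ψ ∧ lam ≤ 1))
    (hcond : 2 * lam * exp (lam + lam * (1 - p) + ψ) ≤ 1 - exp (-(a * lam))) :
    (Measure.pi fun _ : Fin n => P) {x | ∃ f ∈ D, ψ / lam + a * RadF n D x + τ / (lam * n) ≤
      ∫ s, f s ∂P - empMean n x f} ≤ ENNReal.ofReal (exp (-τ)) := by
  set G : Set (S → ℝ) := (fun f => -f) '' D with hG
  have hn0 : (0:ℝ) < n := by exact_mod_cast hn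
  have hp2 : 0 ≤ 1 - p := by linarith
  have hψ0 : 0 ≤ ψ := by
    rcases hψ with h | h
    · exact le_trans (by positivity) h
    · exact le_trans (by positivity) h.1
  have hset : Setup P (fun g : G => g.1) lam (lam * (1 - p)) lam ψ (a * lam) := by
    refine ⟨?_, ?_, h0.le, ?_, ?_, h0.le, hψ0, ?_, by positivity, ?_⟩
    · rintro ⟨_, f, hf, rfl⟩; exact (hA f hf).meas.neg
    · rintro ⟨_, f, hf, rfl⟩ x; simpa using (hA f hf).absle x
    · rintro ⟨_, f, hf, rfl⟩ x
      have h1 := (hA f hf).rng x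
      have h2 := hp f hf
      simp only [Pi.neg_apply, integral_neg]
      have : -(1 - p) ≤ -f x - -∫ s, f s ∂P := by linarith [h1.2]
      nlinarith
    · rintro ⟨_, f, hf, rfl⟩ x
      have h1 := (hA f hf).rng x
      have h2 := (hA f hf).mean P
      simp only [Pi.neg_apply, integral_neg]
      have : -f x - -∫ s, f s ∂P ≤ 1 := by linarith [h1.1, h2.2]
      nlinarith
    · rintro ⟨_, f, hf, rfl⟩
      rcases hψ with h | h
      · exact (mgf_hoeff (hA f hf) lam).trans (exp_le_exp.2 h)
      · exact (mgf_var' (hA f hf) (hp f hf) h0.le h.2).trans (exp_le_exp.2 h.1)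
    · exact cond_of hcond
  refine le_trans (measure_mono ?_) (dev_count G (hD.image _) hset (by positivity) n hn D
    (fun f hf => (hA f hf).absle) ?_ τ)
  · rintro x ⟨f, hf, hx⟩
    refine ⟨-f, ⟨f, hf, rfl⟩, ?_⟩
    have := mul_le_mul_of_nonneg_left hx (show 0 ≤ lam * n by positivity)
    have e : n * empMean n x f = ∑ j, f (x j) := by unfold empMean; field_simp
    have e2 : lam * n * (ψ / lam + a * RadF n D x + τ / (lam * n)) =
        n * ψ + a * lam * n * RadF n D x + τ := by field_simp
    rw [e2] at this
    simp only [Pi.neg_apply, integral_neg, Finset.sum_neg_distrib]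
    rw [← e]
    refine this.trans (le_of_eq ?_)
    ring
  · rintro g ⟨f, hf, rfl⟩
    right; simpa using hf

/-- `DD` in terms of `u = 1/√n` -/
def DDu (t u ρ : ℝ) : ℝ := ρ - 2 * u * √(ρ * tau t ρ) - 10 / 3 * tau t ρ * u ^ 2

/-- `c2` in terms of `u = 1/√n` -/
def c2u (t u ρ : ℝ) : ℝ := 2 * ρ + 2 * u * √(ρ * tau t ρ) + 10 / 3 * tau t ρ * u ^ 2

lemma sqrt_u {n : ℕ} (hn : 1 ≤ n) (y : ℝ) : √(4 * (y / n)) = 2 * (1 / √n) * √y := by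
  have hn0 : (0:ℝ) < n := by exact_mod_cast hn
  have : 4 * (y / n) = (2 * (1 / √n)) ^ 2 * y := by
    rw [mul_pow, div_pow, Real.sq_sqrt hn0.le]; ring
  rw [this, Real.sqrt_mul (sq_nonneg _), Real.sqrt_sq (by positivity)]

lemma u_sq {n : ℕ} : (1 / √(n:ℝ)) ^ 2 = 1 / n := by
  rw [div_pow, Real.sq_sqrt (by positivity)]; norm_num

lemma DD_u {n : ℕ} (hn : 1 ≤ n) (t ρ : ℝ) : DD n t ρ = DDu t (1 / √n) ρ := by
  rw [DD_eq, DDu, u_sq, ← sqrt_u hn, show 4 * ρ * (tau t ρ / n) = 4 * (ρ * tau t ρ / n) by ring]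
  ring

lemma c2_u {n : ℕ} (hn : 1 ≤ n) (t ρ : ℝ) : c2 n t ρ = c2u t (1 / √n) ρ := by
  rw [c2_eq, c2u, u_sq, ← sqrt_u hn, show 4 * ρ * (tau t ρ / n) = 4 * (ρ * tau t ρ / n) by ring]
  ring

/-- numerical condition -/
def Num (t u a dev ρ : ℝ) : Prop := ∃ ρ', 0 < ρ' ∧ ρ' ≠ 1 ∧ ρ ≤ ρ' ∧ 1 ≤ c2u t u ρ' ∧
  (a * u + 1.29) * DDu t u ρ' ≤ (8 * u + 1.29) * (ρ - dev)

lemma radSup_one {S : Type*} [MeasurableSpace S] {n : ℕ} (hn : 1 ≤ n) {F : Set (S → ℝ)}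
    (hA : ∀ f ∈ F, Adm f) {x : Fin n → S} {u : ℝ} (hu : 1 ≤ u) : radSup n F x u = RadF n F x := by
  rw [radSup_eq]
  congr 1
  ext f
  constructor
  · exact fun h => h.1
  · intro hf
    refine ⟨hf, le_trans ?_ hu⟩
    unfold empMean
    have hn0 : (0:ℝ) < n := by exact_mod_cast hn
    rw [div_le_one hn0]
    calc ∑ i, f (x i) ≤ ∑ i : Fin n, (1:ℝ) := Finset.sum_le_sum fun i _ => ((hA f hf).rng _).2
      _ = n := by simp

lemma star {S : Type*} [MeasurableSpace S] {n : ℕ} (hn : 9 ≤ n) {F : Set (S → ℝ)}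
    (hA : ∀ f ∈ F, Adm f) {x : Fin n → S} {t : ℝ} (ht : log 2 ≤ t) {V r : ℝ → ℝ}
    (hFP : FP n t (radSup n F x) V r) {f : S → ℝ} (hf : f ∈ F) {ρ a dev : ℝ} (hρ : ρ ≤ 1)
    (ha : 0 ≤ a) (ha8 : a ≤ 8) (hdev : ρ - empMean n x f ≤ dev + a * RadF n F x)
    (hN : Num t (1 / √n) a dev ρ) : ρ ≤ r (empMean n x f) := by
  have hn1 : 1 ≤ n := by omega
  have hn0 : (0:ℝ) < n := by exact_mod_cast hn1
  obtain ⟨ρ', h0, h1, h2, hc, hs⟩ := hN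
  rw [← c2_u hn1] at hc
  rw [← DD_u hn1] at hs
  have hk := RadF_ge hn hA hf (x := x)
  set u := 1 / √(n:ℝ)
  have hu : 0 < u := by positivity
  have hR := radSup_one hn1 hA (x := x) (hc.trans (hFP.c2_le_V ρ'))
  have key : DD n t ρ' - 8 * radSup n F x (V ρ') ≤ empMean n x f := by
    rw [hR]
    have h4 : (a * u + 1.29) * DD n t ρ' ≤ (a * u + 1.29) * (empMean n x f + 8 * RadF n F x) := by
      refine hs.trans ?_
      have h5 : (8 * u + 1.29) * (ρ - dev) ≤ (8 * u + 1.29) * (empMean n x f + a * RadF n F x) :=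
        mul_le_mul_of_nonneg_left (by linarith) (by positivity)
      have h6 := mul_le_mul_of_nonneg_left hk (show 0 ≤ 8 - a by linarith)
      linarith
    have := le_of_mul_le_mul_left h4 (by positivity)
    linarith
  exact (le_min h2 hρ).trans (lemmaJ hFP ht (empMean_nonneg (hA f hf) x) h0 h1 key)

/-- one event for a range of means -/
lemma lev_I {S : Type*} [MeasurableSpace S] {P : Measure S} [IsProbabilityMeasure P]
    {F : Set (S → ℝ)} (hF : F.Countable) (hA : ∀ f ∈ F, Adm f) {n : ℕ} (hn : 9 ≤ n) {t : ℝ}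
    (ht : log 2 ≤ t) {I : Set ℝ} {p : ℝ} (hp1 : p ≤ 1) (hI : ∀ ρ ∈ I, p ≤ ρ)
    {lam τ a ψ : ℝ} (ha : 0 < a) (ha8 : a ≤ 8)
    (h0 : 0 < lam) (hψ : lam ^ 2 / 8 ≤ ψ ∨ ((1 - p) * lam ^ 2 / 2 * (1 + 4 * lam / 9) ≤ ψ ∧ lam ≤ 1))
    (hcond : 2 * lam * exp (lam + lam * (1 - p) + ψ) ≤ 1 - exp (-(a * lam)))
    (hN : ∀ ρ ∈ I, ρ ≤ 1 → Num t (1 / √n) a (ψ / lam + τ * (1 / √n) ^ 2 / lam) ρ) :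
    ∃ B, (Measure.pi fun _ : Fin n => P) B ≤ ENNReal.ofReal (exp (-τ)) ∧
      ∀ x ∉ B, ∀ V r, FP n t (radSup n F x) V r → ∀ f ∈ F, ∫ s, f s ∂P ∈ I →
        ∫ s, f s ∂P ≤ r (empMean n x f) := by
  set D : Set (S → ℝ) := {f ∈ F | ∫ s, f s ∂P ∈ I} with hD
  have hDF : D ⊆ F := fun f hf => hf.1
  refine ⟨_, dev_one (P := P) (hF.mono hDF) (fun f hf => hA f (hDF hf)) hp1 (fun f hf => hI _ hf.2)
    (by omega : 1 ≤ n) (τ := τ) ha h0 hψ hcond, ?_⟩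
  intro x hx V r hFP f hf hfI
  simp only [Set.mem_setOf_eq, not_exists, not_and, not_le] at hx
  have h1 := hx f ⟨hf, hfI⟩
  have h2 : RadF n D x ≤ RadF n F x := RadF_mono (fun f hf => (hA f hf).absle) hDF
  have h3 := ((hA f hf).mean P).2
  refine star hn hA ht hFP hf h3 ha.le ha8 ?_ (hN _ hfI h3)
  have h4 : τ / (lam * n) = τ * (1 / √(n:ℝ)) ^ 2 / lam := by
    rw [u_sq]; field_simp
  rw [h4] at h1
  have := mul_le_mul_of_nonneg_left h2 ha.le
  linarith

end GB

end

section

open MeasureTheory ProbabilityTheory Real Set Filter Topology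


namespace GB

/-- nonnegativity of the Bernstein coefficients of a cubic on `[u1, u2]` -/
def Bern {K : Type*} [Field K] [LinearOrder K] (c0 c1 c2 c3 u1 u2 : K) : Prop :=
  0 ≤ c0 + c1 * u1 + c2 * u1 ^ 2 + c3 * u1 ^ 3 ∧
  0 ≤ c0 + c1 * (2 * u1 + u2) / 3 + c2 * (u1 ^ 2 + 2 * u1 * u2) / 3 + c3 * (u1 ^ 2 * u2) ∧
  0 ≤ c0 + c1 * (u1 + 2 * u2) / 3 + c2 * (2 * u1 * u2 + u2 ^ 2) / 3 + c3 * (u1 * u2 ^ 2) ∧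
  0 ≤ c0 + c1 * u2 + c2 * u2 ^ 2 + c3 * u2 ^ 3

lemma Bern.sound {c0 c1 c2 c3 u1 u2 u : ℝ} (h : Bern c0 c1 c2 c3 u1 u2) (h1 : u1 ≤ u)
    (h2 : u ≤ u2) : 0 ≤ c0 + c1 * u + c2 * u ^ 2 + c3 * u ^ 3 := by
  obtain ⟨b0, b1, b2, b3⟩ := h
  rcases eq_or_lt_of_le (h1.trans h2) with h | h
  · have : u = u1 := by linarith
    rw [this]; exact b0
  · have e : (u2 - u1) ^ 3 * (c0 + c1 * u + c2 * u ^ 2 + c3 * u ^ 3) =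
      (c0 + c1 * u1 + c2 * u1 ^ 2 + c3 * u1 ^ 3) * (u2 - u) ^ 3 +
      3 * (c0 + c1 * (2 * u1 + u2) / 3 + c2 * (u1 ^ 2 + 2 * u1 * u2) / 3 + c3 * (u1 ^ 2 * u2)) *
        ((u2 - u) ^ 2 * (u - u1)) +
      3 * (c0 + c1 * (u1 + 2 * u2) / 3 + c2 * (2 * u1 * u2 + u2 ^ 2) / 3 + c3 * (u1 * u2 ^ 2)) *
        ((u2 - u) * (u - u1) ^ 2) +
      (c0 + c1 * u2 + c2 * u2 ^ 2 + c3 * u2 ^ 3) * (u - u1) ^ 3 := by ring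
    have h3 : 0 ≤ u2 - u := by linarith
    have h4 : 0 ≤ u - u1 := by linarith
    have h5 : 0 < u2 - u1 := by linarith
    have : 0 ≤ (u2 - u1) ^ 3 * (c0 + c1 * u + c2 * u ^ 2 + c3 * u ^ 3) := by rw [e]; positivity
    exact nonneg_of_mul_nonneg_right this (by positivity)

/-- Bernstein check at a fixed `t` with square root lower bound `s` -/
def BernT {K : Type*} [Field K] [LinearOrder K] (t s u1 u2 lam a ra rp L : K) : Prop :=
  Bern (129 / 100 * (ra - lam / 8 - rp))
    (8 * (ra - lam / 8) + 2 * (129 / 100) * s - a * rp)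
    (129 / 100 * (10 / 3 * (t + L) - (t - 405 / 1000) / lam) + 2 * a * s)
    (a * (10 / 3 * (t + L)) - 8 * ((t - 405 / 1000) / lam)) u1 u2

/-- full check of a piece -/
def PhiOK {K : Type*} [Field K] [LinearOrder K] (t1 t2 u1 u2 lam a ra rp L s1 s2 : K) : Prop :=
  BernT t1 s1 u1 u2 lam a ra rp L ∧ BernT t2 s2 u1 u2 lam a ra rp L ∧ 0 ≤ s1 ∧ 0 ≤ s2 ∧
  ((s1 = 0 ∧ s2 = 0) ∨ (s1 ^ 2 ≤ rp * (t1 + L) ∧ s2 ^ 2 ≤ rp * (t2 + L))) ∧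
  1 ≤ 2 * rp + 10 / 3 * (t1 + L) * u2 ^ 2 ∧ 1 ≤ 2 * rp

lemma PhiOK.sound {t1 t2 u1 u2 lam a ra rp L s1 s2 : ℝ}
    (h : PhiOK t1 t2 u1 u2 lam a ra rp L s1 s2) (ht : t1 < t2) (hu : 0 < u1) (ha : 0 < a)
    {t u T : ℝ} (h1 : t1 ≤ t) (h2 : t ≤ t2) (h3 : u1 ≤ u) (h4 : u ≤ u2) (hT : t + L ≤ T) :
    1 ≤ 2 * rp + 2 * u * √(rp * T) + 10 / 3 * T * u ^ 2 ∧
    (a * u + 1.29) * (rp - 2 * u * √(rp * T) - 10 / 3 * T * u ^ 2) ≤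
      (8 * u + 1.29) * (ra - (lam / 8 + (t - 0.405) * u ^ 2 / lam)) := by
  obtain ⟨hb1, hb2, hs1, hs2, hs, hc, hrp⟩ := h
  have hu0 : 0 < u := by linarith
  set θ := (t - t1) / (t2 - t1) with hθ
  have hθ0 : 0 ≤ θ := div_nonneg (by linarith) (by linarith)
  have hθ1 : θ ≤ 1 := by rw [hθ, div_le_one (by linarith)]; linarith
  have hteq : t = (1 - θ) * t1 + θ * t2 := by
    have : θ * (t2 - t1) = t - t1 := div_mul_cancel₀ _ (by linarith)
    linarith
  set s := (1 - θ) * s1 + θ * s2 with hsdef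
  have hs0 : 0 ≤ s := by
    have : 0 ≤ 1 - θ := by linarith
    positivity
  have hsq : s ≤ √(rp * T) := by
    rcases hs with ⟨e1, e2⟩ | ⟨e1, e2⟩
    · have : s = 0 := by rw [hsdef, e1, e2]; ring
      rw [this]; positivity
    · apply Real.le_sqrt_of_sq_le
      have h5 : s ^ 2 ≤ (1 - θ) * s1 ^ 2 + θ * s2 ^ 2 := by
        have : (1 - θ) * s1 ^ 2 + θ * s2 ^ 2 - s ^ 2 = θ * (1 - θ) * (s1 - s2) ^ 2 := by
          rw [hsdef]; ring
        have h6 : 0 ≤ θ * (1 - θ) * (s1 - s2) ^ 2 := by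
          have : 0 ≤ 1 - θ := by linarith
          positivity
        linarith
      have h7 : (1 - θ) * s1 ^ 2 + θ * s2 ^ 2 ≤ rp * (t + L) := by
        have e : rp * (t + L) = (1 - θ) * (rp * (t1 + L)) + θ * (rp * (t2 + L)) := by
          rw [hteq]; ring
        rw [e]
        exact add_le_add (mul_le_mul_of_nonneg_left e1 (by linarith))
          (mul_le_mul_of_nonneg_left e2 hθ0)
      have h8 : rp * (t + L) ≤ rp * T := mul_le_mul_of_nonneg_left hT (by linarith)
      linarith
  have hu2 : u ^ 2 ≤ u2 ^ 2 := by gcongr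
  have hT2 : (t + L) * u ^ 2 ≤ T * u ^ 2 := mul_le_mul_of_nonneg_right hT (sq_nonneg u)
  have hsu : 2 * u * s ≤ 2 * u * √(rp * T) := mul_le_mul_of_nonneg_left hsq (by linarith)
  constructor
  · have h9 : 0 ≤ 2 * u * s := by positivity
    rcases le_or_gt 0 (t + L) with h10 | h10
    · have : 0 ≤ (t + L) * u ^ 2 := by positivity
      linarith
    · have h11 : (t + L) * u2 ^ 2 ≤ (t + L) * u ^ 2 := mul_le_mul_of_nonpos_left hu2 h10.le
      have h12 : (t1 + L) * u2 ^ 2 ≤ (t + L) * u2 ^ 2 :=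
        mul_le_mul_of_nonneg_right (by linarith) (sq_nonneg _)
      linarith
  · have p1 := Bern.sound hb1 h3 h4
    have p2 := Bern.sound hb2 h3 h4
    have h12 : (a * u + 1.29) * (rp - 2 * u * √(rp * T) - 10 / 3 * T * u ^ 2) ≤
        (a * u + 1.29) * (rp - 2 * u * s - 10 / 3 * (t + L) * u ^ 2) :=
      mul_le_mul_of_nonneg_left (by linarith) (by positivity)
    refine h12.trans ?_
    have q1 := mul_nonneg (show 0 ≤ 1 - θ by linarith) p1
    have q2 := mul_nonneg hθ0 p2
    rw [← sub_nonneg]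
    refine le_trans (add_nonneg q1 q2) (le_of_eq ?_)
    rw [hsdef, hteq]
    ring

/-- logarithm check: `j/20 ≤ 2 log q` -/
def LOK {K : Type*} [Field K] [LinearOrder K] (j : ℤ) (q : K) : Prop :=
  (0 ≤ j ∧ (27183 / 10000 : K) ^ j.toNat ≤ q ^ 40) ∨
  (j < 0 ∧ 1 ≤ q ^ 40 * (2718 / 1000 : K) ^ (-j).toNat)

lemma LOK.sound {j : ℤ} {q : ℝ} (h : LOK j q) (hq : 0 < q) : (j:ℝ) / 20 ≤ 2 * log q := by
  have key : exp j ≤ q ^ 40 := by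
    rcases h with ⟨h1, h2⟩ | ⟨h1, h2⟩
    · have e : (j:ℝ) = (j.toNat : ℝ) := by
        exact_mod_cast (Int.toNat_of_nonneg h1).symm
      rw [e]
      refine le_trans ?_ h2
      rw [← Real.exp_one_pow]
      have := exp_one_lt_d9
      gcongr
      linarith
    · have e : (j:ℝ) = -((-j).toNat : ℝ) := by
        have : (((-j).toNat : ℤ) : ℝ) = ((-j : ℤ) : ℝ) := by rw [Int.toNat_of_nonneg (by omega)]
        push_cast at this; rw [this]; ring
      rw [e, Real.exp_neg, inv_le_iff_one_le_mul₀ (exp_pos _), ← Real.exp_one_pow]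
      refine h2.trans ?_
      have := exp_one_gt_d9
      gcongr
      linarith
  have := Real.log_le_log (exp_pos _) key
  rw [Real.log_exp, Real.log_pow] at this
  push_cast at this
  linarith

lemma log_ge_A {y : ℝ} (h : 1 < y) : 2 * (y - 1) / (y + 1) ≤ log y := by
  have := Real.le_log_one_add_of_nonneg (show 0 ≤ y - 1 by linarith)
  rw [show y - 1 + 2 = y + 1 by ring, show 1 + (y - 1) = y by ring] at this
  exact this

lemma log_ge_B {y : ℝ} (h0 : 0 < y) (h : y < 1) : 2 * (1 - y) / (1 + y) ≤ -log y := by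
  have := log_ge_A (show 1 < y⁻¹ by rw [one_lt_inv₀ h0]; exact h)
  rw [Real.log_inv] at this
  refine le_trans (le_of_eq ?_) this
  field_simp

lemma tau_ge {j : ℤ} {ℓ t ρ : ℝ} (hℓ : 0 < ℓ) (h : LOK j (26167 / 10000 * ℓ)) (hl : ℓ ≤ |log ρ|) :
    t + (j:ℝ) / 20 ≤ tau t ρ := by
  have h1 := h.sound (by positivity)
  have hK := K0_gt
  have h2 : 26167 / 10000 * ℓ ≤ K0 * |log ρ| := by
    norm_num at hK
    gcongr
  have := Real.log_le_log (by positivity) h2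
  unfold tau
  linarith

/-- truncated exponential series -/
def expS {K : Type*} [Field K] (z : K) : K :=
  1 + z + z ^ 2 / 2 + z ^ 3 / 6 + z ^ 4 / 24 + z ^ 5 / 120 + z ^ 6 / 720

/-- check of the side condition -/
def CondOK {K : Type*} [Field K] [LinearOrder K] (lam a y : K) : Prop :=
  0 < lam ∧ 0 < a ∧ 0 ≤ y ∧ y ≤ 1 ∧
  2 * lam * (1 + y + y ^ 2 / 2 + y ^ 3 / 6 + y ^ 4 * 5 / 96) * expS (a * lam) ≤ expS (a * lam) - 1

lemma exp_up {y : ℝ} (h0 : 0 ≤ y) (h1 : y ≤ 1) :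
    exp y ≤ 1 + y + y ^ 2 / 2 + y ^ 3 / 6 + y ^ 4 * 5 / 96 := by
  have := Real.exp_bound' h0 h1 (show 0 < 4 by norm_num)
  refine this.trans (le_of_eq ?_)
  simp [Finset.sum_range_succ, Nat.factorial]
  ring

lemma exp_neg_up {z : ℝ} (h0 : 0 ≤ z) : exp (-z) ≤ 1 / expS z := by
  rw [Real.exp_neg, ← one_div]
  apply one_div_le_one_div_of_le
  · unfold expS; positivity
  · have := Real.sum_le_exp_of_nonneg h0 7
    refine le_trans (le_of_eq ?_) this
    simp [Finset.sum_range_succ, Nat.factorial, expS]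

lemma CondOK.sound {lam a y : ℝ} (h : CondOK lam a y) :
    2 * lam * exp y ≤ 1 - exp (-(a * lam)) := by
  obtain ⟨h0, ha, hy, hy1, hc⟩ := h
  have h1 := exp_up hy hy1
  have h2 := exp_neg_up (show 0 ≤ a * lam by positivity)
  have h3 : 0 < expS (a * lam) := by unfold expS; positivity
  have h4 : 2 * lam * (1 + y + y ^ 2 / 2 + y ^ 3 / 6 + y ^ 4 * 5 / 96) ≤ 1 - 1 / expS (a * lam) := by
    rw [← mul_le_mul_iff_left₀ h3, sub_mul, one_div_mul_cancel h3.ne', one_mul]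
    exact hc
  have h5 := mul_le_mul_of_nonneg_left h1 (show 0 ≤ 2 * lam by linarith)
  linarith

end GB

end

section

open MeasureTheory ProbabilityTheory Real Set Filter Topology


namespace GB

instance {c0 c1 c2 c3 u1 u2 : ℚ} : Decidable (Bern c0 c1 c2 c3 u1 u2) := by
  unfold Bern; infer_instance
instance {t s u1 u2 lam a ra rp L : ℚ} : Decidable (BernT t s u1 u2 lam a ra rp L) := by
  unfold BernT; infer_instance
instance {t1 t2 u1 u2 lam a ra rp L s1 s2 : ℚ} :
    Decidable (PhiOK t1 t2 u1 u2 lam a ra rp L s1 s2) := by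
  unfold PhiOK; infer_instance
instance {j : ℤ} {q : ℚ} : Decidable (LOK j q) := by
  unfold LOK; infer_instance
instance {lam a y : ℚ} : Decidable (CondOK lam a y) := by
  unfold CondOK; infer_instance

lemma Bern.cast {c0 c1 c2 c3 u1 u2 : ℚ} (h : Bern c0 c1 c2 c3 u1 u2) :
    Bern (c0:ℝ) c1 c2 c3 u1 u2 := by
  unfold Bern at *; exact_mod_cast h

lemma BernT.cast {t s u1 u2 lam a ra rp L : ℚ} (h : BernT t s u1 u2 lam a ra rp L) :
    BernT (t:ℝ) s u1 u2 lam a ra rp L := by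
  unfold BernT at *
  have := Bern.cast h
  push_cast at this
  exact this

lemma PhiOK.cast {t1 t2 u1 u2 lam a ra rp L s1 s2 : ℚ}
    (h : PhiOK t1 t2 u1 u2 lam a ra rp L s1 s2) :
    PhiOK (t1:ℝ) t2 u1 u2 lam a ra rp L s1 s2 := by
  obtain ⟨h1, h2, h3, h4, h5, h6, h7⟩ := h
  refine ⟨h1.cast, h2.cast, by exact_mod_cast h3, by exact_mod_cast h4, by exact_mod_cast h5, ?_,
    by exact_mod_cast h7⟩
  have := (Rat.cast_le (K := ℝ)).2 h6
  push_cast at this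
  exact this

lemma LOK.cast {j : ℤ} {q : ℚ} (h : LOK j q) : LOK j (q:ℝ) := by
  unfold LOK at *
  rcases h with ⟨h1, h2⟩ | ⟨h1, h2⟩
  · left
    have := (Rat.cast_le (K := ℝ)).2 h2
    push_cast at this
    exact ⟨h1, this⟩
  · right
    have := (Rat.cast_le (K := ℝ)).2 h2
    push_cast at this
    exact ⟨h1, this⟩

lemma CondOK.cast {lam a y : ℚ} (h : CondOK lam a y) : CondOK (lam:ℝ) a y := by
  unfold CondOK expS at *; exact_mod_cast h

/-- a piece of type B: lower end, log index, two square roots -/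
structure Pc where
  (ra : ℚ) (j : ℤ) (s1 s2 : ℚ)

/-- certificate tree -/
inductive Tr where
  | leaf (lam a rp : ℚ) (A : Pc) (B : List Pc)
  | out
  | st (m : ℚ) (l r : Tr)
  | su (m : ℚ) (l r : Tr)

/-- chain of type B pieces -/
def okB (t1 t2 u1 u2 lam a : ℚ) : ℚ → List Pc → Bool
  | rb, [] => decide (rb ≤ 1 / 2)
  | rb, p :: ps => decide (rb < 1 ∧ 0 < p.ra ∧ p.ra ≤ rb ∧
      LOK p.j (26167 / 10000 * (2 * (1 - rb) / (1 + rb))) ∧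
      PhiOK t1 t2 u1 u2 lam a p.ra p.ra ((p.j : ℚ) / 20) p.s1 p.s2) && okB t1 t2 u1 u2 lam a p.ra ps

/-- checker -/
def Tr.ok : Tr → ℚ → ℚ → ℚ → ℚ → Bool
  | .leaf lam a rp A B, t1, t2, u1, u2 =>
      decide (t1 < t2 ∧ 0 < u1 ∧ CondOK lam a (3 / 2 * lam + lam ^ 2 / 8) ∧ a ≤ 8 ∧ 1 < rp ∧
        LOK A.j (26167 / 10000 * (2 * (rp - 1) / (rp + 1))) ∧
        PhiOK t1 t2 u1 u2 lam a A.ra rp ((A.j : ℚ) / 20) A.s1 A.s2) && okB t1 t2 u1 u2 lam a A.ra B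
  | .out, t1, _, u1, _ => decide (0 ≤ t1 ∧ 0 ≤ u1 ∧ 22 / 100 ≤ (t1 + 119 / 100) * u1 ^ 2)
  | .st m l r, t1, t2, u1, u2 => l.ok t1 m u1 u2 && r.ok m t2 u1 u2
  | .su m l r, t1, t2, u1, u2 => l.ok t1 t2 u1 m && r.ok t1 t2 m u2

lemma Num_of_phi {t u a lam ra rp ρ : ℝ} (hρ : ra ≤ ρ) (h0 : 0 < rp) (h1 : rp ≠ 1) (hrp : ρ ≤ rp)
    (hu : 0 < u)
    (h : 1 ≤ 2 * rp + 2 * u * √(rp * tau t rp) + 10 / 3 * tau t rp * u ^ 2 ∧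
    (a * u + 1.29) * (rp - 2 * u * √(rp * tau t rp) - 10 / 3 * tau t rp * u ^ 2) ≤
      (8 * u + 1.29) * (ra - (lam / 8 + (t - 0.405) * u ^ 2 / lam))) :
    Num t u a (lam / 8 + (t - 0.405) * u ^ 2 / lam) ρ := by
  refine ⟨rp, h0, h1, hrp, h.1, h.2.trans ?_⟩
  gcongr

lemma okB_sound {t1 t2 u1 u2 lam a : ℚ} (ht : t1 < t2) (hu : 0 < u1) (ha : 0 < a) (ha8 : a ≤ 8)
    {t u : ℝ} (h1 : t1 ≤ t) (h2 : t ≤ t2) (h3 : u1 ≤ u) (h4 : u ≤ u2) (B : List Pc) :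
    ∀ rb : ℚ, okB t1 t2 u1 u2 lam a rb B = true → ∀ ρ : ℝ, 1 / 2 < ρ → ρ ≤ rb →
      Num t u a (lam / 8 + (t - 0.405) * u ^ 2 / lam) ρ := by
  induction B with
  | nil =>
    intro rb h ρ hρ hρ2
    simp only [okB, decide_eq_true_eq] at h
    have := (Rat.cast_le (K := ℝ)).2 h
    push_cast at this
    linarith
  | cons p ps ih =>
    intro rb h ρ hρ hρ2
    simp only [okB, Bool.and_eq_true, decide_eq_true_eq] at h
    obtain ⟨⟨hb1, hp0, hpb, hL, hP⟩, hps⟩ := h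
    rcases le_or_gt ρ p.ra with hc | hc
    · exact ih _ hps ρ hρ hc
    have hu0 : 0 < u := lt_of_lt_of_le (by exact_mod_cast hu) h3
    have hb1' : (rb:ℝ) < 1 := by exact_mod_cast hb1
    have ha' : (0:ℝ) < a := by exact_mod_cast ha
    have ha8' : (a:ℝ) ≤ 8 := by exact_mod_cast ha8
    have hp0' : (0:ℝ) < p.ra := by exact_mod_cast hp0
    have hrb0 : (0:ℝ) < rb := by linarith
    have hL' := hL.cast
    push_cast at hL'
    have hℓ0 : 0 < 2 * (1 - (rb:ℝ)) / (1 + rb) := div_pos (by linarith) (by linarith)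
    have hℓ : 2 * (1 - (rb:ℝ)) / (1 + rb) ≤ |log ρ| := by
      have e1 := log_ge_B hrb0 hb1'
      have e2 := Real.log_le_log (by linarith) hρ2
      have := neg_abs_le (log ρ)
      have := neg_le_abs (log ρ)
      linarith
    have hT : t + (p.j:ℝ) / 20 ≤ tau t ρ := tau_ge hℓ0 hL' hℓ
    have hP' := hP.cast
    push_cast at hP'
    obtain ⟨q1, q2⟩ := hP'.sound (by exact_mod_cast ht) (by exact_mod_cast hu) ha' h1 h2 h3 h4 hT
    have hsq : √((p.ra:ℝ) * tau t ρ) ≤ √(ρ * tau t ρ) := by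
      rcases le_or_gt 0 (tau t ρ) with h | h
      · apply Real.sqrt_le_sqrt; gcongr
      · rw [Real.sqrt_eq_zero_of_nonpos (by nlinarith)]; positivity
    have hsq2 : 2 * u * √((p.ra:ℝ) * tau t ρ) ≤ 2 * u * √(ρ * tau t ρ) := by gcongr
    refine ⟨ρ, by linarith, by linarith, le_rfl, ?_, ?_⟩
    · unfold c2u; linarith
    · unfold DDu
      have e1 : ((a:ℝ) * u + 1.29) * (ρ - 2 * u * √(ρ * tau t ρ) - 10 / 3 * tau t ρ * u ^ 2) ≤
        (a * u + 1.29) * (ρ - 2 * u * √(p.ra * tau t ρ) - 10 / 3 * tau t ρ * u ^ 2) := by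
        apply mul_le_mul_of_nonneg_left _ (by positivity); linarith
      have e2 : ((a:ℝ) * u + 1.29) * (ρ - p.ra) ≤ (8 * u + 1.29) * (ρ - p.ra) := by
        apply mul_le_mul_of_nonneg_right _ (by linarith)
        gcongr
      linarith

/-- conclusion of a certificate -/
def Cert (t u : ℝ) : Prop := ∃ lam a : ℝ, 0 < lam ∧ 0 < a ∧ a ≤ 8 ∧
  2 * lam * exp (3 / 2 * lam + lam ^ 2 / 8) ≤ 1 - exp (-(a * lam)) ∧
  ∀ ρ : ℝ, 1 / 2 < ρ → ρ ≤ 1 → Num t u a (lam / 8 + (t - 0.405) * u ^ 2 / lam) ρ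

lemma Tr.sound {t u : ℝ} (T : Tr) : ∀ {t1 t2 u1 u2 : ℚ}, T.ok t1 t2 u1 u2 = true →
    t1 ≤ t → t ≤ t2 → u1 ≤ u → u ≤ u2 → (22 / 100 ≤ (t + 119 / 100) * u ^ 2) ∨ Cert t u := by
  induction T with
  | leaf lam a rp A B =>
    intro t1 t2 u1 u2 h h1 h2 h3 h4
    right
    simp only [Tr.ok, Bool.and_eq_true, decide_eq_true_eq] at h
    obtain ⟨⟨ht, hu, hC, ha8, hrp, hL, hP⟩, hB⟩ := h
    have hC' := hC.cast
    have ha' : (0:ℝ) < a := hC'.2.1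
    have hrp' : (1:ℝ) < rp := by exact_mod_cast hrp
    have hu0 : 0 < u := lt_of_lt_of_le (by exact_mod_cast hu) h3
    have hs := hC'.sound
    push_cast at hs
    refine ⟨lam, a, hC'.1, ha', by exact_mod_cast ha8, hs, ?_⟩
    intro ρ hρ hρ1
    rcases le_or_gt ρ A.ra with hc | hc
    · exact okB_sound ht hu (by exact_mod_cast ha') ha8 h1 h2 h3 h4 B _ hB ρ hρ hc
    · have hL' := hL.cast
      push_cast at hL'
      have hℓ0 : 0 < 2 * ((rp:ℝ) - 1) / (rp + 1) := div_pos (by linarith) (by linarith)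
      have hT : t + (A.j:ℝ) / 20 ≤ tau t rp :=
        tau_ge hℓ0 hL' ((log_ge_A hrp').trans (le_abs_self _))
      have hP' := hP.cast
      push_cast at hP'
      have := hP'.sound (by exact_mod_cast ht) (by exact_mod_cast hu) ha' h1 h2 h3 h4 hT
      exact Num_of_phi hc.le (by linarith) (by linarith) (by linarith) hu0 this
  | out =>
    intro t1 t2 u1 u2 h h1 h2 h3 h4
    left
    simp only [Tr.ok, decide_eq_true_eq] at h
    obtain ⟨h5, h6, h7⟩ := h
    have h5' : (0:ℝ) ≤ t1 := by exact_mod_cast h5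
    have h6' : (0:ℝ) ≤ u1 := by exact_mod_cast h6
    have h7' := (Rat.cast_le (K := ℝ)).2 h7
    push_cast at h7'
    refine h7'.trans ?_
    have : 0 ≤ t + 119 / 100 := by linarith
    gcongr
  | st m l r ihl ihr =>
    intro t1 t2 u1 u2 h h1 h2 h3 h4
    simp only [Tr.ok, Bool.and_eq_true] at h
    rcases le_total t m with hm | hm
    · exact ihl h.1 h1 hm h3 h4
    · exact ihr h.2 hm h2 h3 h4
  | su m l r ihl ihr =>
    intro t1 t2 u1 u2 h h1 h2 h3 h4
    simp only [Tr.ok, Bool.and_eq_true] at h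
    rcases le_total u m with hm | hm
    · exact ihl h.1 h1 h2 h3 hm
    · exact ihr h.2 h1 h2 hm h4

/-- certificate data -/
def tree0 : Tr :=
  (.leaf (3 / 25) (283 / 100) (51 / 50) ⟨99 / 100, -119, 0, 0⟩ [⟨23 / 25, -146, 0, 0⟩,
    ⟨63 / 100, -61, 0, 0⟩,
    ⟨1 / 2, 6, 703 / 1000, 321 / 250⟩])

lemma tree0_ok : tree0.ok (69 / 100) (3) (1 / 50) (707 / 10000) = true := by decide +kernel

/-- certificate data -/
def tree1 : Tr :=
  (.su (777 / 5000)
    (.su (131 / 1250)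
      (.st (369 / 200)
        (.su (43 / 500)
          (.leaf (3 / 25) (283 / 100) (21 / 20) ⟨97 / 100, -83, 0, 0⟩ [⟨37 / 50, -102, 0, 0⟩,
            ⟨1 / 2, -10, 77 / 250, 41 / 50⟩])
          (.st (1267 / 1000)
            (.leaf (1 / 10) (53 / 20) (21 / 20) ⟨24 / 25, -83, 0, 0⟩ [⟨37 / 50, -90, 0, 0⟩,
              ⟨1 / 2, -10, 77 / 250, 619 / 1000⟩])
            (.leaf (3 / 25) (283 / 100) (13 / 10) ⟨97 / 100, -16, 779 / 1000, 233 / 200⟩ [⟨93 / 100, -102, 0, 0⟩,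
              ⟨37 / 50, -67, 0, 0⟩,
              ⟨1 / 2, -10, 619 / 1000, 41 / 50⟩])))
        (.su (43 / 500)
          (.leaf (3 / 25) (283 / 100) (5 / 4) ⟨24 / 25, -22, 193 / 200, 1541 / 1000⟩ [⟨91 / 100, -90, 0, 0⟩,
            ⟨77 / 100, -57, 0, 0⟩,
            ⟨1 / 2, -16, 361 / 500, 131 / 125⟩])
          (.leaf (4 / 25) (82 / 25) (5 / 4) ⟨47 / 50, -22, 193 / 200, 1541 / 1000⟩ [⟨15 / 16, -73, 0, 0⟩,
            ⟨93 / 100, -72, 0, 0⟩,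
            ⟨9 / 10, -67, 0, 0⟩,
            ⟨81 / 100, -52, 0, 0⟩,
            ⟨1 / 2, -24, 567 / 1000, 237 / 250⟩])))
      (.st (369 / 200)
        (.su (319 / 2500)
          (.st (1267 / 1000)
            (.leaf (3 / 25) (283 / 100) (7 / 5) ⟨24 / 25, -6, 369 / 500, 1163 / 1000⟩ [⟨91 / 100, -90, 0, 0⟩,
              ⟨17 / 25, -57, 0, 0⟩,
              ⟨1 / 2, -1, 113 / 200, 39 / 50⟩])
            (.leaf (7 / 50) (76 / 25) (27 / 20) ⟨93 / 100, -10, 1017 / 1000, 1347 / 1000⟩ [⟨9 / 10, -67, 0, 0⟩,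
              ⟨79 / 100, -52, 0, 0⟩,
              ⟨1 / 2, -20, 73 / 200, 13 / 20⟩]))
          (.st (1267 / 1000)
            (.leaf (3 / 25) (283 / 100) (7 / 5) ⟨91 / 100, -6, 369 / 500, 1163 / 1000⟩ [⟨87 / 100, -57, 0, 0⟩,
              ⟨73 / 100, -41, 0, 0⟩,
              ⟨1 / 2, -9, 173 / 500, 639 / 1000⟩])
            (.su (88 / 625)
              (.leaf (7 / 50) (76 / 25) (27 / 20) ⟨89 / 100, -10, 1017 / 1000, 1347 / 1000⟩ [⟨43 / 50, -48, 0, 0⟩,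
                ⟨39 / 50, -38, 0, 0⟩,
                ⟨1 / 2, -18, 107 / 250, 687 / 1000⟩])
              (.leaf (4 / 25) (82 / 25) (7 / 5) ⟨43 / 50, -6, 1163 / 1000, 147 / 100⟩ [⟨21 / 25, -38, 0, 0⟩,
                ⟨39 / 50, -32, 0, 0⟩,
                ⟨1 / 2, -18, 107 / 250, 687 / 1000⟩]))))
        (.su (319 / 2500)
          (.st (1211 / 500)
            (.leaf (4 / 25) (82 / 25) (13 / 10) ⟨9 / 10, -16, 233 / 200, 363 / 250⟩ [⟨359 / 400, -52, 0, 0⟩,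
              ⟨89 / 100, -51, 0, 0⟩,
              ⟨87 / 100, -48, 0, 0⟩,
              ⟨81 / 100, -41, 0, 0⟩,
              ⟨1 / 2, -24, 567 / 1000, 781 / 1000⟩])
            (.leaf (7 / 50) (76 / 25) (5 / 4) ⟨89 / 100, -22, 257 / 200, 1541 / 1000⟩ [⟨83 / 100, -48, 27 / 200, 141 / 200⟩,
              ⟨1 / 2, -29, 697 / 1000, 22 / 25⟩]))
          (.st (1211 / 500)
            (.su (88 / 625)
              (.leaf (9 / 50) (357 / 100) (27 / 20) ⟨43 / 50, -10, 1347 / 1000, 161 / 100⟩ [⟨17 / 20, -38, 0, 0⟩,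
                ⟨51 / 100, -35, 11 / 50, 117 / 200⟩,
                ⟨1 / 2, 21, 1203 / 1000, 1317 / 1000⟩])
              (.leaf (9 / 50) (357 / 100) (27 / 20) ⟨21 / 25, -10, 1347 / 1000, 161 / 100⟩ [⟨1 / 2, -32, 7 / 20, 641 / 1000⟩]))
            (.leaf (9 / 50) (357 / 100) (5 / 4) ⟨17 / 20, -22, 257 / 200, 1541 / 1000⟩ [⟨1 / 2, -35, 579 / 1000, 79 / 100⟩])))))
    (.su (461 / 2000)
      (.st (369 / 200)
        (.su (473 / 2500)
          (.st (1267 / 1000)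
            (.leaf (4 / 25) (82 / 25) (29 / 20) ⟨43 / 50, -2, 231 / 250, 13 / 10⟩ [⟨83 / 100, -38, 0, 0⟩,
              ⟨18 / 25, -29, 0, 0⟩,
              ⟨1 / 2, -7, 103 / 250, 677 / 1000⟩])
            (.su (857 / 5000)
              (.st (389 / 250)
                (.leaf (7 / 50) (76 / 25) (29 / 20) ⟨83 / 100, -2, 13 / 10, 363 / 250⟩ [⟨79 / 100, -29, 0, 0⟩,
                  ⟨1 / 2, -20, 73 / 200, 527 / 1000⟩])
                (.leaf (4 / 25) (82 / 25) (29 / 20) ⟨41 / 50, -2, 363 / 250, 159 / 100⟩ [⟨1 / 2, -27, 8 / 25, 497 / 1000⟩]))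
              (.leaf (4 / 25) (82 / 25) (29 / 20) ⟨4 / 5, -2, 13 / 10, 159 / 100⟩ [⟨1 / 2, -22, 36 / 125, 61 / 100⟩])))
          (.st (1267 / 1000)
            (.leaf (4 / 25) (82 / 25) (8 / 5) ⟨19 / 25, 7, 1289 / 1000, 201 / 125⟩ [⟨7 / 10, -14, 0, 0⟩,
              ⟨1 / 2, -4, 247 / 500, 73 / 100⟩])
            (.leaf (9 / 50) (357 / 100) (29 / 20) ⟨39 / 50, -2, 13 / 10, 159 / 100⟩ [⟨1 / 2, -18, 107 / 250, 687 / 1000⟩])))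
        (.leaf (9 / 50) (357 / 100) (29 / 20) ⟨81 / 100, -2, 159 / 100, 41 / 20⟩ [⟨7 / 10, -24, 671 / 1000, 561 / 500⟩,
          ⟨1 / 2, -4, 453 / 500, 1183 / 1000⟩]))
      (.leaf (11 / 50) (87 / 20) (31 / 20) ⟨18 / 25, 4, 587 / 500, 2227 / 1000⟩ [⟨1 / 2, -7, 103 / 250, 1151 / 1000⟩])))

lemma tree1_ok : tree1.ok (69 / 100) (3) (707 / 10000) (171 / 500) = true := by decide +kernel

/-- certificate data -/
def tree2 : Tr :=
  (.st (13 / 2)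
    (.su (47 / 1250)
      (.leaf (1 / 10) (53 / 20) (201 / 200) ⟨199 / 200, -174, 0, 0⟩ [⟨43 / 50, -174, 0, 0⟩,
        ⟨1 / 2, -38, 741 / 1000, 379 / 250⟩])
      (.st (19 / 4)
        (.su (103 / 2000)
          (.leaf (1 / 10) (53 / 20) (11 / 10) ⟨99 / 100, -56, 469 / 1000, 183 / 125⟩ [⟨91 / 100, -146, 0, 0⟩,
            ⟨1 / 2, -57, 273 / 1000, 487 / 500⟩])
          (.leaf (7 / 50) (76 / 25) (11 / 10) ⟨24 / 25, -56, 469 / 1000, 183 / 125⟩ [⟨9 / 10, -90, 0, 0⟩,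
            ⟨1 / 2, -52, 447 / 1000, 259 / 250⟩]))
        (.leaf (3 / 25) (283 / 100) (107 / 100) ⟨47 / 50, -70, 289 / 250, 1791 / 1000⟩ [⟨1 / 2, -73, 741 / 1000, 1193 / 1000⟩])))
    (.leaf (4 / 25) (82 / 25) (21 / 20) ⟨24 / 25, -83, 157 / 100, 1239 / 500⟩ [⟨1 / 2, -90, 1, 829 / 500⟩]))

lemma tree2_ok : tree2.ok (3) (10) (1 / 50) (707 / 10000) = true := by decide +kernel

/-- certificate data -/
def tree3 : Tr :=
  (.st (13 / 2)
    (.su (161 / 1250)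
      (.leaf (4 / 25) (82 / 25) (6 / 5) ⟨91 / 100, -30, 1341 / 1000, 2449 / 1000⟩ [⟨83 / 100, -57, 44 / 125, 87 / 50⟩,
        ⟨53 / 100, -29, 453 / 500, 409 / 250⟩,
        ⟨1 / 2, 18, 349 / 250, 1923 / 1000⟩])
      (.leaf (13 / 50) (287 / 50) (13 / 10) ⟨17 / 20, -16, 1691 / 1000, 1361 / 500⟩ [⟨1 / 2, -35, 79 / 100, 1541 / 1000⟩]))
    (.leaf (13 / 50) (287 / 50) (23 / 20) ⟨87 / 100, -41, 1131 / 500, 3023 / 1000⟩ [⟨1 / 2, -41, 1491 / 1000, 1993 / 1000⟩]))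

lemma tree3_ok : tree3.ok (3) (10) (707 / 10000) (47 / 200) = true := by decide +kernel


end GB

end

section

open MeasureTheory ProbabilityTheory Real Set Filter Topology


namespace GB

lemma reg1 {t u : ℝ} (ht1 : 0.69 ≤ t) (ht2 : t ≤ 10) (hu1 : 0.02 ≤ u) (hu2 : u ≤ 0.342) :
    (22 / 100 ≤ (t + 119 / 100) * u ^ 2) ∨ Cert t u := by
  norm_num at ht1 hu1 hu2
  rcases le_total t 3 with h | h <;> rcases le_total u (707 / 10000) with h' | h'
  · exact Tr.sound _ tree0_ok (by push_cast; linarith) (by push_cast; linarith)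
      (by push_cast; linarith) (by push_cast; linarith)
  · exact Tr.sound _ tree1_ok (by push_cast; linarith) (by push_cast; linarith)
      (by push_cast; linarith) (by push_cast; linarith)
  · exact Tr.sound _ tree2_ok (by push_cast; linarith) (by push_cast; linarith)
      (by push_cast; linarith) (by push_cast; linarith)
  · rcases le_total u (47 / 200) with h4 | h4
    · exact Tr.sound _ tree3_ok (by push_cast; linarith) (by push_cast; linarith)
        (by push_cast; linarith) (by push_cast; linarith)
    · left
      nlinarith

lemma LOKq {j : ℤ} {q : ℚ} (h : LOK j q) (hq : 0 < q) : (j:ℝ) / 20 ≤ 2 * log (q:ℝ) :=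
  h.cast.sound (by exact_mod_cast hq)

lemma tauS {t u ρ : ℝ} (hu0 : 0 < u) (hl : 0.0999 * u ≤ |log ρ|) :
    -(u * tau t ρ) ≤ (8.55 - t) * u + 0.04 := by
  have hK := K0_gt
  have h0 := LOKq (show LOK (-211) (5228 / 1000000 : ℚ) by decide +kernel) (by norm_num)
  push_cast at h0
  have h1 : 0.2614 * u ≤ K0 * |log ρ| := by
    nlinarith [abs_nonneg (log ρ)]
  have h2 := Real.log_le_log (by positivity) h1
  have h3 := Real.log_le_sub_one_of_pos (show 0 < (5228 / 1000000 : ℝ) / (0.2614 * u) by positivity)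
  rw [Real.log_div (by norm_num) (by positivity)] at h3
  have h4 : u * ((5228 / 1000000 : ℝ) / (0.2614 * u)) = 0.02 := by field_simp; norm_num
  have h5 := mul_le_mul_of_nonneg_left h3 hu0.le
  have h6 := mul_le_mul_of_nonneg_left h2 hu0.le
  have h7 := mul_le_mul_of_nonneg_left h0 hu0.le
  unfold tau
  have h8 : u * ((5228 / 1000000 : ℝ) / (0.2614 * u) - 1) = 0.02 - u := by
    rw [mul_sub, h4]; ring
  rw [h8] at h5
  linarith

lemma Hmul {u X Y a h : ℝ} (hu0 : 0 < u) (ha : 0 < a) (hh : h * (a * u + 1.29) ≤ 8 - a)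
    (hY : 0 ≤ Y)
    (h1 : X ≤ (1 + h * u) * Y) : (a * u + 1.29) * X ≤ (8 * u + 1.29) * Y := by
  have h2 : (a * u + 1.29) * X ≤ (a * u + 1.29) * ((1 + h * u) * Y) := by
    apply mul_le_mul_of_nonneg_left h1; positivity
  refine h2.trans ?_
  rw [← mul_assoc]
  apply mul_le_mul_of_nonneg_right _ hY
  nlinarith

set_option maxHeartbeats 2000000 in
lemma reg2 {t u : ℝ} (ht1 : 0.69 ≤ t) (ht2 : t ≤ 10) (hu1 : 0 < u) (hu2 : u ≤ 0.02) :
    Cert t u := by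
  refine ⟨4 * u, 2.6, by positivity, by norm_num, by norm_num, ?_, ?_⟩
  · set l := 4 * u with hl
    have hl0 : 0 < l := by positivity
    have hl1 : l ≤ 0.08 := by linarith
    have h1 : 3 / 2 * l + l ^ 2 / 8 ≤ 1.51 * l := by nlinarith
    have h2 : exp (3 / 2 * l + l ^ 2 / 8) ≤ 1 + 1.61 * l := by
      refine (Real.exp_le_exp.2 h1).trans ?_
      refine (exp_up (by positivity) (by linarith)).trans ?_
      nlinarith [pow_pos hl0 2, pow_pos hl0 3, pow_pos hl0 4, mul_pos hl0 hl0,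
        mul_le_mul_of_nonneg_left hl1 (pow_pos hl0 1).le,
        mul_le_mul_of_nonneg_left hl1 (pow_pos hl0 2).le,
        mul_le_mul_of_nonneg_left hl1 (pow_pos hl0 3).le]
    have h3 := exp_neg_up (show 0 ≤ 2.6 * l by positivity)
    have h4 : 1 / expS (2.6 * l) ≤ 1 / (1 + 2.6 * l + (2.6 * l) ^ 2 / 2) := by
      apply one_div_le_one_div_of_le (by positivity)
      unfold expS
      have : 0 ≤ (2.6 * l) ^ 3 / 6 + (2.6 * l) ^ 4 / 24 + (2.6 * l) ^ 5 / 120 + (2.6 * l) ^ 6 / 720 := by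
        positivity
      linarith
    have h5 : 1 / (1 + 2.6 * l + (2.6 * l) ^ 2 / 2) ≤ 1 - 2 * l * (1 + 1.61 * l) := by
      rw [div_le_iff₀ (by positivity)]
      nlinarith [pow_pos hl0 2, pow_pos hl0 3, pow_pos hl0 4, mul_le_mul_of_nonneg_left hl1 (pow_pos hl0 1).le,
        mul_le_mul_of_nonneg_left hl1 (pow_pos hl0 2).le,
        mul_le_mul_of_nonneg_left hl1 (pow_pos hl0 3).le]
    have h6 := mul_le_mul_of_nonneg_left h2 (show 0 ≤ 2 * l by positivity)
    linarith
  · intro ρ hρ hρ1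
    have hdev : 4 * u / 8 + (t - 0.405) * u ^ 2 / (4 * u) = u * (0.5 + (t - 0.405) / 4) := by
      field_simp; ring
    rw [hdev]
    have hd1 : u * (0.5 + (t - 0.405) / 4) ≤ 0.06 := by nlinarith
    have hd2 : u * (u * (0.5 + (t - 0.405) / 4)) ≤ 0.06 * u := by nlinarith
    rcases le_or_gt (1 - 0.1 * u) ρ with hA | hB
    · -- type A
      have hl : 0.0999 * u ≤ |log (1 + 0.1 * u)| := by
        refine le_trans ?_ (le_abs_self _)
        refine le_trans ?_ (log_ge_A (by linarith))
        rw [le_div_iff₀ (by linarith)]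
        nlinarith
      have hτ := tauS (t := t) hu1 hl
      have hτ2 : -(tau t (1 + 0.1 * u) * u ^ 2) ≤ u * ((8.55 - t) * u + 0.04) := by nlinarith
      have hτ3 : u * ((8.55 - t) * u) ≤ u * ((10 - t) * 0.02) := by
        apply mul_le_mul_of_nonneg_left _ hu1.le; nlinarith
      have hs : 0 ≤ 2 * u * √((1 + 0.1 * u) * tau t (1 + 0.1 * u)) := by positivity
      refine ⟨1 + 0.1 * u, by linarith, by linarith, by linarith, ?_, ?_⟩
      · unfold c2u
        nlinarith
      · refine Hmul (h := 4.02) hu1 (by norm_num) (by nlinarith) (by linarith) ?_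
        unfold DDu
        nlinarith
    · have hx : 1 - ρ ≤ -log ρ := by linarith [Real.log_le_sub_one_of_pos (show 0 < ρ by linarith)]
      have habs : |log ρ| = -log ρ := abs_of_neg (Real.log_neg (by linarith) (by linarith))
      have hl : 0.0999 * u ≤ |log ρ| := by rw [habs]; linarith
      have hτ := tauS (t := t) hu1 hl
      have hτ2 : -(tau t ρ * u ^ 2) ≤ u * ((8.55 - t) * u + 0.04) := by nlinarith
      have hτ3 : u * ((8.55 - t) * u) ≤ u * ((10 - t) * 0.02) := by
        apply mul_le_mul_of_nonneg_left _ hu1.le; nlinarith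
      have hs : 0 ≤ 2 * u * √(ρ * tau t ρ) := by positivity
      refine ⟨ρ, by linarith, by linarith, le_rfl, ?_, ?_⟩
      · unfold c2u
        rcases le_or_gt 0.6 ρ with h6 | h6
        · nlinarith
        · have h1 : t + ((0:ℤ):ℝ) / 20 ≤ tau t ρ := by
            refine tau_ge (ℓ := 4 / 10) (by norm_num) ?_ (by rw [habs]; linarith)
            have := (show LOK 0 (26167 / 10000 * (4 / 10) : ℚ) by decide +kernel).cast
            push_cast at this; exact this
          have h2 : 0 ≤ tau t ρ := by push_cast at h1; linarith
          have : 0 ≤ 10 / 3 * tau t ρ * u ^ 2 := by positivity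
          linarith
      · refine Hmul (h := 4.02) hu1 (by norm_num) (by nlinarith) (by linarith) ?_
        unfold DDu
        rcases le_or_gt 0.97 ρ with h6 | h6
        · nlinarith
        · have h1 : t + ((-102:ℤ):ℝ) / 20 ≤ tau t ρ := by
            refine tau_ge (ℓ := 3 / 100) (by norm_num) ?_ (by rw [habs]; linarith)
            have := (show LOK (-102) (26167 / 10000 * (3 / 100) : ℚ) by decide +kernel).cast
            push_cast at this; exact this
          push_cast at h1
          have hu2' : 0 < u ^ 2 := by positivity
          have h2 : (t - 5.1) * u ^ 2 ≤ tau t ρ * u ^ 2 := by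
            apply mul_le_mul_of_nonneg_right _ hu2'.le; linarith
          rcases le_or_gt t 5.1 with h7 | h7
          · have h3 : (t - 5.1) * (0.02 * u) ≤ (t - 5.1) * u ^ 2 := by
              apply mul_le_mul_of_nonpos_left _ (by linarith); nlinarith
            nlinarith
          · have h4 : 0.3 * (t - 5.1) ≤ √(ρ * tau t ρ) := by
              apply Real.le_sqrt_of_sq_le
              nlinarith
            have h5 : 2 * u * (0.3 * (t - 5.1)) ≤ 2 * u * √(ρ * tau t ρ) := by gcongr
            have h8 : 0 ≤ (t - 5.1) * u ^ 2 := mul_nonneg (by linarith) hu2'.le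
            nlinarith

end GB

end

section

open MeasureTheory ProbabilityTheory Real Set Filter Topology


namespace GB

lemma condMono {a l0 l y E : ℝ} (h0 : 0 < l) (h1 : l ≤ l0) (hE : exp y ≤ E)
    (h : 2 * l0 * E ≤ 1 - exp (-(a * l0))) : 2 * l * exp y ≤ 1 - exp (-(a * l)) := by
  have hl0 : 0 < l0 := by linarith
  set θ := l / l0 with hθ
  have hθ0 : 0 ≤ θ := by positivity
  have hθ1 : θ ≤ 1 := by rw [hθ, div_le_one hl0]; exact h1
  have e : l = θ * l0 := by rw [hθ]; field_simp
  have hc := convexOn_exp.2 (Set.mem_univ (-(a * l0))) (Set.mem_univ 0) hθ0 (show 0 ≤ 1 - θ by linarith)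
    (by ring)
  simp only [smul_eq_mul, mul_zero, add_zero, Real.exp_zero, mul_one] at hc
  have e2 : -(a * l) = θ * -(a * l0) := by rw [e]; ring
  rw [e2]
  have h2 : 2 * l * exp y ≤ 2 * l * E := by gcongr
  have h3 : 2 * l * E = θ * (2 * l0 * E) := by rw [e]; ring
  have h4 := mul_le_mul_of_nonneg_left h hθ0
  linarith

lemma exp_num {y b : ℝ} (h0 : 0 ≤ y) (c : ℝ) (h : y ≤ c) (hc1 : c ≤ 1)
    (hb : 1 + c + c ^ 2 / 2 + c ^ 3 / 6 + c ^ 4 * 5 / 96 ≤ b) : exp y ≤ b :=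
  ((Real.exp_le_exp.2 h).trans (exp_up (h0.trans h) hc1)).trans hb

lemma exp_neg_num {z b : ℝ} (h0 : 0 ≤ z) (hb : 1 / expS z ≤ b) : exp (-z) ≤ b :=
  (exp_neg_up h0).trans hb

/-- the threshold for large `t` -/
def xone (t : ℝ) : ℝ := exp (-(0.3 * t))

lemma xone_pos (t : ℝ) : 0 < xone t := exp_pos _

lemma exp_neg3 : exp (-3) ≤ 0.0498 := by
  have h := Real.exp_one_gt_d9
  have e : exp (-3) = (exp 1 ^ 3)⁻¹ := by rw [Real.exp_one_pow, Real.exp_neg]; norm_num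
  rw [e]
  have h2 : (2.7182 : ℝ) ^ 3 ≤ exp 1 ^ 3 := by gcongr; linarith
  refine (inv_anti₀ (by norm_num) h2).trans (by norm_num)

lemma xone_le {t : ℝ} (ht : 10 ≤ t) : xone t ≤ 0.0498 :=
  (Real.exp_le_exp.2 (by linarith)).trans exp_neg3

lemma xone_t {t : ℝ} (ht : 10 ≤ t) : (t + 0.29) * xone t ≤ 0.5125 := by
  have h1 : xone t = exp (-3) * (exp (0.3 * (t - 10)))⁻¹ := by
    unfold xone; rw [← Real.exp_neg, ← Real.exp_add]; congr 1; ring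
  have h2 := Real.add_one_le_exp (0.3 * (t - 10))
  have h3 : t + 0.29 ≤ 10.29 * exp (0.3 * (t - 10)) := by nlinarith
  have h4 := exp_pos (0.3 * (t - 10))
  rw [h1, show (t + 0.29) * (exp (-3) * (exp (0.3 * (t - 10)))⁻¹) =
    exp (-3) * ((t + 0.29) / exp (0.3 * (t - 10))) by rw [div_eq_mul_inv]; ring]
  have h5 : (t + 0.29) / exp (0.3 * (t - 10)) ≤ 10.29 := by rw [div_le_iff₀ h4]; exact h3
  have h6 := exp_neg3
  have h7 : exp (-3) * ((t + 0.29) / exp (0.3 * (t - 10))) ≤ 0.0498 * 10.29 := by gcongr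
  exact h7.trans (by norm_num)

lemma tau_x1 {t ρ c : ℝ} (hc : 0 < c) (h : c * xone t ≤ |log ρ|) :
    0.4 * t + 2 * log (2.6167 * c) ≤ tau t ρ := by
  have hK := K0_gt
  have hx := xone_pos t
  have h1 : 2.6167 * c * xone t ≤ K0 * |log ρ| := by
    rw [mul_assoc]; gcongr
  have h2 := Real.log_le_log (by positivity) h1
  rw [Real.log_mul (by positivity) hx.ne'] at h2
  have h3 : log (xone t) = -(0.3 * t) := Real.log_exp _
  unfold tau
  linarith

lemma reg3a {t u : ℝ} (ht : 10 ≤ t) (hu : 0 < u) (hz : (t + 1.19) * u ^ 2 < 0.22) :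
    ∃ lam : ℝ, 0 < lam ∧ 2 * lam * exp (lam + lam * (1 - 1 / 2) + lam ^ 2 / 8) ≤ 1 - exp (-(8 * lam)) ∧
      ∀ ρ : ℝ, 1 / 2 < ρ → ρ ≤ exp (-xone t) →
        Num t u 8 (lam ^ 2 / 8 / lam + (t + 0.29) * u ^ 2 / lam) ρ := by
  set s := √(t + 0.29) * u with hs
  have hT : 0 < t + 0.29 := by linarith
  have hs0 : 0 < s := by positivity
  have hs2 : s ^ 2 = (t + 0.29) * u ^ 2 := by rw [hs, mul_pow, Real.sq_sqrt hT.le]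
  have hs3 : s ^ 2 < 0.22 := by rw [hs2]; nlinarith [sq_nonneg u]
  have hs4 : s ≤ 0.47 := by nlinarith
  have key : ∀ ρ : ℝ, 1 / 2 < ρ → ρ ≤ exp (-xone t) → ∀ dev : ℝ,
      dev ≤ 1.189 * s + 1.333 * s ^ 2 → Num t u 8 dev ρ := by
    intro ρ h1 h2 dev hdev
    have hx := xone_pos t
    have hρ1 : ρ < 1 := lt_of_le_of_lt h2 (by rw [Real.exp_lt_one_iff]; linarith)
    have hlog : log ρ ≤ -xone t := by
      have := Real.log_le_log (by linarith) h2
      rwa [Real.log_exp] at this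
    have habs : |log ρ| = -log ρ := abs_of_neg (by linarith)
    have hτ : 0.4 * (t + 0.29) ≤ tau t ρ ∧ 0.354 * (t + 0.29) ≤ ρ * tau t ρ := by
      rcases le_or_gt 0.9 ρ with h9 | h9
      · have e1 := tau_x1 (t := t) (ρ := ρ) (c := 1) one_pos (by rw [habs]; linarith)
        have e2 := LOKq (show LOK 38 (26167 / 10000 : ℚ) by decide +kernel) (by norm_num)
        push_cast at e2
        norm_num at e1 e2
        have e3 : 0.4 * t + 1.9 ≤ tau t ρ := by linarith
        constructor
        · linarith
        · nlinarith
      · have hx : 1 - ρ ≤ -log ρ := by linarith [Real.log_le_sub_one_of_pos (show 0 < ρ by linarith)]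
        have e1 : t + ((-54:ℤ):ℝ) / 20 ≤ tau t ρ := by
          refine tau_ge (ℓ := 1 / 10) (by norm_num) ?_ (by rw [habs]; linarith)
          have := (show LOK (-54) (26167 / 10000 * (1 / 10) : ℚ) by decide +kernel).cast
          push_cast at this; exact this
        push_cast at e1
        constructor
        · linarith
        · nlinarith
    have hsq : 0.5949 * √(t + 0.29) ≤ √(ρ * tau t ρ) := by
      apply Real.le_sqrt_of_sq_le
      rw [mul_pow, Real.sq_sqrt hT.le]
      linarith [hτ.2]
    have h5 : 1.189 * s ≤ 2 * u * √(ρ * tau t ρ) := by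
      have := mul_le_mul_of_nonneg_left hsq (show 0 ≤ 2 * u by positivity)
      rw [hs]; nlinarith
    have h6 : 1.333 * s ^ 2 ≤ 10 / 3 * tau t ρ * u ^ 2 := by
      rw [hs2]
      have := mul_le_mul_of_nonneg_right hτ.1 (sq_nonneg u)
      nlinarith [sq_nonneg u]
    refine ⟨ρ, by linarith, by linarith, le_rfl, ?_, ?_⟩
    · unfold c2u; nlinarith
    · unfold DDu
      apply mul_le_mul_of_nonneg_left _ (by positivity)
      linarith
  have hcond : ∀ l : ℝ, 0 < l → l ≤ 0.28 →
      2 * l * exp (l + l * (1 - 1 / 2) + l ^ 2 / 8) ≤ 1 - exp (-(8 * l)) := by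
    intro l h0 h1
    refine condMono h0 h1 (E := 1.54) ?_ ?_
    · refine exp_num (by positivity) 0.43 (by nlinarith) (by norm_num) (by norm_num)
    · have := exp_neg_num (z := 8 * 0.28) (b := 0.13) (by norm_num) (by unfold expS; norm_num)
      linarith
  rcases le_or_gt s 0.1 with h | h
  · refine ⟨2.8 * s, by positivity, hcond _ (by positivity) (by linarith), ?_⟩
    intro ρ h1 h2
    apply key ρ h1 h2
    rw [← hs2, show (2.8 * s) ^ 2 / 8 / (2.8 * s) + s ^ 2 / (2.8 * s) = (2.8 / 8 + 1 / 2.8) * s by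
      field_simp]
    nlinarith
  · refine ⟨0.28, by norm_num, hcond _ (by norm_num) le_rfl, ?_⟩
    intro ρ h1 h2
    apply key ρ h1 h2
    rw [← hs2]
    norm_num
    nlinarith

/-- form of the second large-`t` certificate -/
def CertB (t u : ℝ) : Prop := ∃ lam a ψ : ℝ, 0 < lam ∧ lam ≤ 1 ∧ 0 < a ∧ a ≤ 8 ∧
  (1 - exp (-xone t)) * lam ^ 2 / 2 * (1 + 4 * lam / 9) ≤ ψ ∧
  2 * lam * exp (lam + lam * (1 - exp (-xone t)) + ψ) ≤ 1 - exp (-(a * lam)) ∧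
  ∀ ρ : ℝ, exp (-xone t) < ρ → ρ ≤ 1 → Num t u a (ψ / lam + (t + 0.29) * u ^ 2 / lam) ρ

set_option maxHeartbeats 2000000 in
lemma reg3b1 {t u : ℝ} (ht : 10 ≤ t) (hu : 0 < u) (hz : (t + 1.19) * u ^ 2 < 0.22)
    (hux : 0.6 * xone t ≤ u) : CertB t u := by
  have hx := xone_pos t
  have hx1 := xone_le ht
  set X := xone t with hX
  have hp : 1 - exp (-X) ≤ X := by linarith [Real.add_one_le_exp (-X)]
  have hp0 : 0 ≤ 1 - exp (-X) := by
    have : exp (-X) ≤ 1 := by rw [Real.exp_le_one_iff]; linarith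
    linarith
  refine ⟨0.28, 8, 0.0441 * X, by norm_num, by norm_num, by norm_num, le_rfl, ?_, ?_, ?_⟩
  · norm_num; nlinarith
  · refine condMono (by norm_num) (le_refl (0.28:ℝ)) (E := 1.54) ?_ ?_
    · refine exp_num (by positivity) 0.43 (by nlinarith) (by norm_num) (by norm_num)
    · have := exp_neg_num (z := 8 * 0.28) (b := 0.13) (by norm_num) (by unfold expS; norm_num)
      linarith
  · intro ρ h1 h2
    have hl : 0.396 * X ≤ |log (1 + 0.4 * X)| := by
      refine le_trans ?_ (le_abs_self _)
      refine le_trans ?_ (log_ge_A (by linarith))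
      rw [le_div_iff₀ (by linarith)]
      nlinarith
    have hτ := tau_x1 (t := t) (by norm_num) hl
    have hlog : 0 ≤ log (2.6167 * 0.396) := Real.log_nonneg (by norm_num)
    have hτ2 : 0.4 * t ≤ tau t (1 + 0.4 * X) := by linarith
    set τ := tau t (1 + 0.4 * X) with hτd
    set s := √t * u with hs
    have hs0 : 0 < s := by
      have : 0 < √t := Real.sqrt_pos.2 (by linarith)
      positivity
    have hs2 : s ^ 2 = t * u ^ 2 := by rw [hs, mul_pow, Real.sq_sqrt (by linarith)]
    have hs3 : s ^ 2 < 0.22 := by rw [hs2]; nlinarith [sq_nonneg u]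
    have hs4 : s ≤ 0.46905 := by nlinarith
    have hsu : 3.162 * u ≤ s := by
      rw [hs]; gcongr
      apply Real.le_sqrt_of_sq_le; linarith
    have hu2 : u ^ 2 ≤ 0.1 * s ^ 2 := by rw [hs2]; nlinarith [sq_nonneg u]
    have hsq : 1.2649 * s ≤ 2 * u * √((1 + 0.4 * X) * τ) := by
      have : 0.63245 * √t ≤ √((1 + 0.4 * X) * τ) := by
        apply Real.le_sqrt_of_sq_le
        rw [mul_pow, Real.sq_sqrt (by linarith)]
        nlinarith
      have := mul_le_mul_of_nonneg_left this (show 0 ≤ 2 * u by positivity)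
      rw [hs]; linarith
    have h6 : 1.333 * s ^ 2 ≤ 10 / 3 * τ * u ^ 2 := by
      rw [hs2]
      have := mul_le_mul_of_nonneg_right hτ2 (sq_nonneg u)
      nlinarith [sq_nonneg u]
    refine ⟨1 + 0.4 * X, by linarith, by linarith, by linarith, ?_, ?_⟩
    · unfold c2u
      rw [← hτd]
      have : 0 ≤ s ^ 2 := sq_nonneg s
      linarith
    · unfold DDu
      rw [← hτd]
      apply mul_le_mul_of_nonneg_left _ (by positivity)
      have h7 : (t + 0.29) * u ^ 2 = s ^ 2 + 0.29 * u ^ 2 := by rw [hs2]; ring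
      rw [h7]
      have h8 : 1.5575 * X + 2.3424 * s ^ 2 ≤ 1.2649 * s := by
        rcases le_or_gt s 0.1894 with h9 | h9
        · have : s ^ 2 ≤ 0.1894 * s := by rw [sq]; gcongr
          linarith
        · have : 0 ≤ (s - 0.1894) * (0.46905 - s) := mul_nonneg (by linarith) (by linarith)
          have e : (s - 0.1894) * (0.46905 - s) = (0.1894 + 0.46905) * s - s ^ 2 - 0.1894 * 0.46905 := by ring
          rw [e] at this
          linarith
      have h9 : 0.0441 * X / 0.28 + (s ^ 2 + 0.29 * u ^ 2) / 0.28 ≤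
        0.1575 * X + 3.5715 * s ^ 2 + 0.10358 * s ^ 2 := by
        have e : 0.0441 * X / 0.28 + (s ^ 2 + 0.29 * u ^ 2) / 0.28 = 0.1575 * X + (s ^ 2 + 0.29 * u ^ 2) * (25 / 7) := by ring
        rw [e]
        linarith [sq_nonneg s]
      linarith

set_option maxHeartbeats 2000000 in
lemma reg3b2 {t u : ℝ} (ht : 10 ≤ t) (hu : 0 < u)
    (hux : u < 0.6 * xone t) : CertB t u := by
  have hx := xone_pos t
  have hx1 := xone_le ht
  have hxt := xone_t ht
  set X := xone t with hX
  have hp : 1 - exp (-X) ≤ X := by linarith [Real.add_one_le_exp (-X)]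
  have hp0 : 0 ≤ 1 - exp (-X) := by
    have : exp (-X) ≤ 1 := by rw [Real.exp_le_one_iff]; linarith
    linarith
  have hu3 : u ≤ 0.03 := by linarith
  set l := 0.3 * u / X with hl
  have hl0 : 0 < l := by positivity
  have hlX : l * X = 0.3 * u := by rw [hl]; field_simp
  have hl1 : l ≤ 0.18 := by rw [hl, div_le_iff₀ hx]; linarith
  refine ⟨l, 3.3, 0.54 * X * l ^ 2, hl0, by linarith, by norm_num, by norm_num, ?_, ?_, ?_⟩
  · have h1 : (1 - exp (-X)) * l ^ 2 ≤ X * l ^ 2 := by gcongr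
    have h2 : 0 ≤ X * l ^ 2 := by positivity
    have h3 : (1 - exp (-X)) * l ^ 2 / 2 * (1 + 4 * l / 9) ≤ X * l ^ 2 / 2 * 1.08 := by
      gcongr
      linarith
    linarith
  · refine condMono hl0 hl1 (E := 1.215) ?_ ?_
    · have h1 : l * (1 - exp (-X)) ≤ 0.18 * 0.0498 := by gcongr; linarith
      have h2 : X * l ^ 2 ≤ 0.0498 * 0.18 ^ 2 := by gcongr
      refine exp_num (by positivity) 0.192 (by linarith) (by norm_num) (by norm_num)
    · have := exp_neg_num (z := 3.3 * 0.18) (b := 0.553) (by norm_num) (by unfold expS; norm_num)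
      linarith
  · intro ρ h1 h2
    have hdev : 0.54 * X * l ^ 2 / l + (t + 0.29) * u ^ 2 / l = 0.162 * u + (t + 0.29) * X * u * (10 / 3) := by
      have e1 : 0.54 * X * l ^ 2 / l = 0.54 * (l * X) := by field_simp
      have e2 : (t + 0.29) * u ^ 2 / l = (t + 0.29) * X * u * (10 / 3) := by rw [hl]; field_simp; norm_num
      rw [e1, e2, hlX]; ring
    rw [hdev]
    set dev := 0.162 * u + (t + 0.29) * X * u * (10 / 3) with hd
    have hd1 : dev ≤ 1.871 * u := by
      have := mul_le_mul_of_nonneg_right hxt hu.le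
      rw [hd]; linarith
    have hd2 : u * dev ≤ 0.03 * (1.871 * u) := by
      calc u * dev ≤ u * (1.871 * u) := by gcongr
        _ ≤ 0.03 * (1.871 * u) := by gcongr
    have hτ : ∀ σ, 0.099 * u ≤ |log σ| → -(0.0200 * u) ≤ tau t σ * u ^ 2 := by
      intro σ h
      have hK := K0_gt
      have g1 : 0.259 * u ≤ K0 * |log σ| := by nlinarith [abs_nonneg (log σ)]
      have g2 := Real.log_le_log (by positivity) g1
      have g3 := Real.log_le_sub_one_of_pos (show 0 < exp (-(t / 2) - 1) / (0.259 * u) by positivity)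
      rw [Real.log_div (exp_pos _).ne' (by positivity), Real.log_exp] at g3
      have g4 : exp (-(t / 2) - 1) ≤ 0.0498 ^ 2 := by
        have : exp (-(t / 2) - 1) ≤ exp (-3) ^ 2 := by
          rw [← Real.exp_nat_mul, Real.exp_le_exp]; push_cast; linarith
        refine this.trans ?_
        have := exp_neg3
        gcongr
      have g5 : exp (-(t / 2) - 1) / (0.259 * u) ≤ 0.0098 / u := by
        rw [div_le_div_iff₀ (by positivity) hu]
        have := exp_pos (-(t / 2) - 1)
        nlinarith
      have g6 : -(2 * (0.0098 / u)) ≤ tau t σ := by unfold tau; linarith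
      have g7 := mul_le_mul_of_nonneg_right g6 (sq_nonneg u)
      have g8 : -(2 * (0.0098 / u)) * u ^ 2 = -(0.0196 * u) := by field_simp; norm_num
      rw [g8] at g7
      linarith
    have hρX : 1 - X ≤ ρ := by linarith [Real.add_one_le_exp (-X)]
    rcases le_or_gt (1 - 0.1 * u) ρ with hA | hB
    · have hl : 0.099 * u ≤ |log (1 + 0.1 * u)| := by
        refine le_trans ?_ (le_abs_self _)
        refine le_trans ?_ (log_ge_A (by linarith))
        rw [le_div_iff₀ (by linarith)]
        nlinarith
      have h3 := hτ _ hl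
      have hs : 0 ≤ 2 * u * √((1 + 0.1 * u) * tau t (1 + 0.1 * u)) := by positivity
      refine ⟨1 + 0.1 * u, by linarith, by linarith, by linarith, ?_, ?_⟩
      · unfold c2u; nlinarith
      · refine Hmul (h := 3.38) hu (by norm_num) (by linarith) (by linarith) ?_
        unfold DDu
        nlinarith
    · have hx : 1 - ρ ≤ -log ρ := by linarith [Real.log_le_sub_one_of_pos (show 0 < ρ by linarith)]
      have habs : |log ρ| = -log ρ := abs_of_neg (Real.log_neg (by linarith) (by linarith))
      have h3 := hτ ρ (by rw [habs]; linarith)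
      have hs : 0 ≤ 2 * u * √(ρ * tau t ρ) := by positivity
      refine ⟨ρ, by linarith, by linarith, le_rfl, ?_, ?_⟩
      · unfold c2u; nlinarith
      · refine Hmul (h := 3.38) hu (by norm_num) (by linarith) (by linarith) ?_
        unfold DDu
        nlinarith

end GB

end

section

open MeasureTheory ProbabilityTheory Real Set Filter Topology


namespace GB

lemma reg0 {n : ℕ} {t : ℝ} {Rs V r : ℝ → ℝ} (h : FP n t Rs V r) (ht : log 2 ≤ t)
    (hz : 0.22 ≤ (t + 1.19) * (1 / √(n:ℝ)) ^ 2) {δ : ℝ} (hδ : 0 ≤ δ) : 1 ≤ r δ := by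
  have hl := log_two_gt_d9
  have hn0 : (0:ℝ) < n := by exact_mod_cast h.hn
  have h1 : t + ((23:ℤ):ℝ) / 20 ≤ tau t 2 := by
    refine tau_ge (ℓ := 6931 / 10000) (by norm_num) ?_ ?_
    · have := (show LOK 23 (26167 / 10000 * (6931 / 10000) : ℚ) by decide +kernel).cast
      push_cast at this; exact this
    · rw [abs_of_pos (by linarith)]; linarith
  push_cast at h1
  have h2 : 0.215 ≤ tau t 2 / n := by
    rw [u_sq] at hz
    rw [le_div_iff₀ hn0]
    have h3 : 0.22 * n ≤ t + 1.19 := by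
      have := mul_le_mul_of_nonneg_right hz hn0.le
      rw [mul_assoc, one_div_mul_cancel hn0.ne', mul_one] at this
      exact this
    linarith
  have h3 := lemmaJ h ht hδ (ρ₀ := 2) (by norm_num) (by norm_num) ?_
  · rwa [min_eq_right (by norm_num)] at h3
  · rw [DD_eq]
    have h4 : 1.31 ≤ √(4 * 2 * (tau t 2 / n)) := by
      apply Real.le_sqrt_of_sq_le; linarith
    have := h.nonneg (V 2)
    linarith

lemma lev0 {S : Type*} [MeasurableSpace S] {P : Measure S} [IsProbabilityMeasure P]
    {F : Set (S → ℝ)} (hF : F.Countable) (hA : ∀ f ∈ F, Adm f) {n : ℕ} (hn : 1 ≤ n) {t : ℝ}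
    (ht : log 2 ≤ t) :
    ∃ B, (Measure.pi fun _ : Fin n => P) B ≤ ENNReal.ofReal (3 / 2 * exp (-t)) ∧
      ∀ x ∉ B, ∀ V r, FP n t (radSup n F x) V r → ∀ f ∈ F, 1 / 2 < ∫ s, f s ∂P →
        ∫ s, f s ∂P ≤ r (empMean n x f) := by
  have hl := log_two_gt_d9
  have hn0 : (0:ℝ) < n := by exact_mod_cast hn
  by_cases hz : 0.22 ≤ (t + 1.19) * (1 / √(n:ℝ)) ^ 2
  · refine ⟨∅, by simp, fun x _ V r hFP f hf _ => ?_⟩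
    exact ((hA f hf).mean P).2.trans (reg0 hFP ht hz (empMean_nonneg (hA f hf) x))
  push Not at hz
  have hn9 : 9 ≤ n := by
    rw [u_sq, mul_one_div, div_lt_iff₀ hn0] at hz
    have : (8:ℝ) < n := by linarith
    have : 8 < n := by exact_mod_cast this
    omega
  have hu0 : 0 < 1 / √(n:ℝ) := by positivity
  have hu1 : 1 / √(n:ℝ) ≤ 1 / 3 := by
    apply one_div_le_one_div_of_le (by norm_num)
    apply Real.le_sqrt_of_sq_le
    have : (9:ℝ) ≤ n := by exact_mod_cast hn9
    linarith
  rcases le_or_gt t 10 with ht10 | ht10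
  · have hcert : Cert t (1 / √(n:ℝ)) := by
      rcases le_or_gt (1 / √(n:ℝ)) 0.02 with h | h
      · exact reg2 (by linarith) ht10 hu0 h
      · rcases reg1 (t := t) (by linarith) ht10 h.le (by linarith) with h' | h'
        · exfalso; norm_num at hz h'; linarith
        · exact h'
    obtain ⟨lam, a, h0, ha, ha8, hc, hN⟩ := hcert
    obtain ⟨B, hB, hx⟩ := lev_I (P := P) hF hA hn9 ht (I := Ioi (1/2)) (p := 1 / 2) (by norm_num)
      (fun ρ hρ => (le_of_lt hρ)) ha ha8 h0 (τ := t - 0.405) (Or.inl (le_refl (lam ^ 2 / 8)))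
      (by
        rw [show lam + lam * (1 - 1 / 2) + lam ^ 2 / 8 = 3 / 2 * lam + lam ^ 2 / 8 by ring]
        exact hc)
      (by
        intro ρ hρ hρ1
        rw [show lam ^ 2 / 8 / lam = lam / 8 by field_simp]
        exact hN ρ hρ hρ1)
    refine ⟨B, hB.trans (ENNReal.ofReal_le_ofReal ?_), fun x hxB V r hFP f hf h => hx x hxB V r hFP f hf h⟩
    rw [show -(t - 0.405) = 0.405 + -t by ring, Real.exp_add]
    gcongr
    exact exp_num (by norm_num) 0.405 le_rfl (by norm_num) (by norm_num)
  · obtain ⟨lam, h0, hc, hN⟩ := reg3a ht10.le hu0 hz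
    obtain ⟨B1, hB1, hx1⟩ := lev_I (P := P) hF hA hn9 ht (I := Ioc (1/2) (exp (-xone t))) (p := 1 / 2)
      (by norm_num) (fun ρ hρ => hρ.1.le) (by norm_num : (0:ℝ) < 8) le_rfl h0 (τ := t + 0.29)
      (Or.inl (le_refl (lam ^ 2 / 8))) hc (fun ρ hρ _ => hN ρ hρ.1 hρ.2)
    have hcert : CertB t (1 / √(n:ℝ)) := by
      rcases le_or_gt (0.6 * xone t) (1 / √(n:ℝ)) with h | h
      · exact reg3b1 ht10.le hu0 hz h
      · exact reg3b2 ht10.le hu0 h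
    obtain ⟨lam2, a, ψ, g0, g1, ga, ga8, hψ, gc, gN⟩ := hcert
    obtain ⟨B2, hB2, hx2⟩ := lev_I (P := P) hF hA hn9 ht (I := Ioi (exp (-xone t))) (p := exp (-xone t))
      (by rw [Real.exp_le_one_iff]; linarith [xone_pos t]) (fun ρ hρ => le_of_lt hρ) ga ga8 g0 (τ := t + 0.29)
      (Or.inr ⟨hψ, g1⟩) gc (fun ρ hρ h => gN ρ hρ h)
    refine ⟨B1 ∪ B2, ?_, ?_⟩
    · refine (measure_union_le _ _).trans ((add_le_add hB1 hB2).trans ?_)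
      rw [← ENNReal.ofReal_add (exp_pos _).le (exp_pos _).le]
      apply ENNReal.ofReal_le_ofReal
      have h1 := exp_neg_num (z := 0.29) (b := 0.75) (by norm_num) (by unfold expS; norm_num)
      rw [show -(t + 0.29) = -0.29 + -t by ring, Real.exp_add]
      have := mul_le_mul_of_nonneg_right h1 (exp_pos (-t)).le
      linarith
    · intro x hx V r hFP f hf h
      simp only [Set.mem_union, not_or] at hx
      rcases le_or_gt (∫ s, f s ∂P) (exp (-xone t)) with h' | h'
      · exact hx1 x hx.1 V r hFP f hf ⟨h, h'⟩
      · exact hx2 x hx.2 V r hFP f hf h'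

lemma exp_tauj (t : ℝ) {j : ℕ} (hj : 1 ≤ j) :
    exp (-tauj t j) = exp (-t) * (3 / π ^ 2) * (1 / (j:ℝ) ^ 2) := by
  have hj0 : (0:ℝ) < j := by exact_mod_cast hj
  have hp : 0 < π / √3 * j := by positivity
  unfold tauj
  rw [show -(t + 2 * log (π / √3 * j)) = -t + -(log (π / √3 * j) + log (π / √3 * j)) by ring,
    Real.exp_add, Real.exp_neg (log _ + log _), Real.exp_add, Real.exp_log hp, mul_assoc (exp (-t))]
  congr 1
  have h3 : √(3:ℝ) * √3 = 3 := Real.mul_self_sqrt (by norm_num)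
  have hs : 0 < √(3:ℝ) := by positivity
  field_simp
  rw [sq, h3]

lemma all_levels {S : Type*} [MeasurableSpace S] {P : Measure S} [IsProbabilityMeasure P]
    {F : Set (S → ℝ)} (hF : F.Countable) (hA : ∀ f ∈ F, Adm f) {n : ℕ} (hn : 1 ≤ n) {t : ℝ}
    (ht : log 2 ≤ t) :
    ∃ B, (Measure.pi fun _ : Fin n => P) B ≤ ENNReal.ofReal (2 * exp (-t)) ∧
      ∀ x ∉ B, ∀ V r, FP n t (radSup n F x) V r → ∀ f ∈ F,
        ∫ s, f s ∂P ≤ r (empMean n x f) := by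
  obtain ⟨B0, hB0, hx0⟩ := lev0 (P := P) hF hA hn ht
  choose! B hB hxB using fun (j : ℕ) (hj : 1 ≤ j) => level (P := P) hF hA hn ht hj
  refine ⟨B0 ∪ ⋃ j : ℕ, B (j + 1), ?_, ?_⟩
  · refine (measure_union_le _ _).trans ?_
    have hsum : HasSum (fun j : ℕ => exp (-tauj t (j + 1))) (exp (-t) / 2) := by
      have h1 := hasSum_zeta_two
      rw [← hasSum_nat_add_iff' 1] at h1
      have h2 := h1.mul_left (exp (-t) * (3 / π ^ 2))
      have e1 : (fun j : ℕ => exp (-tauj t (j + 1))) =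
          fun i : ℕ => exp (-t) * (3 / π ^ 2) * (1 / ((i + 1 : ℕ) : ℝ) ^ 2) := by
        funext j
        exact exp_tauj t (by omega)
      have e2 : exp (-t) / 2 = exp (-t) * (3 / π ^ 2) *
          (π ^ 2 / 6 - ∑ i ∈ Finset.range 1, 1 / (i : ℝ) ^ 2) := by
        simp
        field_simp
        norm_num
      rw [e1, e2]
      exact h2
    have h2 : (Measure.pi fun _ : Fin n => P) (⋃ j : ℕ, B (j + 1)) ≤ ENNReal.ofReal (exp (-t) / 2) := by
      refine (measure_iUnion_le _).trans ?_
      rw [← hsum.tsum_eq, ENNReal.ofReal_tsum_of_nonneg (fun _ => (exp_pos _).le) hsum.summable]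
      exact ENNReal.tsum_le_tsum fun j => hB (j + 1) (by omega)
    refine (add_le_add hB0 h2).trans ?_
    rw [← ENNReal.ofReal_add (by positivity) (by positivity)]
    apply ENNReal.ofReal_le_ofReal
    linarith
  · intro x hx V r hFP f hf
    simp only [Set.mem_union, Set.mem_iUnion, not_or, not_exists] at hx
    have hm := (hA f hf).mean P
    rcases eq_or_lt_of_le hm.1 with h0 | h0
    · rw [← h0]; exact level_zero hA ht hFP hf
    rcases lt_or_ge (1/2) (∫ s, f s ∂P) with h1 | h1
    · exact hx0 x hx.1 V r hFP f hf h1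
    · have hex : ∃ j : ℕ, (1/2:ℝ) ^ (j + 1) < ∫ s, f s ∂P := by
        obtain ⟨k, hk⟩ := exists_pow_lt_of_lt_one h0 (show (1/2:ℝ) < 1 by norm_num)
        refine ⟨k, lt_of_le_of_lt ?_ hk⟩
        exact pow_le_pow_of_le_one (by norm_num) (by norm_num) (by omega)
      classical
      obtain ⟨j, hj, hmin⟩ : ∃ j : ℕ, (1/2:ℝ) ^ (j + 1) < ∫ s, f s ∂P ∧
          ∀ k < j, ¬ (1/2:ℝ) ^ (k + 1) < ∫ s, f s ∂P :=
        ⟨Nat.find hex, Nat.find_spec hex, fun k hk => Nat.find_min hex hk⟩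
      rcases j with _ | j
      · exfalso; norm_num at hj; norm_num at h1; linarith
      · have h2 := hmin j (by omega)
        push Not at h2
        exact hxB (j + 1) (by omega) x (hx.2 j) V r hFP f hf hj h2

end GB

end

/-- With `U(δ)` and `r(δ)` the (sample-dependent) largest solutions of the
two fixed-point equations involving the localized Rademacher complexities, with probability
at least `1 - 2e^{-t}`, simultaneously for all `f ∈ 𝓕`, `P f ≤ r(Pₙ f)`. -/
theorem generalization_bound_fixed_point
    {S : Type*} [MeasurableSpace S] (P : Measure S) [IsProbabilityMeasure P]
    (n : ℕ) (hn : 1 ≤ n)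
    (𝓕 : Set (S → ℝ)) (h𝓕 : 𝓕.Countable) (hmeas : ∀ f ∈ 𝓕, Measurable f)
    (hrange : ∀ f ∈ 𝓕, ∀ s, f s ∈ Icc (0 : ℝ) 1)
    (t : ℝ) (ht : 0 < t)
    (U : (Fin n → S) → ℝ → ℝ)
    (hU : ∀ x δ,
      U x δ = δ + 8 * radSup n 𝓕 x (U x δ) +
        Real.sqrt (2 * δ * (t + ell δ) / n) + 10 * (t + ell δ) / (3 * n) ∧
      ∀ u : ℝ, u = δ + 8 * radSup n 𝓕 x u +
          Real.sqrt (2 * δ * (t + ell δ) / n) + 10 * (t + ell δ) / (3 * n) → u ≤ U x δ)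
    (r : (Fin n → S) → ℝ → ℝ)
    (hr : ∀ x δ,
      r x δ = δ + 8 * radSup n 𝓕 x (U x (2 * r x δ)) +
        Real.sqrt (4 * r x δ * (t + ell (2 * r x δ)) / n) +
        10 * (t + ell (2 * r x δ)) / (3 * n) ∧
      ∀ ρ : ℝ, ρ = δ + 8 * radSup n 𝓕 x (U x (2 * ρ)) +
          Real.sqrt (4 * ρ * (t + ell (2 * ρ)) / n) +
          10 * (t + ell (2 * ρ)) / (3 * n) → ρ ≤ r x δ) :
    ENNReal.ofReal (1 - 2 * Real.exp (-t)) ≤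
      (Measure.pi fun _ : Fin n => P) {x | ∀ f ∈ 𝓕,
        ∫ s, f s ∂P ≤ r x (empMean n x f)} := by
  by_cases htl : t < Real.log 2
  · have h1 : (1:ℝ) / 2 ≤ Real.exp (-t) := by
      have h2 : Real.exp (-Real.log 2) ≤ Real.exp (-t) := Real.exp_le_exp.2 (by linarith)
      rw [Real.exp_neg, Real.exp_log (by norm_num)] at h2
      linarith
    rw [ENNReal.ofReal_of_nonpos (by linarith)]
    exact zero_le
  have hA : ∀ f ∈ 𝓕, GB.Adm f := fun f hf => ⟨hmeas f hf, hrange f hf⟩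
  obtain ⟨B, hB, hgood⟩ := GB.all_levels (P := P) h𝓕 hA hn (not_lt.1 htl)
  have hFP : ∀ x, GB.FP n t (radSup n 𝓕 x) (fun ρ => U x (2 * ρ)) (r x) := by
    intro x
    refine ⟨hn, ?_, ?_, ?_, ?_, ?_, ?_, ?_⟩
    · intro u v huv
      rw [GB.radSup_eq, GB.radSup_eq]
      exact GB.RadF_mono (fun f hf => (hA f hf.1).absle) fun f hf => ⟨hf.1, hf.2.trans huv⟩
    · intro u
      rw [GB.radSup_eq]
      exact GB.RadF_nonneg
    · intro u
      rw [GB.radSup_eq]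
      exact GB.RadF_le_one (fun f hf => (hA f hf.1).absle)
    · intro u hu
      rw [GB.radSup_one hn hA hu, GB.radSup_one hn hA le_rfl]
    · intro ρ
      have h := (hU x (2 * ρ)).1
      rw [GB.ell_two_mul, show 2 * (2 * ρ) = 4 * ρ by ring] at h
      simp only [GB.c2]
      linarith
    · intro ρ u hu
      have h := (hU x (2 * ρ)).2 u
      rw [GB.ell_two_mul, show 2 * (2 * ρ) = 4 * ρ by ring] at h
      simp only [GB.c2] at hu
      exact h (by linarith)
    · intro δ ρ hρ
      have h := (hr x δ).2 ρ
      rw [GB.ell_two_mul] at h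
      simp only [GB.DD] at hρ
      exact h (by linarith)
  set μ := (Measure.pi fun _ : Fin n => P) with hμ
  have hsub : (toMeasurable μ B)ᶜ ⊆ {x | ∀ f ∈ 𝓕, ∫ s, f s ∂P ≤ r x (empMean n x f)} := by
    intro x hx f hf
    exact hgood x (fun hxB => hx (subset_toMeasurable μ B hxB)) _ _ (hFP x) f hf
  calc ENNReal.ofReal (1 - 2 * Real.exp (-t))
      = 1 - ENNReal.ofReal (2 * Real.exp (-t)) := by
        rw [ENNReal.ofReal_sub _ (by positivity), ENNReal.ofReal_one]
    _ ≤ 1 - μ B := tsub_le_tsub_left hB 1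
    _ = μ (toMeasurable μ B)ᶜ := by
        rw [prob_compl_eq_one_sub (measurableSet_toMeasurable μ B), measure_toMeasurable]
    _ ≤ _ := measure_mono hsub
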